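/- There exists an absolute constant c such that for every primitive homogeneous polynomial f ∈ ℤ[x_0,x_1,x_2] of degree d ≥ 1 that is irreducible over ℚ, and every real B ≥ 1, one has N(f,B) ≤ c·B^{2/d}·d^4·b(f)/‖f‖^{1/d^2} + c·d·log B + c·d^4. -/

import Mathlib

/-- The number of rational points of `ℙ^{N-1}(ℚ)` of height at most `B` lying on the
projective hypersurface cut out by the homogeneous polynomial `f ∈ ℤ[x_0,…,x_{N-1}]`.
A point is counted via a primitive integer coordinate vector, all of whose entries
have absolute value at most `B`. -/
noncomputable def Nproj {N : ℕ} (f : MvPolynomial (Fin N) ℤ) (B : ℝ) : ℕ :=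
  Set.ncard {P : Projectivization ℚ (Fin N → ℚ) |
    ∃ (v : Fin N → ℤ) (hv : (fun i => (v i : ℚ)) ≠ 0),
      Finset.univ.gcd v = 1 ∧
      MvPolynomial.eval v f = 0 ∧ (∀ i, |(v i : ℝ)| ≤ B) ∧
      P = Projectivization.mk ℚ (fun i => (v i : ℚ)) hv}

/-- The maximum of the absolute values of the coefficients of `f`, as a real number. -/
noncomputable def normMax {σ : Type*} (f : MvPolynomial σ ℤ) : ℝ :=
  ((f.support.sup fun m => (f.coeff m).natAbs : ℕ) : ℝ)

open Classical in
/-- The badness `b(f)`: `0` if `f` is not absolutely irreducible, and otherwise the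
product of `exp(log p / p)` over the primes `p > 27 d^4` (where `d = deg f`) modulo
which `f` is not irreducible over the algebraic closure of `F_p`. -/
noncomputable def badness {σ : Type*} (f : MvPolynomial σ ℤ) : ℝ :=
  if Irreducible (MvPolynomial.map (Int.castRingHom (AlgebraicClosure ℚ)) f) then
    ∏ᶠ p ∈ {p : ℕ | ∃ hp : Nat.Prime p,
        27 * f.totalDegree ^ 4 < p ∧
        ¬ Irreducible (letI : Fact (Nat.Prime p) := ⟨hp⟩;
          MvPolynomial.map (Int.castRingHom (AlgebraicClosure (ZMod p))) f)},
      Real.exp (Real.log p / p)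
  else 0

namespace PW
open MvPolynomial

/-- exponents of ternary monomials of degree `k` -/
abbrev monS (k : ℕ) : Finset (Fin 3 →₀ ℕ) := Finset.finsuppAntidiag Finset.univ k

lemma mem_monS {k : ℕ} {m : Fin 3 →₀ ℕ} : m ∈ monS k ↔ m.degree = k := by
  simp [monS, Finset.mem_finsuppAntidiag, Finsupp.degree_eq_sum]

lemma card_monS (k : ℕ) : (monS k).card = (k + 2).choose 2 := by
  have h := Finset.card_finsuppAntidiag_nat_eq_choose (ι := Fin 3) (s := Finset.univ) k
  simp at h
  rw [monS, h]
  have := Nat.choose_symm_add (a := k) (b := 2)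
  rw [← this, add_comm]

variable {K : Type*} [Field K]

lemma hom_eq_span (R : Type*) [CommSemiring R] (k : ℕ) : homogeneousSubmodule (Fin 3) R k =
    Submodule.span R (Set.range fun m : monS k => (monomial (m : Fin 3 →₀ ℕ) (1 : R))) := by
  apply le_antisymm
  · intro F hF
    rw [F.as_sum]
    refine Submodule.sum_mem _ fun m hm => ?_
    have : m ∈ monS k := mem_monS.2 (((mem_homogeneousSubmodule k F).1 hF).degree_eq_sum_deg_support hm).symm
    have h2 : monomial m (coeff m F) = coeff m F • monomial m (1 : R) := by
      simp [smul_monomial]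
    rw [h2]
    exact Submodule.smul_mem _ _ (Submodule.subset_span ⟨⟨m, this⟩, rfl⟩)
  · rw [Submodule.span_le]
    rintro _ ⟨m, rfl⟩
    exact isHomogeneous_monomial _ (mem_monS.1 m.2)

instance (k : ℕ) : FiniteDimensional K (homogeneousSubmodule (Fin 3) K k) := by
  rw [hom_eq_span]
  exact FiniteDimensional.span_of_finite K (Set.finite_range _)

lemma finrank_hom (k : ℕ) :
    Module.finrank K (homogeneousSubmodule (Fin 3) K k) = (k + 2).choose 2 := by
  rw [hom_eq_span, finrank_span_eq_card, Fintype.card_coe, card_monS]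
  exact ((basisMonomials (Fin 3) K).linearIndependent).comp _ Subtype.val_injective

lemma finrank_mul_hom {f : MvPolynomial (Fin 3) K} (hf : f ≠ 0) (k : ℕ) :
    Module.finrank K ((homogeneousSubmodule (Fin 3) K k).map (LinearMap.mulLeft K f))
      = (k + 2).choose 2 := by
  rw [← finrank_hom (K := K) k]
  exact (LinearEquiv.finrank_eq (Submodule.equivMapOfInjective (LinearMap.mulLeft K f)
    (mul_right_injective₀ hf) _)).symm

lemma dvd_hom {f F : MvPolynomial (Fin 3) K} {d k : ℕ} (hf : f.IsHomogeneous d) (hdk : d ≤ k)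
    (hF : F.IsHomogeneous k) (h : f ∣ F) : ∃ h : MvPolynomial (Fin 3) K,
      h.IsHomogeneous (k - d) ∧ F = f * h := by
  obtain ⟨a, rfl⟩ := h
  refine ⟨homogeneousComponent (k - d) a, homogeneousComponent_isHomogeneous _ _, ?_⟩
  conv_lhs => rw [← homogeneousComponent_eq_self hF]
  have h1 : f * a = ∑ i ∈ Finset.range (a.totalDegree + 1), f * homogeneousComponent i a := by
    rw [← Finset.mul_sum, sum_homogeneousComponent]
  rw [h1, map_sum]
  have h2 : ∀ i, homogeneousComponent k (f * homogeneousComponent i a) =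
      if i = k - d then f * homogeneousComponent (k - d) a else 0 := by
    intro i
    have h3 : f * homogeneousComponent i a ∈ homogeneousSubmodule (Fin 3) K (d + i) :=
      hf.mul (homogeneousComponent_isHomogeneous _ _)
    rw [homogeneousComponent_of_mem h3]
    by_cases hi : i = k - d
    · subst hi; simp; omega
    · rw [if_neg hi, if_neg (by omega)]
  simp_rw [h2]
  rw [Finset.sum_ite_eq']
  split_ifs with h4
  · rfl
  · rw [homogeneousComponent_eq_zero, mul_zero]
    simp at h4; omega

/-- dimension count behind Bezout -/
theorem bezout_functionals {ι : Type*} [Fintype ι] {f g : MvPolynomial (Fin 3) K} {d M k : ℕ}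
    (hf : f.IsHomogeneous d) (hirr : Irreducible f) (hg : g.IsHomogeneous M) (hfg : ¬ f ∣ g)
    (hk : d + M ≤ k) (φ : MvPolynomial (Fin 3) K →ₗ[K] (ι → K))
    (hφf : ∀ a, φ (f * a) = 0) (hφg : ∀ a, φ (g * a) = 0)
    (hsurj : ∀ w, ∃ F, F.IsHomogeneous k ∧ φ F = w) : Fintype.card ι ≤ d * M := by
  classical
  have hg0 : g ≠ 0 := fun h => hfg (h ▸ dvd_zero f)
  have hf0 := hirr.ne_zero
  set S := homogeneousSubmodule (Fin 3) K
  set U := (S (k - d)).map (LinearMap.mulLeft K f)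
  set V := (S (k - M)).map (LinearMap.mulLeft K g)
  set W := (S (k - d - M)).map (LinearMap.mulLeft K (f * g))
  have hUS : U ≤ S k := by
    rintro _ ⟨a, ha, rfl⟩
    have : (f * a).IsHomogeneous (d + (k - d)) := hf.mul ha
    rw [show d + (k - d) = k by omega] at this
    exact this
  have hVS : V ≤ S k := by
    rintro _ ⟨a, ha, rfl⟩
    have : (g * a).IsHomogeneous (M + (k - M)) := hg.mul ha
    rw [show M + (k - M) = k by omega] at this
    exact this
  have hUV : U ⊓ V ≤ W := by
    rintro _ ⟨⟨a, ha, rfl⟩, ⟨b, hb, hab⟩⟩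
    simp only [LinearMap.mulLeft_apply] at hab ⊢
    have h1 : f ∣ b := (hirr.prime.dvd_or_dvd ⟨a, hab⟩).resolve_left hfg
    obtain ⟨b', hb', rfl⟩ := dvd_hom hf (by omega) hb h1
    refine ⟨b', ?_, ?_⟩
    · rw [show k - d - M = k - M - d by omega]; exact hb'
    · simp only [LinearMap.mulLeft_apply]; rw [← hab]; ring
  haveI : FiniteDimensional K U := inferInstance
  haveI : FiniteDimensional K V := inferInstance
  have hsum := Submodule.finrank_sup_add_finrank_inf_eq U V
  have hinf : Module.finrank K (U ⊓ V : Submodule K _) ≤ (k - d - M + 2).choose 2 :=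
    (Submodule.finrank_mono hUV).trans (finrank_mul_hom (mul_ne_zero hf0 hg0) _).le
  have hU : Module.finrank K U = (k - d + 2).choose 2 := finrank_mul_hom hf0 _
  have hV : Module.finrank K V = (k - M + 2).choose 2 := finrank_mul_hom hg0 _
  let ψ : S k →ₗ[K] (ι → K) := φ.domRestrict (S k)
  have hψ : Function.Surjective ψ := by
    intro w
    obtain ⟨F, hF, h⟩ := hsurj w
    exact ⟨⟨F, hF⟩, h⟩
  have hrn := LinearMap.finrank_range_add_finrank_ker ψ
  rw [LinearMap.range_eq_top.2 hψ, finrank_top, Module.finrank_fintype_fun_eq_card, finrank_hom] at hrn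
  have hker : Module.finrank K (U ⊔ V : Submodule K _) ≤ Module.finrank K (LinearMap.ker ψ) := by
    have h1 : (U ⊔ V) ≤ (LinearMap.ker ψ).map (S k).subtype := by
      rw [sup_le_iff]
      constructor
      · intro x hx
        refine ⟨⟨x, hUS hx⟩, ?_, rfl⟩
        obtain ⟨a, ha, rfl⟩ := hx
        exact hφf a
      · intro x hx
        refine ⟨⟨x, hVS hx⟩, ?_, rfl⟩
        obtain ⟨a, ha, rfl⟩ := hx
        exact hφg a
    refine (Submodule.finrank_mono h1).trans ?_
    exact Submodule.finrank_map_le _ _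
  obtain ⟨t, rfl⟩ : ∃ t, k = d + M + t := ⟨k - (d + M), by omega⟩
  rw [show d + M + t - d - M = t by omega] at hinf
  rw [show d + M + t - d = M + t by omega] at hU
  rw [show d + M + t - M = d + t by omega] at hV
  have key : (d + M + t + 2).choose 2 + (t + 2).choose 2 =
      (M + t + 2).choose 2 + (d + t + 2).choose 2 + d * M := by
    have h := fun n : ℕ => Nat.triangle_succ n
    have hc : ∀ n : ℕ, ((n + 2).choose 2 : ℤ) * 2 = (n + 2) * (n + 1) := by
      intro n
      have := Nat.choose_two_right (n + 2)
      have h2 : (n + 2) * (n + 2 - 1) / 2 * 2 = (n + 2) * (n + 2 - 1) :=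
        Nat.div_mul_cancel (Nat.even_mul_pred_self (n + 2)).two_dvd
      rw [← this] at h2
      zify at h2
      simpa [show n + 2 - 1 = n + 1 by omega] using h2
    have h1 := hc (d + M + t)
    have h2 := hc t
    have h3 := hc (M + t)
    have h4 := hc (d + t)
    zify
    push_cast at h1 h2 h3 h4
    linarith
  omega

end PW

namespace PW
open MvPolynomial

variable {K : Type*} [Field K]

/-- `F` vanishes to order at least `n` at `v`, along the derivation `D`. -/
def ordge (D : Derivation K (MvPolynomial (Fin 3) K) (MvPolynomial (Fin 3) K)) (v : Fin 3 → K) :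
    ℕ → MvPolynomial (Fin 3) K → Prop
  | 0, _ => True
  | n + 1, F => eval v F = 0 ∧ ordge D v n (D F)

section
variable {D : Derivation K (MvPolynomial (Fin 3) K) (MvPolynomial (Fin 3) K)} {v : Fin 3 → K}

lemma ordge_iff (n : ℕ) (F : MvPolynomial (Fin 3) K) :
    ordge D v n F ↔ ∀ a < n, eval v ((D : _ → _)^[a] F) = 0 := by
  induction n generalizing F with
  | zero => simp [ordge]
  | succ n ih =>
    rw [ordge, ih]
    constructor
    · rintro ⟨h0, h⟩ a ha
      cases a with
      | zero => simpa using h0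
      | succ a => simpa using h a (by omega)
    · intro h
      exact ⟨by simpa using h 0 (by omega), fun a ha => by simpa using h (a + 1) (by omega)⟩

lemma ordge.mono {m n : ℕ} {F : MvPolynomial (Fin 3) K} (h : ordge D v n F) (hmn : m ≤ n) :
    ordge D v m F := by
  rw [ordge_iff] at *
  exact fun a ha => h a (by omega)

lemma ordge.add {n : ℕ} {F G : MvPolynomial (Fin 3) K} (h : ordge D v n F) (h' : ordge D v n G) :
    ordge D v n (F + G) := by
  induction n generalizing F G with
  | zero => trivial
  | succ n ih => exact ⟨by simp [h.1, h'.1], by rw [map_add]; exact ih h.2 h'.2⟩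

lemma ordge.mul {n a b : ℕ} (hab : a + b = n) {F G : MvPolynomial (Fin 3) K} (h : ordge D v a F)
    (h' : ordge D v b G) : ordge D v n (F * G) := by
  induction n generalizing F G a b with
  | zero => trivial
  | succ n ih =>
    refine ⟨?_, ?_⟩
    · rw [map_mul]
      rcases a with _ | a
      · rcases b with _ | b
        · omega
        · rw [h'.1, mul_zero]
      · rw [h.1, zero_mul]
    · rw [Derivation.leibniz]
      refine ordge.add ?_ ?_
      · rw [smul_eq_mul]
        rcases b with _ | b
        · exact ih (a := n) (b := 0) rfl (h.mono (by omega)) trivial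
        · exact ih (by omega) h h'.2
      · rw [smul_eq_mul]
        rcases a with _ | a
        · exact ih (a := n) (b := 0) rfl (h'.mono (by omega)) trivial
        · exact ih (a := b) (b := a) (by omega) h' h.2

lemma ordge.pow {n : ℕ} {F : MvPolynomial (Fin 3) K} (h : ordge D v 1 F) : ordge D v n (F ^ n) := by
  induction n with
  | zero => trivial
  | succ n ih => rw [pow_succ]; exact ordge.mul rfl ih h

lemma ordge.mul_right {n : ℕ} {F : MvPolynomial (Fin 3) K} (G : MvPolynomial (Fin 3) K)
    (h : ordge D v n F) : ordge D v n (F * G) := ordge.mul (a := n) (b := 0) rfl h trivial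

lemma iter_add (a : ℕ) (F G : MvPolynomial (Fin 3) K) :
    (D : _ → _)^[a] (F + G) = (D : _ → _)^[a] F + (D : _ → _)^[a] G := by
  induction a generalizing F G with
  | zero => rfl
  | succ a ih => simp [ih]

lemma iter_smul (a : ℕ) (c : K) (F : MvPolynomial (Fin 3) K) :
    (D : _ → _)^[a] (c • F) = c • (D : _ → _)^[a] F := by
  induction a generalizing F with
  | zero => rfl
  | succ a ih => simp [ih]

lemma eval_iter_pow (a : ℕ) (T Q : MvPolynomial (Fin 3) K) (hT : eval v T = 0) :
    eval v ((D : _ → _)^[a] (T ^ a * Q)) = (a.factorial : K) * eval v (D T) ^ a * eval v Q := by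
  induction a generalizing Q with
  | zero => simp
  | succ a ih =>
    rw [Function.iterate_succ_apply, Derivation.leibniz, Derivation.leibniz_pow, iter_add, map_add]
    have h1 : ordge D v (a + 1) (T ^ (a + 1) • D Q) := by
      rw [smul_eq_mul]; exact (ordge.pow ⟨hT, trivial⟩).mul_right _
    rw [(ordge_iff _ _).1 h1 a (by omega), zero_add]
    have h2 : Q • (a + 1) • T ^ (a + 1 - 1) • D T = T ^ a * (((a + 1 : ℕ) : MvPolynomial (Fin 3) K) * D T * Q) := by
      simp only [smul_eq_mul, nsmul_eq_mul, Nat.add_sub_cancel]; ring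
    rw [h2, ih]
    simp only [map_mul, map_natCast, Nat.factorial_succ]; push_cast; ring

end

lemma exists_form_ne {v : Fin 3 → K} (hv : v ≠ 0) :
    ∃ E : MvPolynomial (Fin 3) K, E.IsHomogeneous 1 ∧ eval v E ≠ 0 := by
  obtain ⟨i, hi⟩ := Function.ne_iff.1 hv
  exact ⟨X i, isHomogeneous_X _ _, by simpa using hi⟩

lemma exists_form_sep {v w : Fin 3 → K} (hw : w ≠ 0) (h : ∀ c : K, v ≠ c • w) :
    ∃ L : MvPolynomial (Fin 3) K, L.IsHomogeneous 1 ∧ eval v L ≠ 0 ∧ eval w L = 0 := by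
  obtain ⟨i, hi⟩ := Function.ne_iff.1 hw
  simp only [Pi.zero_apply] at hi
  have : ∃ j, v j * w i - v i * w j ≠ 0 := by
    by_contra hc
    push Not at hc
    apply h (v i / w i)
    ext j
    have := hc j
    simp only [Pi.smul_apply, smul_eq_mul]
    field_simp
    linear_combination this
  obtain ⟨j, hj⟩ := this
  refine ⟨C (w i) * X j - C (w j) * X i, (isHomogeneous_C_mul_X _ _).sub (isHomogeneous_C_mul_X _ _),
    ?_, ?_⟩
  · simpa [mul_comm] using hj
  · simp [mul_comm]

/-- Bezout with multiplicities. -/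
theorem bezout_mult {ι : Type*} [Fintype ι] {f g : MvPolynomial (Fin 3) K} {d M ℓ : ℕ}
    (D : Derivation K (MvPolynomial (Fin 3) K) (MvPolynomial (Fin 3) K))
    (hf : f.IsHomogeneous d) (hirr : Irreducible f) (hg : g.IsHomogeneous M) (hfg : ¬ f ∣ g)
    (v : ι → Fin 3 → K) (hv : ∀ i, v i ≠ 0) (hvv : ∀ i j, i ≠ j → ∀ c : K, v i ≠ c • v j)
    (hfv : ∀ i, ordge D (v i) ℓ f)
    (hgv : ∀ i, ordge D (v i) ℓ g)
    (hfact : ∀ a < ℓ, (a.factorial : K) ≠ 0)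
    (hT : ℓ ≤ 1 ∨ ∀ i, ∃ T : MvPolynomial (Fin 3) K, T.IsHomogeneous 1 ∧ eval (v i) T = 0 ∧
      eval (v i) (D T) ≠ 0) :
    Fintype.card ι * ℓ ≤ d * M := by
  classical
  have hT' : ∀ i, ∃ T : MvPolynomial (Fin 3) K, T.IsHomogeneous 1 ∧ eval (v i) T = 0 ∧
      ∀ a < ℓ, eval (v i) (D T) ^ a ≠ 0 := by
    intro i
    rcases hT with h | h
    · refine ⟨0, isHomogeneous_zero _ _ _, by simp, fun a ha => ?_⟩
      obtain rfl : a = 0 := by omega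
      simp
    · obtain ⟨T, h1, h2, h3⟩ := h i
      exact ⟨T, h1, h2, fun a _ => pow_ne_zero _ h3⟩
  choose T hT1 hT0 hTD using hT'
  choose E hE1 hE0 using fun i => exists_form_ne (hv i)
  have hL : ∀ i j, ∃ L : MvPolynomial (Fin 3) K, L.IsHomogeneous 1 ∧ eval (v i) L ≠ 0 ∧
      (i ≠ j → eval (v j) L = 0) := by
    intro i j
    by_cases hij : i = j
    · exact ⟨E i, hE1 i, hE0 i, fun h => absurd hij h⟩
    · obtain ⟨L, h1, h2, h3⟩ := exists_form_sep (hv j) (hvv i j hij)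
      exact ⟨L, h1, h2, fun _ => h3⟩
  choose L hL1 hL0 hLz using hL
  set n := Fintype.card ι
  set k := d + M + n * ℓ + ℓ
  let φ : MvPolynomial (Fin 3) K →ₗ[K] (ι × Fin ℓ → K) :=
    { toFun := fun F q => eval (v q.1) ((D : _ → _)^[(q.2 : ℕ)] F)
      map_add' := fun F G => by ext q; simp [iter_add]
      map_smul' := fun c F => by ext q; simp [iter_smul] }
  have hφ0 : ∀ h : MvPolynomial (Fin 3) K, (∀ i, ordge D (v i) ℓ h) → ∀ a, φ (h * a) = 0 := by
    intro h hh a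
    ext q
    exact (ordge_iff _ _).1 ((hh q.1).mul_right a) q.2 q.2.2
  have := bezout_functionals (ι := ι × Fin ℓ) hf hirr hg hfg (k := k) (by omega) φ
    (hφ0 f hfv) (hφ0 g hgv) ?_
  · simpa using this
  -- surjectivity
  set R := (homogeneousSubmodule (Fin 3) K k).map φ with hR
  suffices hs : ∀ i : ι, ∀ m : ℕ, ∀ a : Fin ℓ, ℓ - a ≤ m → (Pi.single (i, a) (1 : K)) ∈ R by
    have htop : R = ⊤ := by
      rw [eq_top_iff]
      rintro w -
      rw [pi_eq_sum_univ' w]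
      refine Submodule.sum_mem _ fun q _ => Submodule.smul_mem _ _ ?_
      have := hs q.1 ℓ q.2 (by omega)
      convert this using 1
    intro w
    have : w ∈ R := htop ▸ Submodule.mem_top
    obtain ⟨F, h1, h2⟩ := this
    exact ⟨F, h1, h2⟩
  intro i m
  induction m with
  | zero => intro a ha; omega
  | succ m ih =>
    intro a ha
    let Q := (∏ j ∈ Finset.univ.erase i, L i j ^ ℓ) * E i ^ (k - a - (n - 1) * ℓ)
    let F := T i ^ (a : ℕ) * Q
    have hn : 1 ≤ n := Fintype.card_pos_iff.2 ⟨i⟩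
    have hF : F.IsHomogeneous k := by
      have h1 : (∏ j ∈ Finset.univ.erase i, L i j ^ ℓ).IsHomogeneous ((n - 1) * ℓ) := by
        have := IsHomogeneous.prod (Finset.univ.erase i) (fun j => L i j ^ ℓ) (fun _ => ℓ)
          (fun j _ => by simpa using (hL1 i j).pow ℓ)
        simpa [Finset.card_erase_of_mem, n] using this
      have h2 := ((hT1 i).pow a).mul (h1.mul ((hE1 i).pow (k - a - (n - 1) * ℓ)))
      have h3 : 1 * (a : ℕ) + ((n - 1) * ℓ + 1 * (k - a - (n - 1) * ℓ)) = k := by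
        have : (n - 1) * ℓ ≤ n * ℓ := Nat.mul_le_mul_right _ (by omega)
        have := a.2
        omega
      rw [h3] at h2
      exact h2
    have hQ : eval (v i) Q ≠ 0 := by
      simp only [Q, map_mul, map_prod, map_pow]
      exact mul_ne_zero (Finset.prod_ne_zero_iff.2 fun j _ => pow_ne_zero _ (hL0 i j))
        (pow_ne_zero _ (hE0 i))
    set c := φ F (i, a) with hc
    have hc0 : c ≠ 0 := by
      have : c = eval (v i) ((D : _ → _)^[(a : ℕ)] (T i ^ (a : ℕ) * Q)) := rfl
      rw [this, eval_iter_pow _ _ _ (hT0 i)]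
      exact mul_ne_zero (mul_ne_zero (hfact a a.2) (hTD i a a.2)) hQ
    have hlow : ∀ b : Fin ℓ, b < a → φ F (i, b) = 0 := by
      intro b hb
      have : ordge D (v i) a F := ordge.mul_right _ (ordge.pow ⟨hT0 i, trivial⟩)
      exact (ordge_iff _ _).1 this b hb
    have hoth : ∀ j, j ≠ i → ∀ b : Fin ℓ, φ F (j, b) = 0 := by
      intro j hj b
      have h1 : ordge D (v j) ℓ F := by
        have h2 : ordge D (v j) ℓ (L i j ^ ℓ) := ordge.pow ⟨hLz i j hj.symm, trivial⟩
        have h3 : F = L i j ^ ℓ * ((∏ j' ∈ (Finset.univ.erase i).erase j, L i j' ^ ℓ) *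
            E i ^ (k - a - (n - 1) * ℓ) * T i ^ (a : ℕ)) := by
          simp only [F, Q]
          rw [← Finset.mul_prod_erase (Finset.univ.erase i) (fun j' => L i j' ^ ℓ) (a := j) (by simp [hj])]
          ring
        rw [h3]
        exact h2.mul_right _
      exact (ordge_iff _ _).1 h1 b b.2
    have hFR : φ F ∈ R := ⟨F, hF, rfl⟩
    have hdec : φ F - ∑ b ∈ Finset.univ.filter (fun b : Fin ℓ => a < b), φ F (i, b) • Pi.single (i, b) (1 : K)
        = c • Pi.single (i, a) (1 : K) := by
      ext ⟨j, b⟩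
      simp only [Pi.sub_apply, Finset.sum_apply, Pi.smul_apply, Pi.single_apply, smul_eq_mul, Prod.mk.injEq]
      by_cases hj : j = i
      · subst hj
        simp only [true_and]
        rcases lt_trichotomy b a with h | h | h
        · rw [hlow b h, if_neg h.ne, mul_zero, Finset.sum_eq_zero, sub_zero]
          intro x hx
          simp only [Finset.mem_filter, Finset.mem_univ, true_and] at hx
          rw [if_neg (by intro h'; subst h'; exact absurd h (not_lt.2 hx.le)), mul_zero]
        · subst h
          rw [if_pos rfl, mul_one, Finset.sum_eq_zero, sub_zero]
          intro x hx
          simp only [Finset.mem_filter, Finset.mem_univ, true_and] at hx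
          rw [if_neg hx.ne, mul_zero]
        · rw [if_neg h.ne', mul_zero, Finset.sum_eq_single b]
          · simp
          · intro x _ hx
            rw [if_neg hx.symm, mul_zero]
          · intro h'; simp [h] at h'
      · rw [hoth j hj b]
        simp [hj]
    have h1 : c • Pi.single (i, a) (1 : K) ∈ R := by
      rw [← hdec]
      refine Submodule.sub_mem _ hFR (Submodule.sum_mem _ fun b hb => Submodule.smul_mem _ _ (ih b ?_))
      simp only [Finset.mem_filter, Finset.mem_univ, true_and] at hb
      have : (a : ℕ) < b := hb
      omega
    have h2 := Submodule.smul_mem _ c⁻¹ h1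
    rwa [smul_smul, inv_mul_cancel₀ hc0, one_smul] at h2

/-- Plain Bezout bound. -/
theorem bezout {ι : Type*} [Fintype ι] {f g : MvPolynomial (Fin 3) K} {d M : ℕ}
    (hf : f.IsHomogeneous d) (hirr : Irreducible f) (hg : g.IsHomogeneous M) (hfg : ¬ f ∣ g)
    (v : ι → Fin 3 → K) (hv : ∀ i, v i ≠ 0) (hvv : ∀ i j, i ≠ j → ∀ c : K, v i ≠ c • v j)
    (hfv : ∀ i, eval (v i) f = 0) (hgv : ∀ i, eval (v i) g = 0) :
    Fintype.card ι ≤ d * M := by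
  have := bezout_mult (ℓ := 1) 0 hf hirr hg hfg v hv hvv (fun i => ⟨hfv i, trivial⟩)
    (fun i => ⟨hgv i, trivial⟩) (fun a ha => by simp [Nat.lt_one_iff.1 ha]) (Or.inl le_rfl)
  simpa using this

end PW

namespace PW
open MvPolynomial

variable {K : Type*} [Field K]

lemma exists_minor {T n : Type*} [Fintype n] [DecidableEq n] (A : Matrix T n K)
    (hA : ∀ x : n → K, A.mulVec x = 0 → x = 0) :
    ∃ g : n → T, (A.submatrix g id).det ≠ 0 := by
  classical
  have htop : Submodule.span K (Set.range A) = ⊤ := by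
    by_contra hne
    obtain ⟨φ, hφ0, hφ⟩ := Submodule.exists_le_ker_of_lt_top _ (lt_top_iff_ne_top.2 hne)
    apply hφ0
    have hx := hA (fun i => φ (Pi.single i 1)) ?_
    · ext i
      simpa using congrFun hx i
    · ext t
      have h1 : φ (A t) = 0 := hφ (Submodule.subset_span ⟨t, rfl⟩)
      rw [LinearMap.pi_apply_eq_sum_univ] at h1
      simp only [Matrix.mulVec, dotProduct, Pi.zero_apply]
      rw [← h1]
      refine Finset.sum_congr rfl fun i _ => ?_
      rw [smul_eq_mul]
      congr 2
      ext j
      simp [Pi.single_apply, eq_comm]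
  obtain ⟨b, hb, hspan, hind⟩ := exists_linearIndependent K (Set.range A)
  rw [htop] at hspan
  let B : Module.Basis b K (n → K) := Module.Basis.mk hind (by simp [hspan])
  let e := (Pi.basisFun K n).indexEquiv B
  choose g hg using fun i : n => hb (e i).2
  refine ⟨g, ?_⟩
  have hli : LinearIndependent K (A.submatrix g id).row := by
    have : (A.submatrix g id).row = (fun x : b => (x : n → K)) ∘ e := by
      ext i j
      simp only [Matrix.row, Matrix.submatrix_apply, id, Function.comp]
      rw [← hg i]
    rw [this]
    exact hind.comp _ e.injective
  rw [Matrix.linearIndependent_rows_iff_isUnit, Matrix.isUnit_iff_isUnit_det] at hli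
  exact hli.ne_zero

/-- dimension of the degree `e` part of the coordinate ring of a plane curve of degree `d` -/
def hil (d e : ℕ) : ℕ := (e + 2).choose 2 - (e - d + 2).choose 2

lemma two_choose (n : ℕ) : ((n + 2).choose 2 : ℤ) * 2 = (n + 2) * (n + 1) := by
  have := Nat.choose_two_right (n + 2)
  have h2 : (n + 2) * (n + 2 - 1) / 2 * 2 = (n + 2) * (n + 2 - 1) :=
    Nat.div_mul_cancel (Nat.even_mul_pred_self (n + 2)).two_dvd
  rw [← this] at h2
  zify at h2
  simpa [show n + 2 - 1 = n + 1 by omega] using h2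

lemma hil_add (d e : ℕ) : hil d e + (e - d + 2).choose 2 = (e + 2).choose 2 :=
  Nat.sub_add_cancel (Nat.choose_le_choose 2 (by omega))

lemma two_hil {d e : ℕ} (h : d ≤ e) : (2 * hil d e : ℤ) = 2 * d * e + 3 * d - d ^ 2 := by
  obtain ⟨t, rfl⟩ := Nat.exists_eq_add_of_le h
  have h1 := hil_add d (d + t)
  rw [show d + t - d = t by omega] at h1
  have h2 := two_choose t
  have h3 := two_choose (d + t)
  zify at h1
  push_cast at h3 ⊢
  linarith

lemma hil_le {d e : ℕ} (h : d ≤ e) : hil d e ≤ d * e + d := by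
  have := two_hil h
  have h2 : (d : ℤ) ≤ d ^ 2 := by exact_mod_cast Nat.le_self_pow (by norm_num) d
  zify
  linarith

lemma finrank_quot {f : MvPolynomial (Fin 3) K} (hf0 : f ≠ 0) {d e : ℕ} (hf : f.IsHomogeneous d)
    (hde : d ≤ e) :
    Module.finrank K (homogeneousSubmodule (Fin 3) K e ⧸
      (((homogeneousSubmodule (Fin 3) K (e - d)).map (LinearMap.mulLeft K f)).comap
        (homogeneousSubmodule (Fin 3) K e).subtype)) = hil d e := by
  have h := Submodule.finrank_quotient_add_finrank
    (((homogeneousSubmodule (Fin 3) K (e - d)).map (LinearMap.mulLeft K f)).comap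
        (homogeneousSubmodule (Fin 3) K e).subtype)
  have hle : (homogeneousSubmodule (Fin 3) K (e - d)).map (LinearMap.mulLeft K f) ≤
      homogeneousSubmodule (Fin 3) K e := by
    rintro _ ⟨a, ha, rfl⟩
    have : (f * a).IsHomogeneous (d + (e - d)) := hf.mul ha
    rw [show d + (e - d) = e by omega] at this
    exact this
  rw [finrank_hom, (Submodule.comapSubtypeEquivOfLe hle).finrank_eq, finrank_mul_hom hf0] at h
  have := hil_add d e
  omega

lemma exists_reps {f : MvPolynomial (Fin 3) K} (hf0 : f ≠ 0) {d e : ℕ} (hf : f.IsHomogeneous d)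
    (hde : d ≤ e) : ∃ a : Fin (hil d e) → MvPolynomial (Fin 3) K, (∀ i, (a i).IsHomogeneous e) ∧
      ∀ c : Fin (hil d e) → K, f ∣ ∑ i, c i • a i → c = 0 := by
  set U := (((homogeneousSubmodule (Fin 3) K (e - d)).map (LinearMap.mulLeft K f)).comap
        (homogeneousSubmodule (Fin 3) K e).subtype) with hU
  let B := Module.finBasisOfFinrankEq K (homogeneousSubmodule (Fin 3) K e ⧸ U) (finrank_quot hf0 hf hde)
  choose a ha using fun i => Submodule.mkQ_surjective U (B i)
  refine ⟨fun i => a i, fun i => (a i).2, fun c hc => ?_⟩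
  have h1 : (∑ i, c i • a i) ∈ U := by
    have hh : (∑ i, c i • (a i : MvPolynomial (Fin 3) K)).IsHomogeneous e := by
      have := (∑ i, c i • a i).2
      simpa using this
    obtain ⟨h, h2, h3⟩ := dvd_hom hf hde hh hc
    refine ⟨h, h2, ?_⟩
    simp [h3]
  have h2 : ∑ i, c i • B i = 0 := by
    have := (Submodule.Quotient.mk_eq_zero U).2 h1
    rw [← Submodule.mkQ_apply, map_sum] at this
    simpa [ha] using this
  ext i
  exact Fintype.linearIndependent_iff.1 B.linearIndependent c h2 i

end PW

namespace PW
open MvPolynomial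

variable {K : Type*} [Field K]

lemma exists_ker_aux {ι : Type*} [Fintype ι] {ℓ : ℕ} (V : (k : Fin ℓ) → Type*)
    [∀ k, AddCommGroup (V k)] [∀ k, Module K (V k)] (L : ∀ k, (ι → K) →ₗ[K] V k)
    (hfin : ∀ k, FiniteDimensional K (V k)) (hlt : ∑ k, Module.finrank K (V k) < Fintype.card ι) :
    ∃ γ : ι → K, γ ≠ 0 ∧ ∀ k, L k γ = 0 := by
  have hk : LinearMap.ker (LinearMap.pi L) ≠ ⊥ := by
    apply LinearMap.ker_ne_bot_of_finrank_lt
    rw [Module.finrank_pi_fintype, Module.finrank_fintype_fun_eq_card]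
    exact hlt
  obtain ⟨γ, h1, h2⟩ := (Submodule.ne_bot_iff _).1 hk
  exact ⟨γ, h2, fun k => congrFun (LinearMap.mem_ker.1 h1) k⟩

lemma exists_ker {f : MvPolynomial (Fin 3) K} (hf0 : f ≠ 0) {d : ℕ} (hf : f.IsHomogeneous d)
    {ι : Type*} [Fintype ι] {ℓ : ℕ} (e : Fin ℓ → ℕ) (hde : ∀ k, d ≤ e k)
    (w : Fin ℓ → ι → MvPolynomial (Fin 3) K) (hw : ∀ k x, (w k x).IsHomogeneous (e k))
    (hlt : ∑ k, hil d (e k) < Fintype.card ι) :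
    ∃ γ : ι → K, γ ≠ 0 ∧ ∀ k, f ∣ ∑ x, γ x • w k x := by
  let U : ∀ k, Submodule K (homogeneousSubmodule (Fin 3) K (e k)) := fun k =>
    (((homogeneousSubmodule (Fin 3) K (e k - d)).map (LinearMap.mulLeft K f)).comap
        (homogeneousSubmodule (Fin 3) K (e k)).subtype)
  obtain ⟨γ, h2, h1⟩ := exists_ker_aux (ι := ι) (fun k => homogeneousSubmodule (Fin 3) K (e k) ⧸ U k)
    (fun k => (U k).mkQ ∘ₗ
      Fintype.linearCombination K (fun x => (⟨w k x, hw k x⟩ : homogeneousSubmodule (Fin 3) K (e k))))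
    (fun k => Module.Finite.quotient K (U k)) (by
      refine lt_of_eq_of_lt (Finset.sum_congr rfl fun k _ => finrank_quot hf0 hf (hde k)) hlt)
  refine ⟨γ, h2, fun k => ?_⟩
  have h3 := h1 k
  simp only [LinearMap.comp_apply, Pi.zero_apply, Submodule.mkQ_apply,
    Submodule.Quotient.mk_eq_zero] at h3
  obtain ⟨h, _, h5⟩ := h3
  refine ⟨h, ?_⟩
  simp only [LinearMap.mulLeft_apply, Submodule.subtype_apply, Fintype.linearCombination_apply] at h5
  rw [h5]
  simp

section
variable (f : MvPolynomial (Fin 3) K)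

/-- the tangent derivation of the curve -/
noncomputable def DT : Derivation K (MvPolynomial (Fin 3) K) (MvPolynomial (Fin 3) K) :=
  (X 0 * pderiv 2 f) • pderiv 1 - (X 0 * pderiv 1 f) • pderiv 2

lemma DT_apply (F : MvPolynomial (Fin 3) K) :
    DT f F = X 0 * pderiv 2 f * pderiv 1 F - X 0 * pderiv 1 f * pderiv 2 F := by
  simp [DT, Derivation.sub_apply]

lemma DT_self : DT f f = 0 := by rw [DT_apply]; ring

lemma DT_iter_mul (n : ℕ) (h : MvPolynomial (Fin 3) K) :
    (DT f : _ → _)^[n] (f * h) = f * (DT f : _ → _)^[n] h := by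
  induction n generalizing h with
  | zero => rfl
  | succ n ih =>
    rw [Function.iterate_succ_apply, Derivation.leibniz, DT_self, smul_zero, add_zero, smul_eq_mul, ih,
      Function.iterate_succ_apply]

lemma DT_iter_mul_of {g : MvPolynomial (Fin 3) K} (hg : DT f g = 0) (n : ℕ) (h : MvPolynomial (Fin 3) K) :
    (DT f : _ → _)^[n] (h * g) = (DT f : _ → _)^[n] h * g := by
  induction n generalizing h with
  | zero => rfl
  | succ n ih =>
    rw [Function.iterate_succ_apply, Derivation.leibniz, hg, smul_zero, zero_add, smul_eq_mul,
      mul_comm g, ih, Function.iterate_succ_apply]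

lemma iter_sum {D : Derivation K (MvPolynomial (Fin 3) K) (MvPolynomial (Fin 3) K)}
    {ι : Type*} (s : Finset ι) (F : ι → MvPolynomial (Fin 3) K) (n : ℕ) :
    (D : _ → _)^[n] (∑ i ∈ s, F i) = ∑ i ∈ s, (D : _ → _)^[n] (F i) := by
  induction n with
  | zero => rfl
  | succ n ih => simp only [Function.iterate_succ_apply', ih, map_sum]

lemma DT_hom {d n : ℕ} (_hd : 1 ≤ d) (hf : f.IsHomogeneous d) {F : MvPolynomial (Fin 3) K}
    (hF : F.IsHomogeneous n) : (DT f F).IsHomogeneous (n + (d - 1)) := by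
  rcases n with _ | n
  · have : F = C (coeff 0 F) := by
      rw [← totalDegree_eq_zero_iff_eq_C]
      exact Nat.le_zero.1 hF.totalDegree_le
    rw [this]
    simp [isHomogeneous_zero]
  · rw [DT_apply]
    have h1 : ∀ i j, (X 0 * pderiv i f * pderiv j F).IsHomogeneous (n + 1 + (d - 1)) := by
      intro i j
      have := ((isHomogeneous_X K (0 : Fin 3)).mul (hf.pderiv (i := i))).mul (hF.pderiv (i := j))
      convert this using 1
      omega
    exact (h1 _ _).sub (h1 _ _)

lemma DT_iter_hom {d n : ℕ} (hd : 1 ≤ d) (hf : f.IsHomogeneous d) {F : MvPolynomial (Fin 3) K}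
    (hF : F.IsHomogeneous n) (k : ℕ) : ((DT f : _ → _)^[k] F).IsHomogeneous (n + k * (d - 1)) := by
  induction k with
  | zero => simpa using hF
  | succ k ih =>
    rw [Function.iterate_succ_apply', add_mul, one_mul, ← add_assoc]
    exact DT_hom f hd hf ih

end

lemma good_T (f : MvPolynomial (Fin 3) K) {v : Fin 3 → K} (h0 : v 0 = 1)
    (h : eval v (pderiv 1 f) ≠ 0 ∨ eval v (pderiv 2 f) ≠ 0) :
    ∃ T : MvPolynomial (Fin 3) K, T.IsHomogeneous 1 ∧ eval v T = 0 ∧ eval v (DT f T) ≠ 0 := by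
  rcases h with h | h
  · refine ⟨X 2 - C (v 2) * X 0, (isHomogeneous_X _ _).sub (isHomogeneous_C_mul_X _ _), ?_, ?_⟩
    · simp [h0]
    · rw [DT_apply]
      simp [h0, pderiv_X, h]
  · refine ⟨X 1 - C (v 1) * X 0, (isHomogeneous_X _ _).sub (isHomogeneous_C_mul_X _ _), ?_, ?_⟩
    · simp [h0]
    · rw [DT_apply]
      simp [h0, pderiv_X, h]

section
variable {p : ℕ} [hp : Fact p.Prime]

lemma stepanov_indep {f : MvPolynomial (Fin 3) (ZMod p)} {d A n : ℕ}
    (hf : f.IsHomogeneous d) (hirr : Irreducible f) (hA : d * A < p)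
    (a : Fin n → MvPolynomial (Fin 3) (ZMod p)) (ha : ∀ i, (a i).IsHomogeneous A)
    (hind : ∀ c : Fin n → ZMod p, f ∣ ∑ i, c i • a i → c = 0)
    {v : Fin 3 → ZMod p} (h0 : v 0 = 1) (hv : eval v f = 0)
    (hgood : eval v (pderiv 1 f) ≠ 0 ∨ eval v (pderiv 2 f) ≠ 0)
    (c : Fin n → MvPolynomial (Fin 3) (ZMod p)) (hdvd : f ∣ ∑ i, a i * c i ^ p) :
    ∀ i, f ∣ c i := by
  classical
  have hprime : Prime f := hirr.prime
  obtain ⟨g, hg⟩ := exists_minor (T := Fin (d * A + 1)) (n := Fin n)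
    (fun k i => eval v ((DT f : _ → _)^[(k : ℕ)] (a i))) (by
      intro x hx
      apply hind
      by_contra hnd
      have := bezout_mult (ι := Unit) (ℓ := d * A + 1) (M := A) (DT f) hf hirr (g := ∑ i, x i • a i) ?_ hnd
        (fun _ => v) (fun _ h => by simpa [h0] using congrFun h 0) (fun i j h => (h rfl).elim) ?_ ?_ ?_
        (Or.inr fun _ => good_T f h0 hgood)
      · simp at this
      · exact (homogeneousSubmodule (Fin 3) (ZMod p) A).sum_mem fun i _ =>
          Submodule.smul_mem _ _ (ha i)
      · intro _
        rw [ordge_iff]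
        intro k _
        rcases k with _ | k
        · simpa using hv
        · rw [Function.iterate_succ_apply, DT_self]
          have : ∀ k, (DT f : _ → _)^[k] (0 : MvPolynomial (Fin 3) (ZMod p)) = 0 :=
            fun k => Function.iterate_fixed (map_zero _) k
          rw [this, map_zero]
      · intro _
        rw [ordge_iff]
        intro k hk
        have := congrFun hx ⟨k, hk⟩
        simp only [Matrix.mulVec, dotProduct, Pi.zero_apply] at this
        rw [iter_sum, map_sum, ← this]
        refine Finset.sum_congr rfl fun i _ => ?_
        rw [iter_smul, smul_eval]
        ring
      · intro k hk h
        rw [ZMod.natCast_eq_zero_iff, hp.out.dvd_factorial] at h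
        omega)
  set I := Ideal.span {f} with hI
  have hIp : I.IsPrime := (Ideal.span_singleton_prime hirr.ne_zero).2 hprime
  have hIv : I ≤ RingHom.ker (eval v) := by
    rw [hI, Ideal.span_singleton_le_iff_mem, RingHom.mem_ker, hv]
  let M : Matrix (Fin n) (Fin n) (MvPolynomial (Fin 3) (ZMod p)) :=
    fun k i => (DT f : _ → _)^[(g k : ℕ)] (a i)
  have hM : (M.map (Ideal.Quotient.mk I)).det ≠ 0 := by
    intro h
    rw [← RingHom.mapMatrix_apply, ← RingHom.map_det, Ideal.Quotient.eq_zero_iff_mem] at h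
    have h2 := hIv h
    rw [RingHom.mem_ker, RingHom.map_det] at h2
    exact hg h2
  have hz := Matrix.eq_zero_of_mulVec_eq_zero hM (v := fun i => Ideal.Quotient.mk I (c i) ^ p) (by
    ext k
    simp only [Matrix.mulVec, dotProduct, Pi.zero_apply, M]
    obtain ⟨h, hh⟩ := hdvd
    have h2 := congrArg (DT f : _ → _)^[(g k : ℕ)] hh
    rw [DT_iter_mul, iter_sum] at h2
    have hpow : ∀ c : MvPolynomial (Fin 3) (ZMod p), DT f (c ^ p) = 0 := by
      intro c
      rw [Derivation.leibniz_pow, ← Nat.cast_smul_eq_nsmul (ZMod p), CharP.cast_eq_zero, zero_smul]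
    simp only [DT_iter_mul_of f (hpow _)] at h2
    have h3 := congrArg (Ideal.Quotient.mk I) h2
    rw [map_sum, map_mul, (Ideal.Quotient.eq_zero_iff_mem (a := f)).2 (Ideal.mem_span_singleton_self f),
      zero_mul] at h3
    simp only [map_mul, map_pow] at h3
    exact h3)
  intro i
  have := congrFun hz i
  simp only [Pi.zero_apply] at this
  rw [← map_pow, Ideal.Quotient.eq_zero_iff_mem, hI, Ideal.mem_span_singleton] at this
  exact hprime.dvd_of_dvd_pow this

end
end PW

namespace PW
open MvPolynomial

lemma step_dA {d p q A : ℕ} (hd : 1 ≤ d) (hq : 20 * d ^ 2 ≤ q) (h1 : q * q ≤ p)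
    (hA1 : p ≤ d * A + d) : d ≤ A := by
  by_contra h
  push Not at h
  have h3 : d * A ≤ d * d := Nat.mul_le_mul_left _ h.le
  have h4 : d ≤ d ^ 2 := Nat.le_self_pow (by norm_num) d
  have h5 : 20 * q ≤ q * q := Nat.mul_le_mul_right _ (by omega)
  rw [← sq d] at h3
  omega

lemma step_dim {d p q A m ℓ : ℕ} (hd : 1 ≤ d) (hq : 20 * d ^ 2 ≤ q) (h1 : q * q ≤ p)
    (hA1 : p ≤ d * A + d) (hAp : d * A + 1 ≤ p) (hm : q < d * m) (hm2 : d * m ≤ q + d) (hℓ : ℓ + 9 * d ^ 2 = q) :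
    ∑ k : Fin ℓ, hil d (A + k * (d - 1) + m) < hil d A * hil d m := by
  have hdA : d ≤ A := step_dA hd hq h1 hA1
  have hdm : d ≤ m := by
    by_contra h
    push Not at h
    have : d * m ≤ d * d := Nat.mul_le_mul_left _ h.le
    nlinarith
  have hsum : ∑ k : Fin ℓ, hil d (A + k * (d - 1) + m) ≤ ℓ * (d * A + d * m + d) + d * d * (ℓ * (ℓ - 1) / 2) := by
    have h2 : ∀ k : Fin ℓ, hil d (A + k * (d - 1) + m) ≤ (d * A + d * m + d) + d * d * k := by
      intro k
      refine (hil_le (by omega)).trans ?_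
      have : (k : ℕ) * (d - 1) ≤ k * d := Nat.mul_le_mul_left _ (by omega)
      nlinarith
    refine (Finset.sum_le_sum fun k _ => h2 k).trans ?_
    rw [Finset.sum_add_distrib, Finset.sum_const, Finset.card_univ, Fintype.card_fin, smul_eq_mul,
      ← Finset.mul_sum, Fin.sum_univ_eq_sum_range (fun k => k), Finset.sum_range_id]
  refine lt_of_le_of_lt hsum ?_
  have e1 := two_hil hdA
  have e2 := two_hil hdm
  have e3 : ℓ * (ℓ - 1) / 2 * 2 ≤ ℓ * ℓ :=
    (Nat.div_mul_le_self _ _).trans (Nat.mul_le_mul_left _ (by omega))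
  generalize ℓ * (ℓ - 1) / 2 = t at *
  zify at *
  have hdd : (1 : ℤ) ≤ d ^ 2 := by nlinarith
  have hdd' : (d : ℤ) ≤ d ^ 2 := by nlinarith
  generalize (hil d A : ℤ) = u at *
  generalize (hil d m : ℤ) = w at *
  have hu : (p : ℤ) - d ^ 2 ≤ u := by nlinarith
  have hw : (q : ℤ) - d ^ 2 ≤ w := by nlinarith
  have hpq : (q : ℤ) ≤ p := by nlinarith
  have huw : ((p : ℤ) - d ^ 2) * (q - d ^ 2) ≤ u * w :=
    mul_le_mul hu hw (by linarith) (by linarith)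
  refine lt_of_lt_of_le ?_ huw
  have hl : (ℓ : ℤ) = q - 9 * d ^ 2 := by linarith
  have hl0 : (0 : ℤ) ≤ ℓ := by positivity
  have k1 : (ℓ : ℤ) * (d * A + d * m + d) ≤ ℓ * (p + q + 2 * d) :=
    mul_le_mul_of_nonneg_left (by linarith) hl0
  have k2 : (d : ℤ) * d * t * 2 ≤ d ^ 2 * (ℓ * q) := by
    have h1 : (t : ℤ) * 2 ≤ ℓ * q := by nlinarith
    nlinarith
  generalize (d : ℤ) ^ 2 = D at *
  generalize (d : ℤ) * d * t = Z at *
  have k3 : (ℓ : ℤ) * q ≤ p := by nlinarith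
  have k4 : D * ((ℓ : ℤ) * q) ≤ D * p := mul_le_mul_of_nonneg_left k3 (by linarith)
  have k5 : (ℓ : ℤ) * (2 * d) ≤ p := by
    have : (ℓ : ℤ) * (2 * d) ≤ ℓ * q := mul_le_mul_of_nonneg_left (by linarith) hl0
    linarith
  have k6 : (ℓ : ℤ) * p = q * p - 9 * (D * p) := by rw [hl]; ring
  have k7 : D * q ≤ D * p := mul_le_mul_of_nonneg_left hpq (by linarith)
  have hp0 : (0 : ℤ) < p := by linarith
  have k8 : (p : ℤ) ≤ D * p := le_mul_of_one_le_left hp0.le hdd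
  have k9 : ((p : ℤ) - D) * (q - D) = q * p - D * p - D * q + D * D := by ring
  have k10 : (ℓ : ℤ) * (p + q + 2 * d) = ℓ * p + ℓ * q + ℓ * (2 * d) := by ring
  have k11 : 0 ≤ D * D := mul_self_nonneg D
  rw [k9]
  linarith

lemma step_fin {d p q N ℓ : ℕ} (hd : 1 ≤ d) (hq : 20 * d ^ 2 ≤ q) (h2 : p ≤ q * q + 2 * q)
    (hℓ : ℓ + 9 * d ^ 2 = q) (h : N * ℓ ≤ p + p * (q + d)) : N ≤ p + 23 * d ^ 2 * q := by
  by_contra hc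
  push Not at hc
  have h3 : (p + 23 * d ^ 2 * q + 1) * ℓ ≤ N * ℓ := Nat.mul_le_mul_right _ hc
  have h4 := h3.trans h
  clear h3 h hc
  have hdd' : d ≤ d ^ 2 := Nat.le_self_pow (by norm_num) d
  have hdd : 1 ≤ d ^ 2 := Nat.one_le_pow _ _ hd
  generalize d ^ 2 = D at *
  zify at *
  have hl : (ℓ : ℤ) = q - 9 * D := by linarith
  have e1 : (p : ℤ) * d ≤ p * D := mul_le_mul_of_nonneg_left hdd' (by positivity)
  have e2 : (p : ℤ) ≤ p * D := by nlinarith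
  have e3 : (p : ℤ) * (q + d) = p * q + p * d := by ring
  have e4 : ((p : ℤ) + 23 * D * q + 1) * ℓ = p * q - 9 * (p * D) + 23 * D * q * ℓ + ℓ := by rw [hl]; ring
  have e5 : 23 * (D : ℤ) * q * ℓ + ℓ ≤ 11 * (p * D) := by linarith
  have e6 : (11 : ℤ) * q ≤ 20 * ℓ := by linarith
  have e7 : (p : ℤ) * D ≤ (q * q + 2 * q) * D := mul_le_mul_of_nonneg_right h2 (by positivity)
  have e8 : (D : ℤ) * q * (11 * q) ≤ D * q * (20 * ℓ) := mul_le_mul_of_nonneg_left e6 (by positivity)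
  have e9 : (D : ℤ) * q * 20 ≤ D * q * q := mul_le_mul_of_nonneg_left (by linarith) (by positivity)
  have e10 : (0 : ℤ) < ℓ := by linarith
  have e11 : (0 : ℤ) ≤ D * q := by positivity
  nlinarith

theorem stepanov {p : ℕ} [hp : Fact p.Prime] {d : ℕ} (hd : 1 ≤ d) (hdp : 400 * d ^ 4 ≤ p)
    {f : MvPolynomial (Fin 3) (ZMod p)} (hf : f.IsHomogeneous d) (hirr : Irreducible f)
    (G : Finset (Fin 3 → ZMod p))
    (hG : ∀ v ∈ G, v 0 = 1 ∧ eval v f = 0 ∧ (eval v (pderiv 1 f) ≠ 0 ∨ eval v (pderiv 2 f) ≠ 0)) :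
    G.card ≤ p + 23 * d ^ 2 * Nat.sqrt p := by
  classical
  rcases G.eq_empty_or_nonempty with rfl | ⟨P0, hP0⟩
  · simp
  have hf0 := hirr.ne_zero
  set q := Nat.sqrt p with hqdef
  have hq : 20 * d ^ 2 ≤ q := by
    rw [hqdef, Nat.le_sqrt]
    nlinarith
  have h1 : q * q ≤ p := Nat.sqrt_le p
  have h2 : p ≤ q * q + 2 * q := by
    have := Nat.sqrt_le_add p
    rw [← hqdef] at this
    omega
  set A := (p - 1) / d with hA
  set m := q / d + 1 with hm
  obtain ⟨ℓ, hℓ⟩ : ∃ ℓ, ℓ + 9 * d ^ 2 = q := ⟨q - 9 * d ^ 2, by omega⟩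
  have hp1 := hp.out.one_lt
  have hA1 : p ≤ d * A + d := by
    have := Nat.div_add_mod (p - 1) d
    have := Nat.mod_lt (p - 1) hd
    rw [hA]; omega
  have hA2 : d * A + 1 ≤ p := by
    have := Nat.mul_div_le (p - 1) d
    rw [hA]; omega
  have hm1 : q < d * m := by
    have := Nat.div_add_mod q d
    have := Nat.mod_lt q hd
    rw [hm, mul_add]; omega
  have hm2 : d * m ≤ q + d := by
    have := Nat.mul_div_le q d
    rw [hm, mul_add]; omega
  have hdA : d ≤ A := step_dA hd hq h1 hA1
  have hdm : d ≤ m := by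
    by_contra h
    push Not at h
    have : d * m ≤ d * d := Nat.mul_le_mul_left _ h.le
    nlinarith
  obtain ⟨a, ha, hai⟩ := exists_reps hf0 hf hdA
  obtain ⟨b, hb, hbi⟩ := exists_reps hf0 hf hdm
  obtain ⟨γ, hγ0, hγ⟩ := exists_ker hf0 hf (ι := Fin (hil d A) × Fin (hil d m)) (ℓ := ℓ)
    (fun k => A + k * (d - 1) + m) (fun k => by omega)
    (fun k x => (DT f : _ → _)^[(k : ℕ)] (a x.1) * b x.2)
    (fun k x => (DT_iter_hom f hd hf (ha _) _).mul (hb _)) (by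
      rw [Fintype.card_prod, Fintype.card_fin, Fintype.card_fin]
      exact step_dim hd hq h1 hA1 hA2 hm1 hm2 hℓ)
  have hpow : ∀ c : MvPolynomial (Fin 3) (ZMod p), DT f (c ^ p) = 0 := by
    intro c
    rw [Derivation.leibniz_pow, ← Nat.cast_smul_eq_nsmul (ZMod p), CharP.cast_eq_zero, zero_smul]
  set F : MvPolynomial (Fin 3) (ZMod p) := ∑ x : Fin (hil d A) × Fin (hil d m), γ x • (a x.1 * b x.2 ^ p) with hF
  have hFhom : F.IsHomogeneous (A + m * p) :=
    (homogeneousSubmodule (Fin 3) (ZMod p) (A + m * p)).sum_mem fun x _ =>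
      Submodule.smul_mem _ _ ((ha x.1).mul ((hb x.2).pow p))
  have hFnd : ¬ f ∣ F := by
    intro hdv
    obtain ⟨h0, hv, hgood⟩ := hG P0 hP0
    have key := stepanov_indep hf hirr (by omega) a ha hai h0 hv hgood
      (fun i => ∑ j, γ (i, j) • b j) (by
        convert hdv using 1
        rw [hF, Fintype.sum_prod_type]
        refine Finset.sum_congr rfl fun i _ => ?_
        rw [sum_pow_char, Finset.mul_sum]
        refine Finset.sum_congr rfl fun j _ => ?_
        rw [smul_pow, ZMod.pow_card, mul_smul_comm])
    apply hγ0
    ext ⟨i, j⟩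
    exact congrFun (hbi _ (key i)) j
  have hbz := bezout_mult (ι := G) (ℓ := ℓ) (DT f) hf hirr hFhom hFnd (fun v => v)
    (fun v h => by simpa [(hG v v.2).1] using congrFun h 0)
    (fun v w hvw c hc => by
      have := congrFun hc 0
      simp only [Pi.smul_apply, (hG v v.2).1, (hG w w.2).1, smul_eq_mul, mul_one] at this
      rw [← this, one_smul] at hc
      exact hvw (Subtype.ext hc))
    (fun v => by
      rw [ordge_iff]
      intro k _
      rcases k with _ | k
      · simpa using (hG v v.2).2.1
      · rw [Function.iterate_succ_apply, DT_self]
        have : ∀ k, (DT f : _ → _)^[k] (0 : MvPolynomial (Fin 3) (ZMod p)) = 0 :=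
          fun k => Function.iterate_fixed (map_zero _) k
        rw [this, map_zero])
    (fun v => by
      rw [ordge_iff]
      intro k hk
      obtain ⟨h, hh⟩ := hγ ⟨k, hk⟩
      have h3 := congrArg (eval (v : Fin 3 → ZMod p)) hh
      rw [map_mul, (hG v v.2).2.1, zero_mul, map_sum] at h3
      rw [hF, iter_sum, map_sum, ← h3]
      refine Finset.sum_congr rfl fun x _ => ?_
      rw [iter_smul, DT_iter_mul_of f (hpow _), smul_eval, smul_eval, map_mul, map_mul, map_pow,
        ZMod.pow_card])
    (fun k hk h => by
      rw [ZMod.natCast_eq_zero_iff, hp.out.dvd_factorial] at h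
      nlinarith)
    (Or.inr fun v => good_T f (hG v v.2).1 (hG v v.2).2.2)
  rw [Fintype.card_coe] at hbz
  refine step_fin hd hq h2 hℓ (hbz.trans ?_)
  have : d * (A + m * p) = d * A + (d * m) * p := by ring
  rw [this]
  have := Nat.mul_le_mul_right p hm2
  nlinarith

end PW

namespace PW
open MvPolynomial Pointwise

lemma fin3_deg (i : Fin 3) (m : Fin 3 →₀ ℕ) : m.degree = m i + m (i + 1) + m (i + 2) := by
  rw [Finsupp.degree_eq_sum, Fin.sum_univ_three]
  fin_cases i <;> simp <;> ring

lemma fin3_ext (i : Fin 3) {m n : Fin 3 →₀ ℕ} (h0 : m i = n i) (h1 : m (i + 1) = n (i + 1))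
    (h2 : m (i + 2) = n (i + 2)) : m = n := by
  ext j
  fin_cases i <;> fin_cases j <;> simp_all

lemma fin3_le (i : Fin 3) {m n : Fin 3 →₀ ℕ} (h0 : m i ≤ n i) (h1 : m (i + 1) ≤ n (i + 1))
    (h2 : m (i + 2) ≤ n (i + 2)) : m ≤ n := by
  intro j
  fin_cases i <;> fin_cases j <;> simp_all

lemma hom_degree {R : Type*} [CommSemiring R] {f : MvPolynomial (Fin 3) R} {d : ℕ} (hf : f.IsHomogeneous d)
    {m : Fin 3 →₀ ℕ} (h : f.coeff m ≠ 0) : m.degree = d :=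
  (hf.degree_eq_sum_deg_support (mem_support_iff.2 h)).symm

/-- off-pivot degree -/
def offd (i : Fin 3) (m : Fin 3 →₀ ℕ) : ℕ := m (i + 1) + m (i + 2)

/-- standard monomials -/
def Std (i : Fin 3) (m0 : Fin 3 →₀ ℕ) (M k0 : ℕ) : Finset (Fin 3 →₀ ℕ) :=
  (monS M).filter fun m => offd i m < k0 ∧ ¬ (m0 (i + 1) ≤ m (i + 1) ∧ m0 (i + 2) ≤ m (i + 2))

lemma std_weight (i : Fin 3) (m0 : Fin 3 →₀ ℕ) (M k0 : ℕ) :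
    (∑ σ ∈ Std i m0 M k0, (k0 - offd i σ)) * 2 ≤ offd i m0 * (k0 * (k0 + 1)) := by
  classical
  have hS : ∀ n : ℕ, (∑ b ∈ Finset.range n, (n - b)) * 2 = n * (n + 1) := by
    intro n
    have h := Finset.sum_range_id_mul_two (n + 1)
    rw [← Finset.sum_range_reflect, Finset.sum_range_succ] at h
    simp only [Nat.add_sub_cancel, Nat.sub_self, add_zero] at h
    rw [h]; ring
  set α := m0 (i + 1)
  set β := m0 (i + 2)
  let P : Finset (ℕ × ℕ) := Finset.range α ×ˢ Finset.range k0
  let Q : Finset (ℕ × ℕ) := Finset.range k0 ×ˢ Finset.range β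
  let g : (Fin 3 →₀ ℕ) → ℕ × ℕ := fun σ => (σ (i + 1), σ (i + 2))
  have hinj : Set.InjOn g (Std i m0 M k0) := by
    intro x hx y hy hxy
    simp only [Std, Finset.coe_filter, Set.mem_ofPred_eq, mem_monS, fin3_deg i] at hx hy
    simp only [g, Prod.mk.injEq] at hxy
    exact fin3_ext i (by omega) hxy.1 hxy.2
  have h1 : ∑ σ ∈ Std i m0 M k0, (k0 - offd i σ) = ∑ x ∈ (Std i m0 M k0).image g, (k0 - (x.1 + x.2)) := by
    rw [Finset.sum_image hinj]; rfl
  have h2 : (Std i m0 M k0).image g ⊆ P ∪ Q := by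
    intro x hx
    obtain ⟨σ, hσ, rfl⟩ := Finset.mem_image.1 hx
    rw [Std, Finset.mem_filter] at hσ
    simp only [offd] at hσ
    simp only [P, Q, g, Finset.mem_union, Finset.mem_product, Finset.mem_range]
    omega
  have h3 : ∑ x ∈ P, (k0 - (x.1 + x.2)) ≤ α * ∑ b ∈ Finset.range k0, (k0 - b) := by
    rw [Finset.sum_product]
    refine (Finset.sum_le_card_nsmul _ _ (∑ b ∈ Finset.range k0, (k0 - b)) fun a _ =>
      Finset.sum_le_sum fun b _ => by omega).trans ?_
    simp
  have h4 : ∑ x ∈ Q, (k0 - (x.1 + x.2)) ≤ β * ∑ b ∈ Finset.range k0, (k0 - b) := by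
    rw [Finset.sum_product_right]
    refine (Finset.sum_le_card_nsmul _ _ (∑ b ∈ Finset.range k0, (k0 - b)) fun a _ =>
      Finset.sum_le_sum fun b _ => by omega).trans ?_
    simp
  have h5 : ∑ x ∈ (Std i m0 M k0).image g, (k0 - (x.1 + x.2)) ≤
      ∑ x ∈ P, (k0 - (x.1 + x.2)) + ∑ x ∈ Q, (k0 - (x.1 + x.2)) := by
    refine (Finset.sum_le_sum_of_subset h2).trans ?_
    rw [← Finset.sum_union_inter]
    omega
  rw [h1]
  have h6 := hS k0
  have h7 : offd i m0 = α + β := rfl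
  rw [h7, ← h6]
  nlinarith

/-- evaluation of a monomial -/
noncomputable abbrev mev (w : Fin 3 → ℤ) (m : Fin 3 →₀ ℕ) : ℤ := eval w (monomial m (1 : ℤ))

lemma mev_eq (i : Fin 3) (w : Fin 3 → ℤ) (m : Fin 3 →₀ ℕ) :
    mev w m = w i ^ m i * (w (i + 1) ^ m (i + 1) * w (i + 2) ^ m (i + 2)) := by
  rw [mev, eval_monomial, one_mul, Finsupp.prod_fintype _ _ (by simp), Fin.prod_univ_three]
  fin_cases i <;> simp <;> ring

lemma dvd_mev {i : Fin 3} {w : Fin 3 → ℤ} {p : ℤ} (h1 : p ∣ w (i + 1)) (h2 : p ∣ w (i + 2))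
    (m : Fin 3 →₀ ℕ) : p ^ offd i m ∣ mev w m := by
  rw [mev_eq i, offd, pow_add]
  exact Dvd.dvd.mul_left (mul_dvd_mul (pow_dvd_pow_of_dvd h1 _) (pow_dvd_pow_of_dvd h2 _)) _

/-- polynomials expressible locally by standard monomials -/
noncomputable def Qm (p : ℤ) (k0 : ℕ) (W : Set (Fin 3 → ℤ)) (S : Finset (Fin 3 →₀ ℕ)) :
    Submodule ℤ (MvPolynomial (Fin 3) ℤ) where
  carrier := {F | ∃ c : (Fin 3 →₀ ℕ) → ℤ, ∀ w ∈ W, p ^ k0 ∣ eval w F - ∑ σ ∈ S, c σ * mev w σ}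
  zero_mem' := ⟨0, by simp⟩
  add_mem' := by
    rintro F G ⟨c, hc⟩ ⟨e, he⟩
    refine ⟨c + e, fun w hw => ?_⟩
    have := dvd_add (hc w hw) (he w hw)
    simp only [Pi.add_apply, add_mul, Finset.sum_add_distrib, map_add]
    rwa [add_sub_add_comm]
  smul_mem' := by
    rintro a F ⟨c, hc⟩
    refine ⟨a • c, fun w hw => ?_⟩
    have := (hc w hw).mul_left a
    simp only [Pi.smul_apply, smul_eq_mul, smul_eval, mul_assoc, ← Finset.mul_sum]
    rwa [← mul_sub]

lemma local_expand {p : ℤ} (hp : Prime p) {i : Fin 3} {d M k0 : ℕ} {f : MvPolynomial (Fin 3) ℤ}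
    (hf : f.IsHomogeneous d) {m0 : Fin 3 →₀ ℕ} (h0 : ¬ p ∣ f.coeff m0)
    (hmin : ∀ n, ¬ p ∣ f.coeff n → n = m0 ∨ offd i m0 < offd i n ∨
      (offd i n = offd i m0 ∧ n (i + 1) < m0 (i + 1)))
    (hk0 : k0 + d ≤ M + 1) {W : Set (Fin 3 → ℤ)}
    (hW : ∀ w ∈ W, p ∣ w (i + 1) ∧ p ∣ w (i + 2) ∧ eval w f = 0) :
    homogeneousSubmodule (Fin 3) ℤ M ≤ Qm p k0 W (Std i m0 M k0) := by
  classical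
  set S := homogeneousSubmodule (Fin 3) ℤ M with hS
  set Q := Qm p k0 W (Std i m0 M k0) with hQ
  have hfd : ∀ n, ¬ p ∣ f.coeff n → n.degree = d := by
    intro n hn
    have h : f.coeff n ≠ 0 := by rintro h; simp [h] at hn
    exact hom_degree hf h
  have hcop : ∃ u v : ℤ, u * f.coeff m0 + v * p = 1 := by
    have := (Prime.coprime_iff_not_dvd hp).2 h0
    obtain ⟨a, b, h⟩ := this
    exact ⟨b, a, by linarith⟩
  obtain ⟨u, v, huv⟩ := hcop
  set pS : Submodule ℤ (MvPolynomial (Fin 3) ℤ) := p • S with hpS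
  -- main induction
  have key : ∀ m : Fin 3 →₀ ℕ, m.degree = M → monomial m (1 : ℤ) ∈ Q ⊔ pS := by
    have main : ∀ t : ℕ, ∀ m : Fin 3 →₀ ℕ, m.degree = M →
        (M - offd i m) * (M + 1) + m (i + 1) = t → monomial m (1 : ℤ) ∈ Q ⊔ pS := by
      intro t
      induction t using Nat.strong_induction_on with
      | _ t ih =>
      intro m hm ht
      by_cases hk : k0 ≤ offd i m
      · refine Submodule.mem_sup_left ⟨0, fun w hw => ?_⟩
        simp only [Pi.zero_apply, zero_mul, Finset.sum_const_zero, sub_zero]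
        exact (pow_dvd_pow p hk).trans (dvd_mev (hW w hw).1 (hW w hw).2.1 m)
      push Not at hk
      by_cases hst : m0 (i + 1) ≤ m (i + 1) ∧ m0 (i + 2) ≤ m (i + 2)
      swap
      · refine Submodule.mem_sup_left ⟨Pi.single m 1, fun w hw => ?_⟩
        rw [Finset.sum_eq_single_of_mem m]
        · simp
        · rw [Std, Finset.mem_filter, mem_monS]
          exact ⟨hm, hk, hst⟩
        · intro b _ hb
          simp [Pi.single_apply, hb]
      have hd0 := hfd m0 h0
      rw [fin3_deg i] at hd0 hm
      have hle : m0 ≤ m := fin3_le i (by unfold offd at hk; omega) hst.1 hst.2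
      obtain ⟨m', hm'⟩ := exists_add_of_le hle
      have hm'j : ∀ j, m j = m0 j + m' j := fun j => by rw [hm']; rfl
      -- x^m = u x^{m'} f + v p x^m - u * (sum over others)
      have hexp : monomial m (1 : ℤ) = u • (monomial m' (1 : ℤ) * f) + p • (v • monomial m (1 : ℤ))
          - ∑ n ∈ f.support.erase m0, (u * f.coeff n) • monomial (m' + n) (1 : ℤ) := by
        by_cases hm0 : m0 ∈ f.support
        swap
        · exfalso; apply h0; rw [notMem_support_iff.1 hm0]; simp
        have e1 : monomial m' (1 : ℤ) * f = ∑ n ∈ f.support, f.coeff n • monomial (m' + n) (1 : ℤ) := by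
          conv_lhs => rw [f.as_sum, Finset.mul_sum]
          refine Finset.sum_congr rfl fun n _ => ?_
          rw [monomial_mul, one_mul, smul_monomial, smul_eq_mul, mul_one]
        rw [e1, ← Finset.add_sum_erase _ _ hm0, smul_add, Finset.smul_sum]
        simp only [smul_smul]
        rw [show m' + m0 = m by rw [hm', add_comm]]
        have : (u * f.coeff m0) • monomial m (1 : ℤ) + (p * v) • monomial m (1 : ℤ) = monomial m (1 : ℤ) := by
          rw [← add_smul, show u * f.coeff m0 + p * v = 1 by linarith, one_smul]
        linear_combination -this
      rw [hexp]
      refine Submodule.sub_mem _ (Submodule.add_mem _ ?_ ?_) (Submodule.sum_mem _ fun n hn => ?_)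
      · refine Submodule.mem_sup_left (Submodule.smul_mem _ _ ⟨0, fun w hw => ?_⟩)
        rw [map_mul, (hW w hw).2.2]
        simp
      · refine Submodule.mem_sup_right (Submodule.smul_mem_pointwise_smul _ _ _ (Submodule.smul_mem _ _ ?_))
        exact isHomogeneous_monomial _ (by rw [fin3_deg i]; omega)
      · have hnd : n.degree = d := hom_degree hf (mem_support_iff.1 (Finset.mem_of_mem_erase hn))
        have hdeg : (m' + n).degree = M := by
          rw [fin3_deg i] at hnd ⊢
          have a1 := hm'j i
          have a2 := hm'j (i + 1)
          have a3 := hm'j (i + 2)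
          simp only [Finsupp.add_apply]
          omega
        by_cases hpn : p ∣ f.coeff n
        · obtain ⟨e, he⟩ := hpn
          refine Submodule.mem_sup_right ?_
          rw [he, show u * (p * e) = p * (u * e) by ring, mul_smul]
          refine Submodule.smul_mem_pointwise_smul _ _ _ (Submodule.smul_mem _ _ ?_)
          exact isHomogeneous_monomial _ hdeg
        · refine Submodule.smul_mem _ _ (ih _ ?_ (m' + n) hdeg rfl)
          rw [← ht]
          rw [fin3_deg i] at hdeg
          have a2 := hm'j (i + 1)
          have a3 := hm'j (i + 2)
          simp only [Finsupp.add_apply] at hdeg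
          rcases hmin n hpn with h | h | ⟨h, h'⟩
          · exact absurd h (Finset.ne_of_mem_erase hn)
          · have b1 : M - offd i (m' + n) + 1 ≤ M - offd i m := by
              simp only [offd, Finsupp.add_apply] at *
              omega
            have b2 : (m' + n) (i + 1) ≤ M := by simp only [Finsupp.add_apply]; omega
            nlinarith
          · have b1 : M - offd i (m' + n) = M - offd i m := by
              simp only [offd, Finsupp.add_apply] at *
              omega
            rw [b1]
            simp only [Finsupp.add_apply]
            omega
    exact fun m hm => main _ m hm rfl
  have step : S ≤ Q ⊔ pS := by
    rw [hS, hom_eq_span, Submodule.span_le]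
    rintro _ ⟨m, rfl⟩
    exact key m (mem_monS.1 m.2)
  have iter : ∀ n : ℕ, S ≤ Q ⊔ (p ^ n) • S := by
    intro n
    induction n with
    | zero => rw [pow_zero, one_smul]; exact le_sup_right
    | succ n ih =>
      refine ih.trans (sup_le le_sup_left ?_)
      intro F hF
      obtain ⟨G, hG, rfl⟩ := (Submodule.mem_smul_pointwise_iff_exists _ _ _).1 hF
      obtain ⟨a, ha, b, hb, rfl⟩ := Submodule.mem_sup.1 (step hG)
      obtain ⟨e, he, rfl⟩ := (Submodule.mem_smul_pointwise_iff_exists _ _ _).1 hb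
      rw [smul_add, smul_smul, ← pow_succ]
      exact Submodule.add_mem _ (Submodule.mem_sup_left (Submodule.smul_mem _ _ ha))
        (Submodule.mem_sup_right (Submodule.smul_mem_pointwise_smul _ _ _ he))
  refine (iter k0).trans (sup_le le_rfl ?_)
  intro F hF
  obtain ⟨G, hG, rfl⟩ := (Submodule.mem_smul_pointwise_iff_exists _ _ _).1 hF
  refine ⟨0, fun w hw => ?_⟩
  simp [smul_eval]

end PW

namespace PW

lemma det_dvd {s q T : Type*} [Fintype s] [DecidableEq s] [Fintype q] [DecidableEq q] [Fintype T]
    [DecidableEq T]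
    (A : Matrix (s ⊕ q) (s ⊕ q) ℤ) (W : s → T → ℤ) (C : T → (s ⊕ q) → ℤ)
    (hA : ∀ j, A (Sum.inl j) = ∑ t, W j t • C t) (p : ℤ) (wt : T → ℕ)
    (hW : ∀ j t, p ^ wt t ∣ W j t) (k0 e : ℕ)
    (he : e + ∑ t, (k0 - wt t) ≤ k0 * Fintype.card s) : p ^ e ∣ A.det := by
  classical
  let D : MultilinearMap ℤ (fun _ : s ⊕ q => (s ⊕ q → ℤ)) ℤ :=
    (Matrix.detRowAlternating (n := s ⊕ q) (R := ℤ)).toMultilinearMap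
  have h1 : A.det = D.currySum (fun j => ∑ t, W j t • C t) (fun i => A (Sum.inr i)) := by
    rw [MultilinearMap.currySum_apply]
    change A.det = Matrix.det _
    congr 1
    ext x y
    rcases x with j | i
    · simp [hA]
    · simp
  rw [h1, MultilinearMap.map_sum, sum_apply]
  refine Finset.dvd_sum fun τ _ => ?_
  rw [MultilinearMap.map_smul_univ, smul_apply, smul_eq_mul]
  by_cases hτ : Function.Injective τ
  · refine Dvd.dvd.mul_right ?_ _
    have h2 : p ^ (∑ j, wt (τ j)) ∣ ∏ j, W j (τ j) := by
      rw [← Finset.prod_pow_eq_pow_sum]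
      exact Finset.prod_dvd_prod_of_dvd _ _ fun j _ => hW _ _
    refine (pow_dvd_pow p ?_).trans h2
    have h3 : ∑ j, (k0 - wt (τ j)) ≤ ∑ t, (k0 - wt t) := by
      rw [← Finset.sum_image (f := fun t => k0 - wt t) (g := τ) (fun a _ b _ h => hτ h)]
      exact Finset.sum_le_sum_of_subset (Finset.subset_univ _)
    have h4 : k0 * Fintype.card s ≤ ∑ j, (k0 - wt (τ j)) + ∑ j, wt (τ j) := by
      rw [← Finset.sum_add_distrib]
      have : ∑ _j : s, k0 = k0 * Fintype.card s := by
        rw [Finset.sum_const, Finset.card_univ, smul_eq_mul, mul_comm]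
      rw [← this]
      exact Finset.sum_le_sum fun j _ => by omega
    omega
  · have : ∃ a b, τ a = τ b ∧ a ≠ b := by
      simpa [Function.Injective] using hτ
    obtain ⟨a, b, hab, hne⟩ := this
    refine Dvd.dvd.mul_left ?_ _
    rw [MultilinearMap.currySum_apply]
    refine (dvd_zero _).trans (Eq.dvd (Eq.symm ?_))
    refine (Matrix.detRowAlternating (n := s ⊕ q) (R := ℤ)).map_eq_zero_of_eq _
      (i := Sum.inl a) (j := Sum.inl b) ?_ (by simpa using hne)
    simp [hab]

end PW

namespace PW
open MvPolynomial

section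
variable {K : Type*} [Field K]

/-- normalised coordinate vectors -/
def Nrm (r : Fin 3 → K) : Prop := r 0 = 1 ∨ (r 0 = 0 ∧ r 1 = 1) ∨ (r 0 = 0 ∧ r 1 = 0 ∧ r 2 = 1)

lemma Nrm.ne_zero {r : Fin 3 → K} (h : Nrm r) : r ≠ 0 := by
  rintro rfl
  simp [Nrm] at h

lemma Nrm.not_smul {r r' : Fin 3 → K} (h : Nrm r) (h' : Nrm r') (hne : r ≠ r') (c : K) : r ≠ c • r' := by
  intro hc
  apply hne
  have h0 := congrFun hc 0
  have h1 := congrFun hc 1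
  have h2 := congrFun hc 2
  simp only [Pi.smul_apply, smul_eq_mul] at h0 h1 h2
  have : c = 1 := by
    rcases h with h | ⟨h, h3⟩ | ⟨h, h3, h4⟩ <;> rcases h' with h' | ⟨h', h3'⟩ | ⟨h', h3', h4'⟩ <;> simp_all
  rw [hc, this, one_smul]

lemma exists_nrm {u : Fin 3 → K} (hu : u ≠ 0) : ∃ r : Fin 3 → K, Nrm r ∧ ∃ c : K, c ≠ 0 ∧ u = c • r := by
  have key : ∀ i, u i ≠ 0 → u = u i • ((u i)⁻¹ • u) := fun i hi => by
    rw [smul_smul, mul_inv_cancel₀ hi, one_smul]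
  by_cases h0 : u 0 = 0
  · by_cases h1 : u 1 = 0
    · have h2 : u 2 ≠ 0 := by
        intro h2
        apply hu
        ext i
        fin_cases i <;> simp [h0, h1, h2]
      exact ⟨_, Or.inr (Or.inr ⟨by simp [h0], by simp [h1], by simp [h2]⟩), u 2, h2, key 2 h2⟩
    · exact ⟨_, Or.inr (Or.inl ⟨by simp [h0], by simp [h1]⟩), u 1, h1, key 1 h1⟩
  · exact ⟨_, Or.inl (by simp [h0]), u 0, h0, key 0 h0⟩

lemma Nrm.pivot {r : Fin 3 → K} (h : Nrm r) : ∃ i, r i = 1 ∧ (r 0 = 1 → i = 0) := by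
  rcases h with h | ⟨h, h3⟩ | ⟨h, h3, h4⟩
  · exact ⟨0, h, fun _ => rfl⟩
  · exact ⟨1, h3, by simp [h]⟩
  · exact ⟨2, h4, by simp [h]⟩

end

lemma pderiv_zero_dvd {p d : ℕ} [hp : Fact p.Prime] (hdp : d < p)
    {f : MvPolynomial (Fin 3) (ZMod p)} (hf : f.IsHomogeneous d) (hirr : Irreducible f)
    (h1 : pderiv 1 f = 0) (h2 : pderiv 2 f = 0) : f ∣ X 0 := by
  have key : ∀ i : Fin 3, pderiv i f = 0 → ∀ m, f.coeff m ≠ 0 → m i = 0 := by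
    intro i hi m hm
    by_contra h
    have hle : Finsupp.single i 1 ≤ m := by
      rw [Finsupp.single_le_iff]; omega
    have := coeff_pderiv (i := i) f (m - Finsupp.single i 1)
    rw [hi, coeff_zero, tsub_add_cancel_of_le hle] at this
    have h3 : (((m - Finsupp.single i 1 : Fin 3 →₀ ℕ) i : ℕ) : ZMod p) + 1 = (m i : ZMod p) := by
      rw [Finsupp.tsub_apply, Finsupp.single_eq_same]
      have h5 : m i = (m i - 1) + 1 := by omega
      conv_rhs => rw [h5]
      push_cast
      rfl
    rw [h3] at this
    rcases mul_eq_zero.1 this.symm with h4 | h4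
    · exact hm h4
    · rw [ZMod.natCast_eq_zero_iff] at h4
      have := Nat.le_of_dvd (by omega) h4
      have := hom_degree hf hm
      rw [fin3_deg i] at this
      omega
  have hfX : f = monomial (Finsupp.single 0 d) (f.coeff (Finsupp.single 0 d)) := by
    ext m
    rw [coeff_monomial]
    split_ifs with h
    · rw [h]
    · by_contra hm
      apply h
      have a := key 1 h1 m hm
      have b := key 2 h2 m hm
      have c := hom_degree hf hm
      rw [fin3_deg 0] at c
      refine fin3_ext 0 ?_ ?_ ?_
      · simp at c ⊢; omega
      · simp [a]
      · simp [b]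
  have hc : f.coeff (Finsupp.single 0 d) ≠ 0 := by
    intro h
    rw [h, monomial_zero] at hfX
    exact hirr.ne_zero hfX
  apply hirr.prime.dvd_of_dvd_pow (n := d)
  generalize f.coeff (Finsupp.single 0 d) = c at *
  refine ⟨C c⁻¹, ?_⟩
  rw [hfX, mul_comm, C_mul_monomial, inv_mul_cancel₀ hc, X_pow_eq_monomial]

lemma count_bound {p : ℕ} [hp : Fact p.Prime] {d : ℕ} (hd : 1 ≤ d) (hdp : 400 * d ^ 4 ≤ p)
    {f : MvPolynomial (Fin 3) (ZMod p)} (hf : f.IsHomogeneous d) (hirr : Irreducible f)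
    (Z : Finset (Fin 3 → ZMod p)) (hZ : ∀ r ∈ Z, Nrm r ∧ eval r f = 0) (μ : (Fin 3 → ZMod p) → ℕ)
    (hμ : ∀ r ∈ Z, μ r ≤ d)
    (hμ1 : ∀ r ∈ Z, r 0 = 1 → (eval r (pderiv 1 f) ≠ 0 ∨ eval r (pderiv 2 f) ≠ 0) → μ r ≤ 1) :
    ∑ r ∈ Z, μ r ≤ p + 24 * d ^ 2 * Nat.sqrt p := by
  classical
  have hdd : d ^ 2 ≤ d ^ 4 := Nat.pow_le_pow_right hd (by norm_num)
  have hdd' : d ≤ d ^ 2 := Nat.le_self_pow (by norm_num) d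
  have hq : 20 * d ^ 2 ≤ Nat.sqrt p := by
    rw [Nat.le_sqrt]
    nlinarith
  by_cases hX : f ∣ X 0
  · have hd1 : d = 1 := by
      obtain ⟨g, hg⟩ := hX
      have h1 := hf.totalDegree hirr.ne_zero
      have hg0 : g ≠ 0 := by rintro rfl; simp at hg
      have h2 := totalDegree_mul_of_isDomain hirr.ne_zero hg0
      rw [← hg, totalDegree_X] at h2
      omega
    subst hd1
    have hz0 : ∀ r ∈ Z, r 0 = 0 := by
      intro r hr
      obtain ⟨g, hg⟩ := hX
      have := congrArg (eval r) hg
      rw [map_mul, (hZ r hr).2, zero_mul, eval_X] at this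
      exact this
    have hcard : Z.card ≤ p + 1 := by
      have : Z ⊆ (insert ![0, 0, 1] (Finset.univ.image fun t : ZMod p => ![0, 1, t])) := by
        intro r hr
        have h0 := hz0 r hr
        rw [Finset.mem_insert, Finset.mem_image]
        rcases (hZ r hr).1 with h | ⟨_, h3⟩ | ⟨_, h3, h4⟩
        · rw [h0] at h; exact absurd h zero_ne_one
        · right
          refine ⟨r 2, Finset.mem_univ _, ?_⟩
          ext i; fin_cases i <;> simp [h0, h3]
        · left
          ext i; fin_cases i <;> simp [h0, h3, h4]
      refine (Finset.card_le_card this).trans ((Finset.card_insert_le _ _).trans ?_)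
      have := Finset.card_image_le (s := (Finset.univ : Finset (ZMod p))) (f := fun t : ZMod p => (![0, 1, t] : Fin 3 → ZMod p))
      rw [Finset.card_univ, ZMod.card] at this
      omega
    have := Finset.sum_le_card_nsmul Z μ 1 hμ
    simp only [smul_eq_mul] at this
    nlinarith
  have hbez : ∀ (Y : Finset (Fin 3 → ZMod p)) (g : MvPolynomial (Fin 3) (ZMod p)) (M : ℕ), Y ⊆ Z →
      g.IsHomogeneous M → ¬ f ∣ g → (∀ r ∈ Y, eval r g = 0) → Y.card ≤ d * M := by
    intro Y g M hY hg hfg hr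
    have := bezout (ι := Y) hf hirr hg hfg (fun r => r) (fun r => (hZ r (hY r.2)).1.ne_zero)
      (fun r r' hne => (hZ r (hY r.2)).1.not_smul (hZ r' (hY r'.2)).1 (fun h => hne (Subtype.ext h)))
      (fun r => (hZ r (hY r.2)).2) (fun r => hr r r.2)
    simpa using this
  set Z0 := Z.filter fun r => r 0 = 0 with hZ0
  set Z1 := Z.filter fun r => r 0 ≠ 0 ∧ (eval r (pderiv 1 f) = 0 ∧ eval r (pderiv 2 f) = 0) with hZ1
  set G := Z.filter fun r => r 0 ≠ 0 ∧ ¬ (eval r (pderiv 1 f) = 0 ∧ eval r (pderiv 2 f) = 0) with hG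
  have c0 : Z0.card ≤ d * 1 := hbez Z0 (X 0) 1 (Finset.filter_subset _ _) (isHomogeneous_X _ _) hX
    (fun r hr => by simpa using (Finset.mem_filter.1 hr).2)
  have hone : ∀ r ∈ Z, r 0 ≠ 0 → r 0 = 1 := by
    intro r hr h
    rcases (hZ r hr).1 with h' | ⟨h', _⟩ | ⟨h', _, _⟩
    · exact h'
    · exact absurd h' h
    · exact absurd h' h
  have hnd : ∀ i : Fin 3, pderiv i f ≠ 0 → ¬ f ∣ pderiv i f := by
    intro i hi ⟨g, hg⟩
    have hg0 : g ≠ 0 := by rintro rfl; simp at hg; exact hi hg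
    have h1 := hf.totalDegree hirr.ne_zero
    have h2 := (hf.pderiv (i := i)).totalDegree hi
    have h3 := totalDegree_mul_of_isDomain hirr.ne_zero hg0
    rw [← hg] at h3
    omega
  have c1 : Z1.card ≤ d * (d - 1) := by
    by_cases h1 : pderiv 1 f = 0
    · by_cases h2 : pderiv 2 f = 0
      · exact absurd (pderiv_zero_dvd (by nlinarith) hf hirr h1 h2) hX
      · exact hbez Z1 _ _ (Finset.filter_subset _ _) hf.pderiv (hnd 2 h2)
          (fun r hr => (Finset.mem_filter.1 hr).2.2.2)
    · exact hbez Z1 _ _ (Finset.filter_subset _ _) hf.pderiv (hnd 1 h1)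
          (fun r hr => (Finset.mem_filter.1 hr).2.2.1)
  have cG : G.card ≤ p + 23 * d ^ 2 * Nat.sqrt p := by
    apply stepanov hd hdp hf hirr
    intro r hr
    obtain ⟨h1, h2, h3⟩ := Finset.mem_filter.1 hr
    exact ⟨hone r h1 h2, (hZ r h1).2, by tauto⟩
  have hsplit : ∑ r ∈ Z, μ r ≤ Z0.card * d + Z1.card * d + G.card * 1 := by
    have e1 : ∑ r ∈ Z, μ r ≤ ∑ r ∈ Z0, μ r + ∑ r ∈ Z1, μ r + ∑ r ∈ G, μ r := by
      rw [← Finset.sum_filter_add_sum_filter_not Z (fun r => r 0 = 0), add_assoc]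
      refine Nat.add_le_add le_rfl ?_
      rw [← Finset.sum_filter_add_sum_filter_not (Z.filter fun r => ¬ r 0 = 0)
        (fun r => eval r (pderiv 1 f) = 0 ∧ eval r (pderiv 2 f) = 0), Finset.filter_filter, Finset.filter_filter]
    refine e1.trans (Nat.add_le_add (Nat.add_le_add ?_ ?_) ?_)
    · have := Finset.sum_le_card_nsmul Z0 μ d fun r hr => hμ r (Finset.mem_filter.1 hr).1
      simpa using this
    · have := Finset.sum_le_card_nsmul Z1 μ d fun r hr => hμ r (Finset.mem_filter.1 hr).1
      simpa using this
    · have := Finset.sum_le_card_nsmul G μ 1 fun r hr => by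
        obtain ⟨h1, h2, h3⟩ := Finset.mem_filter.1 hr
        exact hμ1 r h1 (hone r h1 h2) (by tauto)
      simpa using this
  have e2 : Z0.card * d + Z1.card * d ≤ d ^ 2 * d := by
    have : Z0.card + Z1.card ≤ d ^ 2 := by
      obtain ⟨t, rfl⟩ := Nat.exists_eq_add_of_le hd
      simp only [Nat.add_sub_cancel_left] at c1
      nlinarith
    rw [← add_mul]
    exact Nat.mul_le_mul_right _ this
  have e3 : d ^ 2 * d ≤ d ^ 2 * Nat.sqrt p := Nat.mul_le_mul_left _ (by omega)
  nlinarith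

end PW

namespace PW
open MvPolynomial

section
variable {R : Type*} [CommRing R]

/-- shear moving the pivot point to the point `r` -/
noncomputable def sh (i : Fin 3) (r : Fin 3 → R) : MvPolynomial (Fin 3) R →ₐ[R] MvPolynomial (Fin 3) R :=
  aeval fun j => if j = i then X i else X j + C (r j) * X i

lemma sh_hom (i : Fin 3) (r : Fin 3 → R) {F : MvPolynomial (Fin 3) R} {n : ℕ} (hF : F.IsHomogeneous n) :
    (sh i r F).IsHomogeneous n := by
  have := hF.aeval (n := 1) (fun j => if j = i then X i else X j + C (r j) * X i) (fun j => by
    split_ifs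
    · exact isHomogeneous_X _ _
    · exact (isHomogeneous_X _ _).add (isHomogeneous_C_mul_X _ _))
  rwa [one_mul] at this

lemma eval_sh (i : Fin 3) (r w : Fin 3 → R) (F : MvPolynomial (Fin 3) R) :
    eval w (sh i r F) = eval (fun j => if j = i then w i else w j + r j * w i) F := by
  have : (eval w).comp (sh i r : MvPolynomial (Fin 3) R →+* MvPolynomial (Fin 3) R) =
      eval (fun j => if j = i then w i else w j + r j * w i) := by
    apply ringHom_ext
    · intro a; simp [sh]
    · intro j
      simp only [sh, RingHom.comp_apply, RingHom.coe_coe, aeval_X, eval_X]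
      split_ifs <;> simp
  exact RingHom.congr_fun this F

lemma sh_sh (i : Fin 3) (r : Fin 3 → R) (F : MvPolynomial (Fin 3) R) : sh i (-r) (sh i r F) = F := by
  have : (sh i (-r)).comp (sh i r) = AlgHom.id R _ := by
    apply algHom_ext
    intro j
    simp only [AlgHom.comp_apply, sh, aeval_X]
    split_ifs with h
    · subst h; simp
    · simp [h]
  exact DFunLike.congr_fun this F

lemma map_sh {S : Type*} [CommRing S] (φ : R →+* S) (i : Fin 3) (r : Fin 3 → R) (F : MvPolynomial (Fin 3) R) :
    map φ (sh i r F) = sh i (fun j => φ (r j)) (map φ F) := by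
  have : (map φ).comp (sh i r : MvPolynomial (Fin 3) R →+* MvPolynomial (Fin 3) R) =
      (sh i (fun j => φ (r j)) : MvPolynomial (Fin 3) S →+* MvPolynomial (Fin 3) S).comp (map φ) := by
    apply ringHom_ext
    · intro a; simp [sh]
    · intro j
      simp only [sh, RingHom.comp_apply, RingHom.coe_coe, aeval_X, map_X]
      split_ifs <;> simp
  exact RingHom.congr_fun this F

lemma pderiv_sh {i j : Fin 3} (hij : j ≠ i) (r : Fin 3 → R) (F : MvPolynomial (Fin 3) R) :
    pderiv j (sh i r F) = sh i r (pderiv j F) := by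
  induction F using MvPolynomial.induction_on with
  | C a => simp [sh]
  | add p q hp hq => simp [hp, hq]
  | mul_X p k hp =>
    rw [map_mul, pderiv_mul, pderiv_mul, hp, map_add, map_mul, map_mul]
    congr 2
    simp only [sh, aeval_X]
    by_cases hk : k = i
    · subst hk
      simp [pderiv_X_of_ne hij.symm]
    · by_cases hkj : k = j
      · subst hkj
        simp [hk, pderiv_X_of_ne hij.symm]
      · simp [hk, pderiv_X_of_ne hij.symm, pderiv_X_of_ne hkj]

end

lemma good_offd {K : Type*} [Field K] {F : MvPolynomial (Fin 3) K} {j : Fin 3} (hj : j ≠ 0)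
    (h : eval (fun k : Fin 3 => if k = 0 then (1 : K) else 0) (pderiv j F) ≠ 0) :
    ∃ n ∈ F.support, offd 0 n ≤ 1 := by
  by_contra hc
  push Not at hc
  apply h
  rw [F.as_sum, map_sum, map_sum]
  refine Finset.sum_eq_zero fun n hn => ?_
  have h2 := hc n hn
  rw [pderiv_monomial, eval_monomial, Finsupp.prod_fintype _ _ (by simp), Fin.prod_univ_three]
  simp only [offd] at h2
  fin_cases j
  · exact absurd rfl hj
  · simp at h2 ⊢
    by_cases h3 : n 2 = 0
    · right; left; omega
    · right; right; omega
  · simp at h2 ⊢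
    by_cases h3 : n 1 = 0
    · right; right; omega
    · right; left; omega

lemma exists_lead {p : ℤ} {f : MvPolynomial (Fin 3) ℤ} {d : ℕ} (hf : f.IsHomogeneous d) (i : Fin 3)
    (hne : ∃ n, ¬ p ∣ f.coeff n) : ∃ m0, ¬ p ∣ f.coeff m0 ∧
    (∀ n, ¬ p ∣ f.coeff n → n = m0 ∨ offd i m0 < offd i n ∨
      (offd i n = offd i m0 ∧ n (i + 1) < m0 (i + 1))) := by
  classical
  let S := f.support.filter fun n => ¬ p ∣ f.coeff n
  have hS : ∀ n, n ∈ S ↔ ¬ p ∣ f.coeff n := by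
    intro n
    simp only [S, Finset.mem_filter, mem_support_iff, and_iff_right_iff_imp]
    rintro h h0
    simp [h0] at h
  obtain ⟨n0, hn0⟩ := hne
  obtain ⟨m0, hm0, hmin⟩ := S.exists_min_image (fun n => offd i n * (d + 1) + (d - n (i + 1)))
    ⟨n0, (hS _).2 hn0⟩
  have hdeg : ∀ n, ¬ p ∣ f.coeff n → n i + n (i + 1) + n (i + 2) = d := by
    intro n hn
    rw [← fin3_deg i]
    refine hom_degree hf ?_
    rintro h; simp [h] at hn
  refine ⟨m0, (hS _).1 hm0, fun n hn => ?_⟩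
  have h1 := hmin n ((hS _).2 hn)
  have h2 := hdeg n hn
  have h3 := hdeg m0 ((hS _).1 hm0)
  rcases lt_trichotomy (offd i m0) (offd i n) with h | h | h
  · exact Or.inr (Or.inl h)
  · rw [h] at h1
    have h4 : n (i + 1) ≤ m0 (i + 1) := by omega
    rcases h4.lt_or_eq with h5 | h5
    · exact Or.inr (Or.inr ⟨h.symm, h5⟩)
    · left
      unfold offd at h
      exact fin3_ext i (by omega) h5 (by omega)
  · exfalso
    have : (offd i n + 1) * (d + 1) ≤ offd i m0 * (d + 1) := Nat.mul_le_mul_right _ h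
    rw [add_mul, one_mul] at this
    omega

lemma class_data {p d : ℕ} [hp : Fact p.Prime] {f : MvPolynomial (Fin 3) ℤ} (hf : f.IsHomogeneous d)
    (hfp : map (Int.castRingHom (ZMod p)) f ≠ 0) {r : Fin 3 → ZMod p} (hr : Nrm r) :
    ∃ (i : Fin 3) (m0 : Fin 3 →₀ ℕ), r i = 1 ∧ 
      ¬ (p : ℤ) ∣ (sh i (fun j => ((r j).val : ℤ)) f).coeff m0 ∧
      (∀ n, ¬ (p : ℤ) ∣ (sh i (fun j => ((r j).val : ℤ)) f).coeff n → n = m0 ∨ offd i m0 < offd i n ∨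
      (offd i n = offd i m0 ∧ n (i + 1) < m0 (i + 1))) ∧ offd i m0 ≤ d ∧
      (r 0 = 1 → (eval r (pderiv 1 (map (Int.castRingHom (ZMod p)) f)) ≠ 0 ∨
        eval r (pderiv 2 (map (Int.castRingHom (ZMod p)) f)) ≠ 0) → offd i m0 ≤ 1) := by
  obtain ⟨i, hi, hi0⟩ := hr.pivot
  set f' := sh i (fun j => ((r j).val : ℤ)) f with hf'
  set fp := map (Int.castRingHom (ZMod p)) f with hfpdef
  have hmap : map (Int.castRingHom (ZMod p)) f' = sh i r fp := by
    rw [hf', map_sh]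
    congr 2
    ext j
    simp
  have hcoef : ∀ n, ¬ (p : ℤ) ∣ f'.coeff n ↔ n ∈ (sh i r fp).support := by
    intro n
    rw [mem_support_iff, ← hmap, coeff_map, Int.coe_castRingHom, Ne, ZMod.intCast_zmod_eq_zero_iff_dvd]
  have hne : sh i r fp ≠ 0 := by
    intro h
    apply hfp
    rw [← sh_sh i r fp, h, map_zero]
  obtain ⟨n0, hn0⟩ := support_nonempty.2 hne
  obtain ⟨m0, h1, h2⟩ := exists_lead (p := p) (sh_hom i _ hf) i ⟨n0, (hcoef n0).2 hn0⟩
  refine ⟨i, m0, hi, h1, h2, ?_, ?_⟩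
  · have : m0.degree = d := by
      refine hom_degree (sh_hom i (fun j => ((r j).val : ℤ)) hf) ?_
      intro h; rw [h] at h1; simp at h1
    rw [fin3_deg i] at this
    unfold offd
    omega
  · intro h0 hgood
    obtain rfl := hi0 h0
    have : ∃ n ∈ (sh 0 r fp).support, offd 0 n ≤ 1 := by
      have hpt : (fun j : Fin 3 => if j = 0 then (if (0 : Fin 3) = 0 then (1 : ZMod p) else 0) else
          (if j = 0 then (1 : ZMod p) else 0) + r j * (if (0 : Fin 3) = 0 then (1 : ZMod p) else 0)) = r := by
        ext j
        by_cases hj : j = 0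
        · simp [hj, h0]
        · simp [hj]
      rcases hgood with h | h
      · refine good_offd (j := 1) (by decide) ?_
        rwa [pderiv_sh (by decide), eval_sh, hpt]
      · refine good_offd (j := 2) (by decide) ?_
        rwa [pderiv_sh (by decide), eval_sh, hpt]
    obtain ⟨n, hn, hn1⟩ := this
    rcases h2 n ((hcoef n).2 hn) with h | h | h
    · rw [← h]; exact hn1
    · omega
    · omega

lemma eval_smul_hom {R : Type*} [CommRing R] {d : ℕ} {F : MvPolynomial (Fin 3) R} (hF : F.IsHomogeneous d)
    (c : R) (r : Fin 3 → R) : eval (c • r) F = c ^ d * eval r F := by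
  rw [eval_eq, eval_eq, Finset.mul_sum]
  refine Finset.sum_congr rfl fun m hm => ?_
  have : m.degree = d := hom_degree hF (mem_support_iff.1 hm)
  simp only [Pi.smul_apply, smul_eq_mul, mul_pow, Finset.prod_mul_distrib]
  rw [Finset.prod_pow_eq_pow_sum, ← this]
  have : ∑ i ∈ m.support, m i = m.degree := rfl
  rw [this]; ring

theorem prime_dvd {p d M k0 e : ℕ} [hp : Fact p.Prime] (hd : 1 ≤ d) (hdp : 400 * d ^ 4 ≤ p)
    {f : MvPolynomial (Fin 3) ℤ} (hf : f.IsHomogeneous d)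
    (hirr : Irreducible (map (Int.castRingHom (ZMod p)) f))
    {s q : Type*} [Fintype s] [DecidableEq s] [Fintype q] [DecidableEq q]
    (v : s → Fin 3 → ℤ) (hv : ∀ j, eval (v j) f = 0) (hprim : ∀ j, ∃ i, ¬ (p : ℤ) ∣ v j i)
    (col : s ⊕ q → (Fin 3 →₀ ℕ)) (hcol : ∀ c, (col c).degree = M)
    (A : Matrix (s ⊕ q) (s ⊕ q) ℤ) (hA : ∀ j c, A (Sum.inl j) c = mev (v j) (col c))
    (hk0 : k0 + d ≤ M + 1)
    (he : 2 * e + (p + 24 * d ^ 2 * Nat.sqrt p) * (k0 * (k0 + 1)) ≤ 2 * (k0 * Fintype.card s)) :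
    (p : ℤ) ^ e ∣ A.det := by
  classical
  have hf0 := hirr.ne_zero
  have hprime : Prime (p : ℤ) := Nat.prime_iff_prime_int.1 hp.out
  -- residue classes
  have hred : ∀ j, (fun k => (v j k : ZMod p)) ≠ 0 := by
    intro j h
    obtain ⟨i, hi⟩ := hprim j
    exact hi ((ZMod.intCast_zmod_eq_zero_iff_dvd _ _).1 (congrFun h i))
  choose r hrN c hc0 hcr using fun j => exists_nrm (hred j)
  have hrf : ∀ j, eval (r j) (map (Int.castRingHom (ZMod p)) f) = 0 := by
    intro j
    have h1 : eval (fun k => (v j k : ZMod p)) (map (Int.castRingHom (ZMod p)) f) = 0 := by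
      have := congrArg (Int.castRingHom (ZMod p)) (hv j)
      rw [map_zero] at this
      rw [eval_map, ← this, ← eval₂_id, eval₂_comp_left]
      rfl
    rw [hcr j] at h1
    have h3 : eval (c j • r j) (map (Int.castRingHom (ZMod p)) f) =
        c j ^ d * eval (r j) (map (Int.castRingHom (ZMod p)) f) := eval_smul_hom (hf.map _) _ _
    rw [h3] at h1
    exact (mul_eq_zero.1 h1).resolve_left (pow_ne_zero _ (hc0 j))
  set Z : Finset (Fin 3 → ZMod p) := Finset.univ.image r with hZ
  have hZN : ∀ x : Z, Nrm (x : Fin 3 → ZMod p) := by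
    rintro ⟨x, hx⟩
    obtain ⟨j, _, rfl⟩ := Finset.mem_image.1 hx
    exact hrN j
  choose i m0 hi hm0 hmin hmud hmu1 using fun x : Z => class_data hf hf0 (hZN x)
  let f' : Z → MvPolynomial (Fin 3) ℤ := fun x => sh (i x) (fun j => ((x.1 j).val : ℤ)) f
  let W : Z → Set (Fin 3 → ℤ) := fun x => {w | (p : ℤ) ∣ w (i x + 1) ∧ (p : ℤ) ∣ w (i x + 2) ∧ eval w (f' x) = 0}
  have hexp : ∀ (x : Z) (t : s ⊕ q), ∃ cc : (Fin 3 →₀ ℕ) → ℤ, ∀ w ∈ W x, (p : ℤ) ^ k0 ∣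
      eval w (sh (i x) (fun j => ((x.1 j).val : ℤ)) (monomial (col t) 1)) -
        ∑ σ ∈ Std (i x) (m0 x) M k0, cc σ * mev w σ := by
    intro x t
    exact local_expand (W := W x) hprime (sh_hom (i x) _ hf) (hm0 x) (hmin x) hk0 (fun w hw => hw)
      (sh_hom (i x) _ (isHomogeneous_monomial _ (hcol t)))
  choose cc hcc using hexp
  let z : s → Z := fun j => ⟨r j, Finset.mem_image_of_mem _ (Finset.mem_univ _)⟩
  let w : s → Fin 3 → ℤ := fun j k => if k = i (z j) then v j (i (z j)) else
    v j k - (((r j k).val : ℕ) : ℤ) * v j (i (z j))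
  have hsub : ∀ j, (fun k => if k = i (z j) then w j (i (z j)) else
      w j k + (((r j k).val : ℕ) : ℤ) * w j (i (z j))) = v j := by
    intro j
    ext k
    by_cases hk : k = i (z j)
    · simp [w, hk]
    · simp [w, hk]
  have hpw : ∀ j k, k ≠ i (z j) → (p : ℤ) ∣ w j k := by
    intro j k hk
    rw [← ZMod.intCast_zmod_eq_zero_iff_dvd]
    simp only [w, if_neg hk]
    have h1 := congrFun (hcr j) k
    have h2 := congrFun (hcr j) (i (z j))
    have h3 : r j (i (z j)) = 1 := hi (z j)
    simp only [Pi.smul_apply, smul_eq_mul] at h1 h2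
    push_cast
    rw [h1, h2, h3, ZMod.natCast_zmod_val]
    ring
  have hwW : ∀ j, w j ∈ W (z j) := by
    intro j
    refine ⟨hpw j _ (by simp), hpw j _ (by simp), ?_⟩
    simp only [f', z]
    rw [eval_sh]
    have := hsub j
    simp only [z] at this
    rw [this, hv]
  have hq : ∀ j t, ∃ y : ℤ, mev (v j) (col t) = ∑ σ ∈ Std (i (z j)) (m0 (z j)) M k0, cc (z j) t σ * mev (w j) σ
      + (p : ℤ) ^ k0 * y := by
    intro j t
    obtain ⟨y, hy⟩ := hcc (z j) t (w j) (hwW j)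
    refine ⟨y, ?_⟩
    rw [← hy, eval_sh]
    have := hsub j
    simp only [z] at this ⊢
    rw [this]
    ring
  choose y hy using hq
  let T := (Σ x : Z, Std (i x) (m0 x) M k0) ⊕ s
  refine det_dvd (T := T) A
    (fun j t => Sum.elim (fun a => if a.1 = z j then mev (w j) a.2 else 0)
      (fun j' => if j' = j then (p : ℤ) ^ k0 else 0) t)
    (fun t b => Sum.elim (fun a => cc a.1 b a.2) (fun j' => y j' b) t) ?_ p
    (Sum.elim (fun a => offd (i a.1) a.2) (fun _ => k0)) ?_ k0 e ?_
  · intro j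
    ext b
    rw [hA, hy, Fintype.sum_sum_type, Pi.add_apply, Finset.sum_apply, Finset.sum_apply, Fintype.sum_sigma]
    simp only [Pi.smul_apply, smul_eq_mul, Sum.elim_inl, Sum.elim_inr, ite_mul, zero_mul]
    congr 1
    · rw [Finset.sum_eq_single (z j)]
      · simp only [if_true]
        rw [← Finset.sum_coe_sort]
        exact Finset.sum_congr rfl fun _ _ => mul_comm _ _
      · intro x _ hx
        simp [hx]
      · simp
    · simp
  · rintro j (⟨x, σ⟩ | j')
    · simp only [Sum.elim_inl]
      split_ifs with h
      · subst h
        exact dvd_mev (hpw j _ (by simp)) (hpw j _ (by simp)) _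
      · exact dvd_zero _
    · simp only [Sum.elim_inr]
      split_ifs
      · exact dvd_rfl
      · exact dvd_zero _
  · rw [Fintype.sum_sum_type]
    simp only [Sum.elim_inl, Sum.elim_inr, Nat.sub_self, Finset.sum_const_zero, add_zero]
    rw [Fintype.sum_sigma]
    dsimp only
    have h1 : ∀ x : Z, (∑ a : Std (i x) (m0 x) M k0, (k0 - offd (i x) a)) * 2 ≤
        offd (i x) (m0 x) * (k0 * (k0 + 1)) := by
      intro x
      refine le_trans (le_of_eq ?_) (std_weight (i x) (m0 x) M k0)
      rw [Finset.sum_coe_sort (Std (i x) (m0 x) M k0) (fun a => k0 - offd (i x) a)]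
    have h2 : ∑ x : Z, offd (i x) (m0 x) ≤ p + 24 * d ^ 2 * Nat.sqrt p := by
      have := count_bound hd hdp (hf.map _) hirr Z (fun x hx => by
        obtain ⟨j, _, rfl⟩ := Finset.mem_image.1 hx
        exact ⟨hrN j, hrf j⟩) (fun x => if h : x ∈ Z then offd (i ⟨x, h⟩) (m0 ⟨x, h⟩) else 0)
        (fun x hx => by simp only [dif_pos hx]; exact hmud ⟨x, hx⟩)
        (fun x hx => by simp only [dif_pos hx]; exact hmu1 ⟨x, hx⟩)
      rw [← Finset.sum_coe_sort] at this
      simpa using this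
    have h3 := Finset.sum_le_sum fun (x : Z) (_ : x ∈ Finset.univ) => h1 x
    rw [← Finset.sum_mul, ← Finset.sum_mul] at h3
    have h4 := Nat.mul_le_mul_right (k0 * (k0 + 1)) h2
    omega

end PW

namespace PW
open MvPolynomial

/-- primitivity of an integral polynomial -/
def Prim (f : MvPolynomial (Fin 3) ℤ) : Prop := ∀ p : ℕ, p.Prime → ¬ C (p : ℤ) ∣ f

lemma Prim.dvd {f : MvPolynomial (Fin 3) ℤ} (hf : Prim f) (n : ℕ) : n ≠ 0 →
    ∀ h : MvPolynomial (Fin 3) ℤ, C (n : ℤ) ∣ f * h → C (n : ℤ) ∣ h := by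
  induction n using induction_on_primes with
  | zero => intro h; exact absurd rfl h
  | one => intro _ h _; simp
  | prime_mul p a hp ih =>
    intro h0 h hd
    have ha : a ≠ 0 := by rintro rfl; simp at h0
    have hpp : Prime (C (p : ℤ) : MvPolynomial (Fin 3) ℤ) :=
      (prime_C_iff (Fin 3)).2 (Nat.prime_iff_prime_int.1 hp)
    have h1 : C (p : ℤ) ∣ f * h := (Dvd.intro (C (a : ℤ)) (by push_cast; simp)).trans hd
    obtain ⟨k, rfl⟩ := (hpp.2.2 _ _ h1).resolve_left (hf p hp)
    rw [Nat.cast_mul, C_mul] at hd ⊢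
    refine mul_dvd_mul_left _ (ih ha k ?_)
    rw [show f * (C (p : ℤ) * k) = C (p : ℤ) * (f * k) by ring] at hd
    exact (mul_dvd_mul_iff_left hpp.ne_zero).1 hd

lemma exists_split {f : MvPolynomial (Fin 3) ℤ} {d k M : ℕ} (hf : f.IsHomogeneous d) (hprim : Prim f)
    (hM : d + k = M) : ∃ θ : homogeneousSubmodule (Fin 3) ℤ M →ₗ[ℤ] homogeneousSubmodule (Fin 3) ℤ k,
      ∀ (x : homogeneousSubmodule (Fin 3) ℤ M) (y : homogeneousSubmodule (Fin 3) ℤ k), (x : MvPolynomial (Fin 3) ℤ) = f * y → θ x = y := by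
  have hf0 : f ≠ 0 := by
    rintro rfl
    exact hprim 2 Nat.prime_two (dvd_zero _)
  let F : homogeneousSubmodule (Fin 3) ℤ k →ₗ[ℤ] homogeneousSubmodule (Fin 3) ℤ M :=
    (LinearMap.mulLeft ℤ f).restrict (fun x hx => by
      rw [← hM]
      exact hf.mul hx)
  have hFv : ∀ y, (F y : MvPolynomial (Fin 3) ℤ) = f * y := fun y => rfl
  have hFinj : Function.Injective F := by
    intro x y hxy
    have := congrArg Subtype.val hxy
    rw [hFv, hFv] at this
    exact Subtype.ext (mul_left_cancel₀ hf0 this)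
  have hfin : Module.Finite ℤ (homogeneousSubmodule (Fin 3) ℤ M) := by
    rw [hom_eq_span]
    exact Module.Finite.span_of_finite ℤ (Set.finite_range _)
  have htf : Module.IsTorsionFree ℤ (homogeneousSubmodule (Fin 3) ℤ M ⧸ LinearMap.range F) := by
    refine Module.IsTorsionFree.of_smul_eq_zero fun r m hrm => ?_
    obtain ⟨x, rfl⟩ := Submodule.Quotient.mk_surjective _ m
    by_cases hr : r = 0
    · exact Or.inl hr
    right
    rw [← Submodule.Quotient.mk_smul, Submodule.Quotient.mk_eq_zero] at hrm
    obtain ⟨y, hy⟩ := hrm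
    have hy' := congrArg Subtype.val hy
    rw [hFv] at hy'
    have e1 : ((r • x : homogeneousSubmodule (Fin 3) ℤ M) : MvPolynomial (Fin 3) ℤ) = C r * (x : MvPolynomial (Fin 3) ℤ) := by
      rw [Submodule.coe_smul, smul_eq_C_mul]
    rw [e1] at hy'
    have hn : r.natAbs ≠ 0 := Int.natAbs_ne_zero.2 hr
    have hnr : C (r.natAbs : ℤ) ∣ (C r : MvPolynomial (Fin 3) ℤ) := map_dvd C (Int.natAbs_dvd.2 dvd_rfl)
    have hrn : (C r : MvPolynomial (Fin 3) ℤ) ∣ C (r.natAbs : ℤ) := map_dvd C (Int.dvd_natAbs.2 dvd_rfl)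
    obtain ⟨z, hz⟩ := hrn.trans (hprim.dvd r.natAbs hn y (by rw [hy']; exact Dvd.dvd.mul_right hnr _))
    rw [Submodule.Quotient.mk_eq_zero]
    have hzh : z.IsHomogeneous k := by
      intro m hm
      refine y.2 (d := m) ?_
      rw [hz, coeff_C_mul]
      exact mul_ne_zero hr hm
    refine ⟨⟨z, hzh⟩, Subtype.ext ?_⟩
    rw [hFv]
    have hC : (C r : MvPolynomial (Fin 3) ℤ) ≠ 0 := by simpa using hr
    refine mul_left_cancel₀ hC ?_
    rw [← hy', hz]
    change C r * (f * z) = f * (C r * z)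
    ring
  obtain ⟨σ, hσ⟩ := (LinearMap.range F).mkQ.exists_rightInverse_of_surjective (Submodule.range_mkQ _)
  let E := LinearEquiv.ofInjective F hFinj
  let G : homogeneousSubmodule (Fin 3) ℤ M →ₗ[ℤ] LinearMap.range F :=
    (LinearMap.id - σ ∘ₗ (LinearMap.range F).mkQ).codRestrict _ (fun x => by
      refine (Submodule.Quotient.mk_eq_zero _).1 ?_
      rw [← Submodule.mkQ_apply]
      have := LinearMap.congr_fun hσ ((LinearMap.range F).mkQ x)
      simp only [LinearMap.comp_apply, LinearMap.id_apply] at this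
      simp only [LinearMap.sub_apply, LinearMap.comp_apply, LinearMap.id_apply, map_sub, this, sub_self])
  refine ⟨E.symm.toLinearMap ∘ₗ G, fun x y hxy => ?_⟩
  have hx : x = F y := Subtype.ext hxy
  rw [LinearMap.comp_apply, LinearEquiv.coe_coe, LinearEquiv.symm_apply_eq]
  apply Subtype.ext
  have h0 : (LinearMap.range F).mkQ x = 0 := by
    rw [hx]
    exact (Submodule.Quotient.mk_eq_zero _).2 ⟨y, rfl⟩
  simp only [G, LinearMap.codRestrict_apply, LinearMap.sub_apply, LinearMap.comp_apply, LinearMap.id_apply, h0,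
    map_zero, sub_zero]
  exact hx

end PW

namespace PW
open MvPolynomial

/-- monomials of degree `M` with small exponent of `x_0` -/
noncomputable def lowS (d M : ℕ) : Finset (Fin 3 →₀ ℕ) := (monS M).filter fun m => m 0 < d

lemma mem_lowS {d M : ℕ} {m : Fin 3 →₀ ℕ} : m ∈ lowS d M ↔ m.degree = M ∧ m 0 < d := by
  rw [lowS, Finset.mem_filter, mem_monS]

/-- the columns -/
noncomputable def colm (d M k : ℕ) : lowS d M ⊕ monS k → (Fin 3 →₀ ℕ) :=
  Sum.elim (fun m => (m : Fin 3 →₀ ℕ)) (fun m => (m : Fin 3 →₀ ℕ) + Finsupp.single 0 d)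

lemma colm_deg {d M k : ℕ} (hM : d + k = M) (c) : (colm d M k c).degree = M := by
  rcases c with ⟨m, hm⟩ | ⟨m, hm⟩
  · exact (mem_lowS.1 hm).1
  · simp only [colm, Sum.elim_inr, map_add, Finsupp.degree_single, mem_monS.1 hm]
    omega

lemma colm_inj (d M k : ℕ) : Function.Injective (colm d M k) := by
  rintro (⟨m, hm⟩ | ⟨m, hm⟩) (⟨n, hn⟩ | ⟨n, hn⟩) h
  · simpa [colm] using h
  · exfalso
    have := (mem_lowS.1 hm).2
    have h2 : m 0 = n 0 + d := by simpa [colm] using DFunLike.congr_fun h 0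
    omega
  · exfalso
    have := (mem_lowS.1 hn).2
    have h2 : m 0 + d = n 0 := by simpa [colm] using DFunLike.congr_fun h 0
    omega
  · simpa [colm] using h

lemma colm_surj {d M k : ℕ} (hM : d + k = M) {m : Fin 3 →₀ ℕ} (hm : m.degree = M) :
    ∃ c, colm d M k c = m := by
  by_cases h : m 0 < d
  · exact ⟨Sum.inl ⟨m, mem_lowS.2 ⟨hm, h⟩⟩, rfl⟩
  · have hle : Finsupp.single 0 d ≤ m := by
      rw [Finsupp.single_le_iff]; omega
    refine ⟨Sum.inr ⟨m - Finsupp.single 0 d, mem_monS.2 ?_⟩, tsub_add_cancel_of_le hle⟩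
    have := congrArg Finsupp.degree (tsub_add_cancel_of_le hle)
    rw [map_add, Finsupp.degree_single] at this
    omega

lemma sum_colm {R : Type*} [AddCommMonoid R] {d M k : ℕ} (hM : d + k = M) (F : (Fin 3 →₀ ℕ) → R) :
    ∑ c, F (colm d M k c) = ∑ m ∈ monS M, F m := by
  refine Finset.sum_bij (fun c _ => colm d M k c) (fun c _ => mem_monS.2 (colm_deg hM c))
    (fun a _ b _ h => colm_inj d M k h) (fun m hm => ?_) (fun _ _ => rfl)
  obtain ⟨c, hc⟩ := colm_surj hM (mem_monS.1 hm)
  exact ⟨c, Finset.mem_univ _, hc⟩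

lemma card_lowS {d M k : ℕ} (hM : d + k = M) : (lowS d M).card = hil d M := by
  have h := sum_colm hM (fun _ => 1)
  rw [Finset.sum_const, Finset.sum_const, Finset.card_univ, Fintype.card_sum, Fintype.card_coe,
    Fintype.card_coe, card_monS, card_monS] at h
  have h2 := hil_add d M
  have : M - d = k := by omega
  rw [this] at h2
  simp only [smul_eq_mul, mul_one] at h
  omega

lemma hom_sum {R : Type*} [CommRing R] {M : ℕ} {F : MvPolynomial (Fin 3) R} (hF : F.IsHomogeneous M) :
    F = ∑ m ∈ monS M, monomial m (coeff m F) := by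
  conv_lhs => rw [F.as_sum]
  refine Finset.sum_subset (fun m hm => mem_monS.2 (hom_degree hF (mem_support_iff.1 hm))) ?_
  intro m _ hm
  rw [notMem_support_iff.1 hm, map_zero]

lemma det_low {R : Type*} [CommRing R] {f : MvPolynomial (Fin 3) R} {d k : ℕ} (hf : f.IsHomogeneous d) :
    (Matrix.of fun m n : monS k => coeff ((m : Fin 3 →₀ ℕ) + Finsupp.single 0 d) (f * monomial (n : Fin 3 →₀ ℕ) 1)).det
      = coeff (Finsupp.single 0 d) f ^ (k + 2).choose 2 := by
  classical
  set Y := (Matrix.of fun m n : monS k => coeff ((m : Fin 3 →₀ ℕ) + Finsupp.single 0 d) (f * monomial (n : Fin 3 →₀ ℕ) 1))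
  set c := coeff (Finsupp.single 0 d) f
  have key : ∀ m n : monS k, Y m n ≠ 0 → (m : Fin 3 →₀ ℕ) 0 ≤ (n : Fin 3 →₀ ℕ) 0 ∧
      ((m : Fin 3 →₀ ℕ) 0 = (n : Fin 3 →₀ ℕ) 0 → m = n) := by
    intro m n h
    simp only [Y, Matrix.of_apply, coeff_mul_monomial'] at h
    split_ifs at h with hle
    · have hdeg := hom_degree hf (left_ne_zero_of_mul h)
      rw [fin3_deg 0] at hdeg
      have hm := mem_monS.1 m.2
      have hn := mem_monS.1 n.2
      rw [fin3_deg 0] at hm hn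
      have h0 := hle 0
      have h1 := hle (0 + 1)
      have h2 := hle (0 + 2)
      simp at hdeg h0 h1 h2 hm hn
      refine ⟨by omega, fun he => Subtype.ext (fin3_ext 0 he ?_ ?_)⟩ <;> simp <;> omega
    · exact absurd rfl h
  have hdiag : ∀ m, Y m m = c := by
    intro m
    simp only [Y, Matrix.of_apply, coeff_mul_monomial', c]
    rw [if_pos (by simp)]
    simp
  have hBT : Y.BlockTriangular (fun m : monS k => (m : Fin 3 →₀ ℕ) 0) := by
    intro m n hmn
    by_contra h
    have := (key m n h).1
    simp only at hmn
    omega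
  rw [hBT.det]
  have hb : ∀ a : ℕ, (Y.toSquareBlock (fun m : monS k => (m : Fin 3 →₀ ℕ) 0) a).det =
      c ^ (Finset.univ.filter fun m : monS k => (m : Fin 3 →₀ ℕ) 0 = a).card := by
    intro a
    have : Y.toSquareBlock (fun m : monS k => (m : Fin 3 →₀ ℕ) 0) a = Matrix.diagonal (fun _ => c) := by
      ext m n
      rw [Matrix.toSquareBlock_def, Matrix.of_apply]
      by_cases h : m = n
      · subst h; simp [hdiag]
      · rw [Matrix.diagonal_apply_ne _ h]
        by_contra h2
        exact h (Subtype.ext ((key m n h2).2 (m.2.trans n.2.symm)))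
    rw [this, Matrix.det_diagonal, Finset.prod_const, Finset.card_univ, Fintype.card_subtype]
  rw [Finset.prod_congr rfl fun a _ => hb a, Finset.prod_pow_eq_pow_sum]
  congr 1
  rw [← card_monS, ← Fintype.card_coe, ← Finset.card_univ]
  exact (Finset.card_eq_sum_card_image _ _).symm

/-- The global determinant. -/
theorem global_det {f : MvPolynomial (Fin 3) ℤ} {d M k : ℕ} (hf : f.IsHomogeneous d)
    (hprim : Prim f) (hM : d + k = M) (w : lowS d M → Fin 3 → ℤ) (hw : ∀ j, eval (w j) f = 0) :
    ∃ A : Matrix (lowS d M ⊕ monS k) (lowS d M ⊕ monS k) ℤ,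
      (∀ j c, A (Sum.inl j) c = mev (w j) (colm d M k c)) ∧
      (Matrix.of fun j m : lowS d M => mev (w j) m).det = A.det * coeff (Finsupp.single 0 d) f ^ (k + 2).choose 2 := by
  classical
  obtain ⟨θ, hθ⟩ := exists_split hf hprim hM
  have hmem : ∀ c, monomial (colm d M k c) (1 : ℤ) ∈ homogeneousSubmodule (Fin 3) ℤ M := fun c =>
    isHomogeneous_monomial _ (colm_deg hM c)
  let A : Matrix (lowS d M ⊕ monS k) (lowS d M ⊕ monS k) ℤ := fun r c =>
    Sum.elim (fun j : lowS d M => mev (w j) (colm d M k c)) (fun m : monS k => coeff (m : Fin 3 →₀ ℕ) (θ ⟨_, hmem c⟩ : MvPolynomial (Fin 3) ℤ)) r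
  refine ⟨A, fun j c => rfl, ?_⟩
  let X : Matrix (lowS d M) (monS k) ℤ := fun m n => coeff (m : Fin 3 →₀ ℕ) (f * monomial (n : Fin 3 →₀ ℕ) 1)
  let Y : Matrix (monS k) (monS k) ℤ := Matrix.of fun m n : monS k =>
    coeff ((m : Fin 3 →₀ ℕ) + Finsupp.single 0 d) (f * monomial (n : Fin 3 →₀ ℕ) 1)
  let L : Matrix (monS k) (lowS d M) ℤ := fun m n => A (Sum.inr m) (Sum.inl n)
  have hfn : ∀ n : monS k, (f * monomial (n : Fin 3 →₀ ℕ) 1).IsHomogeneous M := fun n => by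
    rw [← hM]
    exact hf.mul (isHomogeneous_monomial _ (mem_monS.1 n.2))
  have hprod : A * Matrix.fromBlocks 1 X 0 Y =
      Matrix.fromBlocks (Matrix.of fun j m : lowS d M => mev (w j) m) 0 L 1 := by
    have hXY : ∀ c n, (Matrix.fromBlocks (1 : Matrix (lowS d M) (lowS d M) ℤ) X 0 Y) c (Sum.inr n) =
        coeff (colm d M k c) (f * monomial (n : Fin 3 →₀ ℕ) 1) := by
      rintro (m | m) n <;> rfl
    ext r c
    rcases c with c | n
    · have : (A * Matrix.fromBlocks 1 X 0 Y) r (Sum.inl c) = A r (Sum.inl c) := by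
        rw [Matrix.mul_apply, Fintype.sum_sum_type]
        simp [Matrix.one_apply]
      rw [this]
      rcases r with r | r <;> rfl
    · rw [Matrix.mul_apply]
      simp only [hXY]
      rcases r with j | m
      · simp only [A, Sum.elim_inl, Matrix.fromBlocks_apply₁₂, Matrix.zero_apply]
        rw [sum_colm hM (fun m => mev (w j) m * coeff m (f * monomial (n : Fin 3 →₀ ℕ) 1))]
        have h1 := congrArg (eval (w j)) (hom_sum (hfn n))
        rw [map_mul, hw, zero_mul, map_sum] at h1
        rw [h1]
        refine Finset.sum_congr rfl fun m _ => ?_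
        rw [mev, eval_monomial, eval_monomial]
        ring
      · simp only [A, Sum.elim_inr, Matrix.fromBlocks_apply₂₂]
        have h1 := hθ ⟨_, hfn n⟩ ⟨monomial (n : Fin 3 →₀ ℕ) 1, isHomogeneous_monomial _ (mem_monS.1 n.2)⟩ rfl
        have h2 : (⟨_, hfn n⟩ : homogeneousSubmodule (Fin 3) ℤ M) = 
            ∑ c, coeff (colm d M k c) (f * monomial (n : Fin 3 →₀ ℕ) 1) • ⟨_, hmem c⟩ := by
          apply Subtype.ext
          rw [Submodule.coe_sum]
          simp only [Submodule.coe_smul]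
          rw [sum_colm hM (fun m => coeff m (f * monomial (n : Fin 3 →₀ ℕ) 1) • monomial m (1 : ℤ))]
          conv_lhs => rw [hom_sum (hfn n)]
          refine Finset.sum_congr rfl fun m _ => ?_
          rw [smul_monomial, smul_eq_mul, mul_one]
        rw [h2, map_sum] at h1
        have h3 := congrArg (fun y : homogeneousSubmodule (Fin 3) ℤ k => coeff (m : Fin 3 →₀ ℕ) (y : MvPolynomial (Fin 3) ℤ)) h1
        simp only [Submodule.coe_sum, coeff_sum, map_smul, Submodule.coe_smul, coeff_smul, smul_eq_mul,
          coeff_monomial] at h3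
        rw [Matrix.one_apply]
        rw [Finset.sum_congr rfl fun c _ => mul_comm _ _, h3]
        simp only [Subtype.ext_iff]
        exact if_congr eq_comm rfl rfl
  have hdet := congrArg Matrix.det hprod
  rw [Matrix.det_mul, Matrix.det_fromBlocks_zero₂₁, Matrix.det_fromBlocks_zero₁₂, Matrix.det_one, Matrix.det_one,
    one_mul, mul_one, det_low hf] at hdet
  exact hdet.symm

end PW

namespace PW
open MvPolynomial

lemma low_eq_zero {K : Type*} [Field K] {f : MvPolynomial (Fin 3) K} {d M k : ℕ} (hf : f.IsHomogeneous d)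
    (hM : d + k = M) (hc : coeff (Finsupp.single 0 d) f ≠ 0) {g : MvPolynomial (Fin 3) K}
    (hg : g.IsHomogeneous M) (hlow : ∀ m, coeff m g ≠ 0 → m 0 < d) (hfg : f ∣ g) : g = 0 := by
  obtain ⟨h, hh, rfl⟩ := dvd_hom hf (by omega) hg hfg
  have hk : M - d = k := by omega
  rw [hk] at hh
  set Y := (Matrix.of fun m n : monS k => coeff ((m : Fin 3 →₀ ℕ) + Finsupp.single 0 d) (f * monomial (n : Fin 3 →₀ ℕ) 1)) with hY
  have hdet : Y.det ≠ 0 := by rw [hY, det_low hf]; exact pow_ne_zero _ hc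
  have : Y.mulVec (fun n => coeff (n : Fin 3 →₀ ℕ) h) = 0 := by
    ext m
    have h1 : coeff ((m : Fin 3 →₀ ℕ) + Finsupp.single 0 d) (f * h) = 0 := by
      by_contra h2
      have := hlow _ h2
      simp at this
    rw [hom_sum hh, Finset.mul_sum, coeff_sum, ← Finset.sum_coe_sort] at h1
    rw [Matrix.mulVec, dotProduct, Pi.zero_apply, ← h1]
    refine Finset.sum_congr rfl fun n _ => ?_
    rw [hY, Matrix.of_apply, mul_comm, ← coeff_C_mul]
    congr 1
    rw [show (monomial (n : Fin 3 →₀ ℕ)) (coeff (n : Fin 3 →₀ ℕ) h) = C (coeff (n : Fin 3 →₀ ℕ) h) * monomial (n : Fin 3 →₀ ℕ) 1 by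
      rw [C_mul_monomial, mul_one]]
    ring
  have h0 := Matrix.eq_zero_of_mulVec_eq_zero hdet this
  have : h = 0 := by
    rw [hom_sum hh]
    refine Finset.sum_eq_zero fun m hm => ?_
    have := congrFun h0 ⟨m, hm⟩
    simp only [Pi.zero_apply] at this
    rw [this, map_zero]
  rw [this, mul_zero]

lemma cast_mev (w : Fin 3 → ℤ) (m : Fin 3 →₀ ℕ) (x : ℚ) :
    eval (fun a => (w a : ℚ)) (monomial m x) = x * (mev w m : ℚ) := by
  rw [mev_eq 0, eval_monomial, Finsupp.prod_fintype _ _ (by simp), Fin.prod_univ_three]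
  push_cast
  rw [mul_assoc]

lemma mev_le {w : Fin 3 → ℤ} {B : ℕ} (hB : ∀ i, |w i| ≤ B) {m : Fin 3 →₀ ℕ} {M : ℕ} (hm : m.degree = M) :
    |mev w m| ≤ (B : ℤ) ^ M := by
  rw [fin3_deg 0] at hm
  rw [mev_eq 0, abs_mul, abs_mul, abs_pow, abs_pow, abs_pow, ← hm, pow_add, pow_add, mul_assoc]
  have h1 := pow_le_pow_left₀ (abs_nonneg _) (hB 0) (m 0)
  have h2 := pow_le_pow_left₀ (abs_nonneg _) (hB (0 + 1)) (m (0 + 1))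
  have h3 := pow_le_pow_left₀ (abs_nonneg _) (hB (0 + 2)) (m (0 + 2))
  have hB0 : (0 : ℤ) ≤ B := by positivity
  exact mul_le_mul h1 (mul_le_mul h2 h3 (by positivity) (by positivity)) (by positivity) (by positivity)

theorem main_det {ι : Type*} [Fintype ι] {f : MvPolynomial (Fin 3) ℤ} {d M k : ℕ} (hd : 1 ≤ d) (hf : f.IsHomogeneous d)
    (hprim : Prim f) (hirr : Irreducible (map (Int.castRingHom ℚ) f))
    (hc : coeff (Finsupp.single 0 d) f ≠ 0) (hM : d + k = M)
    (v : ι → Fin 3 → ℤ) (hv : ∀ j, eval (v j) f = 0) (hvp : ∀ j (p : ℕ), p.Prime → ∃ i, ¬ (p : ℤ) ∣ v j i)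
    (hvv : ∀ i j, i ≠ j → ∀ c : ℚ, (fun a => (v i a : ℚ)) ≠ c • fun a => (v j a : ℚ))
    (B : ℕ) (hB : ∀ j i, |v j i| ≤ B) (hcard : d * M < Fintype.card ι) :
    ∃ D : ℕ, D ≠ 0 ∧ D * (coeff (Finsupp.single 0 d) f).natAbs ^ (k + 2).choose 2 ≤
        (hil d M).factorial * (B ^ M) ^ hil d M ∧
      ∀ (p : ℕ) [Fact p.Prime], 400 * d ^ 4 ≤ p → Irreducible (map (Int.castRingHom (ZMod p)) f) →
        ∀ k0 e : ℕ, k0 + d ≤ M + 1 →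
          2 * e + (p + 24 * d ^ 2 * Nat.sqrt p) * (k0 * (k0 + 1)) ≤ 2 * (k0 * hil d M) → p ^ e ∣ D := by
  classical
  let Q : Matrix ι (lowS d M) ℚ := fun j m => (mev (v j) m : ℚ)
  have hQ : ∀ x, Q.mulVec x = 0 → x = 0 := by
    intro x hx
    set g : MvPolynomial (Fin 3) ℚ := ∑ m : lowS d M, monomial (m : Fin 3 →₀ ℕ) (x m) with hg
    have hgc : ∀ m, coeff m g = if h : m ∈ lowS d M then x ⟨m, h⟩ else 0 := by
      intro m
      rw [hg, coeff_sum]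
      simp only [coeff_monomial]
      split_ifs with h
      · rw [Finset.sum_eq_single ⟨m, h⟩]
        · simp
        · rintro ⟨b, hb⟩ _ hne
          rw [if_neg]
          rintro rfl
          exact hne rfl
        · simp
      · refine Finset.sum_eq_zero fun n _ => if_neg ?_
        rintro rfl
        exact h n.2
    have hghom : g.IsHomogeneous M := by
      refine IsHomogeneous.sum _ _ _ fun m _ => isHomogeneous_monomial _ (mem_lowS.1 m.2).1
    have hg0 : g = 0 := by
      refine low_eq_zero (f := map (Int.castRingHom ℚ) f) (hf.map _) hM ?_ hghom ?_ ?_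
      · rw [coeff_map]; simpa using hc
      · intro m hm
        rw [hgc] at hm
        split_ifs at hm with h
        · exact (mem_lowS.1 h).2
        · exact absurd rfl hm
      · by_contra hnd
        have := bezout (hf.map _) hirr hghom hnd (fun j a => (v j a : ℚ)) (fun j h => by
          obtain ⟨i, hi⟩ := hvp j 2 Nat.prime_two
          have := congrFun h i
          simp only [Pi.zero_apply, Int.cast_eq_zero] at this
          rw [this] at hi
          exact hi (dvd_zero _)) hvv (fun j => by
            have := congrArg (Int.castRingHom ℚ) (hv j)
            rw [map_zero] at this
            rw [eval_map, ← this, ← eval₂_id, eval₂_comp_left]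
            rfl) (fun j => by
            have := congrFun hx j
            rw [Pi.zero_apply] at this
            rw [hg, map_sum, ← this]
            simp only [cast_mev, Matrix.mulVec, dotProduct, Q]
            exact Finset.sum_congr rfl fun _ _ => mul_comm _ _)
        omega
    ext m
    have := hgc m
    rw [hg0, dif_pos m.2] at this
    simpa using this.symm
  obtain ⟨g, hg⟩ := exists_minor Q hQ
  obtain ⟨A, hA, hdet⟩ := global_det hf hprim hM (fun j => v (g j)) (fun j => hv _)
  have hΔ : (Matrix.of fun j m : lowS d M => mev (v (g j)) m).det ≠ 0 := by
    intro h
    apply hg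
    have h1 := congrArg (Int.castRingHom ℚ) h
    rw [map_zero, RingHom.map_det] at h1
    rw [← h1]
    rfl
  have hcs : Fintype.card (lowS d M) = hil d M := by rw [Fintype.card_coe, card_lowS hM]
  refine ⟨A.det.natAbs, ?_, ?_, ?_⟩
  · rw [Int.natAbs_ne_zero]
    intro h
    rw [hdet, h, zero_mul] at hΔ
    exact hΔ rfl
  · have h1 : |(Matrix.of fun j m : lowS d M => mev (v (g j)) m).det| ≤
      (Fintype.card (lowS d M)).factorial • ((B : ℤ) ^ M) ^ Fintype.card (lowS d M) := by
      refine Matrix.det_le (abv := AbsoluteValue.abs) ?_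
      intro i j
      rw [Matrix.of_apply]
      change |mev _ _| ≤ _
      exact mev_le (hB _) (mem_lowS.1 j.2).1
    rw [hdet, hcs, abs_mul, abs_pow, Int.abs_eq_natAbs, Int.abs_eq_natAbs, nsmul_eq_mul] at h1
    exact_mod_cast h1
  · intro p hp hdp hi k0 e hk0 he
    have := prime_dvd hd hdp hf hi (fun j => v (g j)) (fun j => hv _) (fun j => hvp _ p hp.out) (colm d M k)
      (colm_deg hM) A hA hk0 (e := e) (by rw [hcs]; exact he)
    have h2 := Int.natAbs_dvd_natAbs.2 this
    simpa [Int.natAbs_pow] using h2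

end PW

namespace PW

lemma theta_bd (n : ℕ) : ∑ p ∈ Nat.primesLE n, Real.log p ≤ Real.log 4 * n := by
  rw [← Chebyshev.theta_eq_sum_primesLE_log]
  exact Chebyshev.theta_le_log4_mul_x (by positivity)

lemma log4_lt : Real.log 4 < 1.39 := by
  have : Real.log 4 = 2 * Real.log 2 := by
    rw [show (4 : ℝ) = 2 ^ 2 by norm_num, Real.log_pow]; norm_num
  rw [this]
  have := Real.log_two_lt_d9
  linarith

lemma tail_bd (N : ℕ) : ∀ (t Y : ℕ), 1 ≤ Y → N + 1 ≤ Y + t →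
    ∑ p ∈ (Nat.primesLE N).filter (fun p => Y ≤ p), Real.log p / (p * Real.sqrt p) ≤ 10 / Real.sqrt Y := by
  intro t
  induction t using Nat.strong_induction_on with
  | _ t ih =>
  intro Y hY hN
  have hYpos : (0 : ℝ) < Y := by exact_mod_cast hY
  have hsq : 0 < Real.sqrt Y := Real.sqrt_pos.2 hYpos
  rcases Nat.eq_zero_or_pos t with rfl | ht
  · rw [Finset.sum_eq_zero]
    · positivity
    · intro p hp
      rw [Finset.mem_filter, Nat.mem_primesLE] at hp
      omega
  have h2 := ih (t - Y) (by omega) (2 * Y) (by omega) (by omega)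
  rw [← Finset.sum_filter_add_sum_filter_not ((Nat.primesLE N).filter (fun p => Y ≤ p)) (fun p => 2 * Y ≤ p),
    Finset.filter_filter, Finset.filter_filter]
  have h3 : (Nat.primesLE N).filter (fun p => Y ≤ p ∧ 2 * Y ≤ p) = (Nat.primesLE N).filter (fun p => 2 * Y ≤ p) :=
    Finset.filter_congr fun p _ => ⟨fun h => h.2, fun h => ⟨by omega, h⟩⟩
  rw [h3]
  have h4 : ∑ p ∈ (Nat.primesLE N).filter (fun p => Y ≤ p ∧ ¬ 2 * Y ≤ p), Real.log p / (p * Real.sqrt p)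
      ≤ (∑ p ∈ Nat.primesLE (2 * Y), Real.log p) / (Y * Real.sqrt Y) := by
    rw [Finset.sum_div]
    refine (Finset.sum_le_sum fun p hp => ?_).trans (Finset.sum_le_sum_of_subset_of_nonneg ?_ ?_)
    · rw [Finset.mem_filter] at hp
      have : (Y : ℝ) ≤ p := by exact_mod_cast hp.2.1
      have hl : 0 ≤ Real.log p := Real.log_natCast_nonneg p
      gcongr
    · intro p hp
      rw [Finset.mem_filter, Nat.mem_primesLE] at hp
      rw [Nat.mem_primesLE]
      exact ⟨by omega, hp.1.2⟩
    · intro p _ _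
      have hl : 0 ≤ Real.log p := Real.log_natCast_nonneg p
      positivity
  have h5 : (∑ p ∈ Nat.primesLE (2 * Y), Real.log p) / (Y * Real.sqrt Y) ≤ 2.78 / Real.sqrt Y := by
    rw [div_le_div_iff₀ (by positivity) hsq]
    have := theta_bd (2 * Y)
    have h6 := log4_lt
    push_cast at this
    have h7 : (∑ p ∈ Nat.primesLE (2 * Y), Real.log p) ≤ 2.78 * Y := by nlinarith
    calc _ ≤ 2.78 * (Y : ℝ) * Real.sqrt Y := by gcongr
      _ = _ := by ring
  have h8 : 10 / Real.sqrt ((2 * Y : ℕ) : ℝ) ≤ 7.15 / Real.sqrt Y := by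
    push_cast
    rw [Real.sqrt_mul (by norm_num), div_le_div_iff₀ (by positivity) hsq]
    have : (1.4 : ℝ) ≤ Real.sqrt 2 := Real.le_sqrt_of_sq_le (by norm_num)
    have : 10 ≤ 7.15 * Real.sqrt 2 := by linarith
    calc 10 * Real.sqrt Y ≤ (7.15 * Real.sqrt 2) * Real.sqrt Y := by gcongr
      _ = _ := by ring
  have h9 : 2.78 / Real.sqrt Y + 7.15 / Real.sqrt Y ≤ 10 / Real.sqrt Y := by
    rw [← add_div]
    gcongr
    norm_num
  linarith

lemma log_fact (n : ℕ) : Real.log n.factorial = ∑ p ∈ Nat.primesLE n, (padicValNat p n.factorial : ℝ) * Real.log p := by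
  rw [Real.log_nat_eq_sum_factorization, Finsupp.sum, Nat.support_factorization]
  refine Finset.sum_congr_of_eq_on_inter ?_ ?_ ?_
  · intro p hp hn
    exfalso
    apply hn
    rw [Nat.mem_primesLE]
    exact ⟨(Nat.prime_of_mem_primeFactors hp).dvd_factorial.1 (Nat.dvd_of_mem_primeFactors hp),
      Nat.prime_of_mem_primeFactors hp⟩
  · intro p hp hn
    rw [Nat.mem_primesLE] at hp
    exact absurd (Nat.mem_primeFactors.2 ⟨hp.2, hp.2.dvd_factorial.2 hp.1, Nat.factorial_ne_zero _⟩) hn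
  · intro p hp _
    rw [Nat.factorization_def _ (Nat.prime_of_mem_primeFactors hp)]

lemma log_fact_le (n : ℕ) : Real.log n.factorial ≤ n * Real.log n := by
  rw [← Real.log_pow]
  refine Real.log_le_log (by exact_mod_cast Nat.factorial_pos n) ?_
  exact_mod_cast Nat.factorial_le_pow n

lemma mertens_upper {n : ℕ} (hn : 1 ≤ n) : ∑ p ∈ Nat.primesLE n, Real.log p / p ≤ Real.log n + 1.39 := by
  have hn0 : (0 : ℝ) < n := by exact_mod_cast hn
  have h1 : ∑ p ∈ Nat.primesLE n, ((n : ℝ) / p - 1) * Real.log p ≤ Real.log n.factorial := by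
    rw [log_fact]
    refine Finset.sum_le_sum fun p hp => ?_
    rw [Nat.mem_primesLE] at hp
    haveI := Fact.mk hp.2
    have hp0 : (0 : ℝ) < p := by exact_mod_cast hp.2.pos
    refine mul_le_mul_of_nonneg_right ?_ (Real.log_natCast_nonneg p)
    have h2 : n / p ≤ padicValNat p n.factorial := by
      rw [← padicValNat_mul_div_factorial, padicValNat_factorial_mul]
      omega
    have h3 : (n : ℝ) / p ≤ (n / p : ℕ) + 1 := by
      rw [div_le_iff₀ hp0]
      have := Nat.lt_div_mul_add (a := n) hp.2.pos
      have h4 : n ≤ (n / p + 1) * p := by rw [add_mul, one_mul]; omega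
      exact_mod_cast h4
    have h4 : ((n / p : ℕ) : ℝ) ≤ padicValNat p n.factorial := by exact_mod_cast h2
    linarith
  have h2 := log_fact_le n
  have h3 := theta_bd n
  have h4 : ∑ p ∈ Nat.primesLE n, ((n : ℝ) / p - 1) * Real.log p =
      n * (∑ p ∈ Nat.primesLE n, Real.log p / p) - ∑ p ∈ Nat.primesLE n, Real.log p := by
    rw [Finset.mul_sum, ← Finset.sum_sub_distrib]
    refine Finset.sum_congr rfl fun p _ => ?_
    ring
  have h5 := log4_lt
  have h6 : (n : ℝ) * (∑ p ∈ Nat.primesLE n, Real.log p / p) ≤ n * (Real.log n + 1.39) := by nlinarith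
  exact le_of_mul_le_mul_left h6 hn0

lemma mertens_lower {n : ℕ} (hn : 1 ≤ n) : Real.log n - 21 ≤ ∑ p ∈ Nat.primesLE n, Real.log p / p := by
  have hn0 : (0 : ℝ) < n := by exact_mod_cast hn
  have h1 : Real.log n.factorial ≤ n * ∑ p ∈ Nat.primesLE n, (Real.log p / p + 2 * (Real.log p / (p * Real.sqrt p))) := by
    rw [log_fact, Finset.mul_sum]
    refine Finset.sum_le_sum fun p hp => ?_
    rw [Nat.mem_primesLE] at hp
    haveI := Fact.mk hp.2
    have hp2 : (2 : ℝ) ≤ p := by exact_mod_cast hp.2.two_le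
    have hl : 0 ≤ Real.log p := Real.log_natCast_nonneg p
    have h2 : (p - 1) * padicValNat p n.factorial ≤ n := by
      rw [sub_one_mul_padicValNat_factorial]
      exact Nat.sub_le _ _
    have h3 : ((p : ℝ) - 1) * padicValNat p n.factorial ≤ n := by
      have h4 : (((p - 1 : ℕ) : ℝ)) = (p : ℝ) - 1 := by
        rw [Nat.cast_sub hp.2.one_lt.le, Nat.cast_one]
      rw [← h4]
      exact_mod_cast h2
    have h4 : (padicValNat p n.factorial : ℝ) ≤ n / (p - 1) := by
      rw [le_div_iff₀ (by linarith)]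
      linarith
    have hsq : Real.sqrt p ≤ p := by
      rw [Real.sqrt_le_left (by linarith)]
      nlinarith
    have hsp : 0 < Real.sqrt p := Real.sqrt_pos.2 (by linarith)
    have h5 : 1 / ((p : ℝ) - 1) ≤ 1 / p + 2 / (p * Real.sqrt p) := by
      have h6 : 2 / ((p : ℝ) * p) ≤ 2 / (p * Real.sqrt p) := by gcongr
      refine le_trans ?_ (add_le_add_right h6 _)
      rw [div_add_div _ _ (by positivity) (by positivity), div_le_div_iff₀ (by linarith) (by positivity)]
      nlinarith [mul_nonneg (show (0:ℝ) ≤ p by linarith) (show (0:ℝ) ≤ p - 2 by linarith)]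
    calc (padicValNat p n.factorial : ℝ) * Real.log p ≤ n / (p - 1) * Real.log p := by gcongr
      _ = n * Real.log p * (1 / (p - 1)) := by ring
      _ ≤ n * Real.log p * (1 / p + 2 / (p * Real.sqrt p)) := by gcongr
      _ = _ := by ring
  have h2 : n * Real.log n - n ≤ Real.log n.factorial := by
    have := Stirling.le_log_factorial_stirling (n := n) (by omega)
    have h3 : 0 ≤ Real.log n := Real.log_natCast_nonneg n
    have h4 : 0 ≤ Real.log (2 * Real.pi) := Real.log_nonneg (by have := Real.pi_gt_three; linarith)
    linarith
  have h3 := tail_bd n (n + 1) 1 le_rfl (by omega)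
  rw [Finset.filter_true_of_mem (fun p hp => (Nat.mem_primesLE.1 hp).2.one_lt.le)] at h3
  rw [Finset.sum_add_distrib, ← Finset.mul_sum] at h1
  simp only [Nat.cast_one, Real.sqrt_one, div_one] at h3
  have h6 : (n : ℝ) * (Real.log n - 21) ≤ n * ∑ p ∈ Nat.primesLE n, Real.log p / p := by nlinarith
  exact le_of_mul_le_mul_left h6 hn0

end PW

namespace PW

/-- number of classes bound -/
def nn (d p : ℕ) : ℕ := p + 24 * d ^ 2 * Nat.sqrt p

/-- exponent of `p` -/
def ee (d s p : ℕ) : ℕ := (s / nn d p) * s - nn d p * ((s / nn d p) * (s / nn d p + 1) / 2)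

lemma ee_aux (n s : ℕ) : 2 * ((s / n) * s - n * ((s / n) * (s / n + 1) / 2)) + n * ((s / n) * (s / n + 1)) =
    2 * ((s / n) * s) := by
  set k := s / n
  have h1 : k * (k + 1) / 2 * 2 = k * (k + 1) := Nat.div_mul_cancel (Nat.even_mul_succ_self k).two_dvd
  set t := k * (k + 1) / 2
  have h2 : n * k ≤ s := by rw [mul_comm]; exact Nat.div_mul_le_self s n
  have h3 : n * (k * (k + 1)) ≤ 2 * (k * s) := by
    rcases Nat.eq_zero_or_pos k with h | h
    · simp [h]
    · have : n ≤ n * k := Nat.le_mul_of_pos_right n h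
      nlinarith [Nat.mul_le_mul_left k (show n * k + n ≤ 2 * s by omega)]
  have h4 : 2 * (n * t) = n * (k * (k + 1)) := by rw [← h1]; ring
  omega

lemma ee_real (d s p : ℕ) (hp : 1 ≤ p) : (s : ℝ) ^ 2 / 2 * (1 / (nn d p : ℝ)) - s / 2 ≤ ee d s p := by
  have hn : 1 ≤ nn d p := by unfold nn; omega
  have hn0 : (0 : ℝ) < nn d p := by exact_mod_cast hn
  have h := ee_aux (nn d p) s
  change 2 * ee d s p + _ = _ at h
  have hr1 : nn d p * (s / nn d p) ≤ s := by rw [mul_comm]; exact Nat.div_mul_le_self s _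
  have hr2 : s ≤ nn d p * (s / nn d p) + nn d p := by
    have := Nat.lt_div_mul_add (a := s) (b := nn d p) hn
    rw [mul_comm] at this
    omega
  generalize nn d p = n at *
  generalize s / n = k at *
  generalize ee d s p = e at *
  have h' : 2 * (e : ℝ) + n * (k * (k + 1)) = 2 * (k * s) := by exact_mod_cast h
  have hr1' : (n : ℝ) * k ≤ s := by exact_mod_cast hr1
  have hr2' : (s : ℝ) ≤ n * k + n := by exact_mod_cast hr2
  have : (s : ℝ) ^ 2 - n * s ≤ 2 * n * e := by
    have : 2 * n * (e : ℝ) = 2 * n * k * s - n ^ 2 * k ^ 2 - n ^ 2 * k := by linear_combination n * h'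
    rw [this]
    nlinarith [mul_nonneg (sub_nonneg.2 hr1') (sub_nonneg.2 hr2')]
  have h2 : ((s : ℝ) ^ 2 - n * s) / (2 * n) ≤ e := by
    rw [div_le_iff₀ (by positivity)]
    linarith
  refine le_trans (le_of_eq ?_) h2
  field_simp

lemma nn_inv {d p : ℕ} (hp : 1 ≤ p) :
    1 / (p : ℝ) - 24 * (d : ℝ) ^ 2 * (1 / (p * Real.sqrt p)) ≤ 1 / (nn d p : ℝ) := by
  have hp0 : (0 : ℝ) < p := by exact_mod_cast hp
  have hs : 0 < Real.sqrt p := Real.sqrt_pos.2 hp0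
  have h1 : (nn d p : ℝ) ≤ p + 24 * d ^ 2 * Real.sqrt p := by
    unfold nn
    push_cast
    gcongr
    exact Real.nat_sqrt_le_real_sqrt
  have hn0 : (0 : ℝ) < nn d p := by unfold nn; push_cast; positivity
  refine le_trans ?_ (one_div_le_one_div_of_le hn0 h1)
  have hss : Real.sqrt p * Real.sqrt p = p := Real.mul_self_sqrt hp0.le
  generalize Real.sqrt p = r at *
  rw [← hss]
  rw [le_div_iff₀ (by positivity)]
  have : (1 / (r * r) - 24 * (d : ℝ) ^ 2 * (1 / (r * r * r))) * (r * r + 24 * d ^ 2 * r) = 1 - (24 * d ^ 2 / r) ^ 2 := by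
    field_simp
    ring
  rw [this]
  nlinarith [sq_nonneg (24 * (d : ℝ) ^ 2 / r)]

lemma log400 : Real.log 400 ≤ 6 := by
  rw [Real.log_le_iff_le_exp (by norm_num)]
  have h1 := Real.exp_one_gt_d9
  have h2 : Real.exp 6 = Real.exp 1 ^ 6 := by rw [← Real.exp_nat_mul]; norm_num
  rw [h2]
  calc (400 : ℝ) ≤ 2.718 ^ 6 := by norm_num
    _ ≤ _ := by gcongr; linarith

open Classical in
lemma good_sum {d s : ℕ} (hd : 1 ≤ d) (hs : 1 ≤ s) (good : ℕ → Prop) (L : ℝ)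
    (hL : ∑ p ∈ (Nat.primesLE s).filter (fun p => 400 * d ^ 4 ≤ p ∧ ¬ good p), Real.log p / p ≤ L) :
    (s : ℝ) ^ 2 / 2 * (Real.log s - 4 * Real.log d - L - 42) ≤
      ∑ p ∈ (Nat.primesLE s).filter (fun p => 400 * d ^ 4 ≤ p ∧ good p), (ee d s p : ℝ) * Real.log p := by
  have hd0 : (0 : ℝ) < d := by exact_mod_cast hd
  have hP : 1 ≤ 400 * d ^ 4 := Nat.mul_pos (by norm_num) (pow_pos hd 4)
  set F := (Nat.primesLE s).filter (fun p => 400 * d ^ 4 ≤ p ∧ good p) with hF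
  have hFp : ∀ p ∈ F, p.Prime ∧ p ≤ s ∧ 400 * d ^ 4 ≤ p := by
    intro p hp
    rw [hF, Finset.mem_filter, Nat.mem_primesLE] at hp
    exact ⟨hp.1.2, hp.1.1, hp.2.1⟩
  have hFsub : F ⊆ Nat.primesLE s := Finset.filter_subset _ _
  have h1 : ∑ p ∈ F, ((s : ℝ) ^ 2 / 2 * (Real.log p / p - 24 * (d : ℝ) ^ 2 * (Real.log p / (p * Real.sqrt p)))
      - s / 2 * Real.log p) ≤ ∑ p ∈ F, (ee d s p : ℝ) * Real.log p := by
    refine Finset.sum_le_sum fun p hp => ?_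
    have hp1 := (hFp p hp).1.one_lt.le
    have hl : 0 ≤ Real.log p := Real.log_natCast_nonneg p
    refine le_trans ?_ (mul_le_mul_of_nonneg_right (ee_real d s p hp1) hl)
    have := mul_le_mul_of_nonneg_left (mul_le_mul_of_nonneg_right (nn_inv (d := d) hp1) hl)
      (show 0 ≤ (s : ℝ) ^ 2 / 2 by positivity)
    calc _ = (s : ℝ) ^ 2 / 2 * ((1 / (p : ℝ) - 24 * (d : ℝ) ^ 2 * (1 / (p * Real.sqrt p))) * Real.log p) - s / 2 * Real.log p := by ring
      _ ≤ _ := by linarith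
  rw [Finset.sum_sub_distrib, ← Finset.mul_sum, ← Finset.mul_sum, Finset.sum_sub_distrib, ← Finset.mul_sum] at h1
  have h2 : ∑ p ∈ F, Real.log p ≤ 1.39 * s := by
    refine (Finset.sum_le_sum_of_subset_of_nonneg hFsub fun p _ _ => Real.log_natCast_nonneg p).trans ?_
    refine (theta_bd s).trans ?_
    gcongr
    exact log4_lt.le
  have h3 : ∑ p ∈ F, Real.log p / (p * Real.sqrt p) ≤ 10 / (20 * d ^ 2) := by
    have := tail_bd s s (400 * d ^ 4) hP (by omega)
    have h4 : Real.sqrt ((400 * d ^ 4 : ℕ) : ℝ) = 20 * d ^ 2 := by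
      push_cast
      rw [show (400 : ℝ) * d ^ 4 = (20 * d ^ 2) ^ 2 by ring]
      exact Real.sqrt_sq (by positivity)
    rw [h4] at this
    refine le_trans (Finset.sum_le_sum_of_subset_of_nonneg ?_ ?_) this
    · intro p hp
      rw [hF, Finset.mem_filter] at hp
      exact Finset.mem_filter.2 ⟨hp.1, hp.2.1⟩
    · intro p _ _
      have hl : 0 ≤ Real.log p := Real.log_natCast_nonneg p
      positivity
  have h3' : 24 * (d : ℝ) ^ 2 * ∑ p ∈ F, Real.log p / (p * Real.sqrt p) ≤ 12 := by
    calc _ ≤ 24 * (d : ℝ) ^ 2 * (10 / (20 * d ^ 2)) := by gcongr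
      _ = 12 := by field_simp; norm_num
  have h5 : Real.log s - 21 ≤ ∑ p ∈ F, Real.log p / p + L + (6 + 4 * Real.log d + 1.39) := by
    refine (mertens_lower hs).trans ?_
    rw [← Finset.sum_filter_add_sum_filter_not (Nat.primesLE s) (fun p => 400 * d ^ 4 ≤ p),
      ← Finset.sum_filter_add_sum_filter_not ((Nat.primesLE s).filter (fun p => 400 * d ^ 4 ≤ p)) good,
      Finset.filter_filter, Finset.filter_filter]
    have h6 : ∑ p ∈ (Nat.primesLE s).filter (fun p => ¬ 400 * d ^ 4 ≤ p), Real.log p / p ≤ 6 + 4 * Real.log d + 1.39 := by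
      have h7 := mertens_upper hP
      have h8 : Real.log ((400 * d ^ 4 : ℕ) : ℝ) ≤ 6 + 4 * Real.log d := by
        push_cast
        rw [Real.log_mul (by norm_num) (by positivity), Real.log_pow]
        have := log400
        push_cast
        linarith
      refine le_trans (Finset.sum_le_sum_of_subset_of_nonneg ?_ ?_) (h7.trans (by linarith))
      · intro p hp
        rw [Finset.mem_filter, Nat.mem_primesLE] at hp
        rw [Nat.mem_primesLE]
        exact ⟨by omega, hp.1.2⟩
      · intro p _ _
        have hl : 0 ≤ Real.log p := Real.log_natCast_nonneg p
        positivity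
    linarith
  refine le_trans ?_ h1
  have hs2 : 0 ≤ (s : ℝ) ^ 2 / 2 := by positivity
  have h6 : Real.log s - 4 * Real.log d - L - 42 + 1.39 ≤ ∑ p ∈ F, Real.log p / p -
      24 * (d : ℝ) ^ 2 * ∑ p ∈ F, Real.log p / (p * Real.sqrt p) := by linarith
  have h7 := mul_le_mul_of_nonneg_left h6 hs2
  have h8 : (s : ℝ) / 2 * ∑ p ∈ F, Real.log p ≤ s / 2 * (1.39 * s) := by gcongr
  nlinarith

end PW

namespace PW
open MvPolynomial

lemma prod_dvd_bound (F : Finset ℕ) (hF : ∀ p ∈ F, p.Prime) (e : ℕ → ℕ) {D : ℕ} (hD : D ≠ 0)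
    (h : ∀ p ∈ F, p ^ e p ∣ D) : ∑ p ∈ F, (e p : ℝ) * Real.log p ≤ Real.log D := by
  have h1 : ∏ p ∈ F, p ^ e p ∣ D := by
    refine Finset.prod_dvd_of_isRelPrime ?_ h
    intro p hp q hq hpq
    exact Nat.coprime_iff_isRelPrime.1 (Nat.coprime_pow_primes _ _ (hF p hp) (hF q hq) hpq)
  have h2 := Nat.le_of_dvd (Nat.pos_of_ne_zero hD) h1
  have h3 : ((∏ p ∈ F, p ^ e p : ℕ) : ℝ) ≤ D := by exact_mod_cast h2
  push_cast at h3
  have hpos : ∀ p ∈ F, (0 : ℝ) < (p : ℝ) ^ e p := fun p hp => by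
    have := (hF p hp).pos
    positivity
  have h4 := Real.log_le_log (Finset.prod_pos hpos) h3
  rw [Real.log_prod (fun p hp => (hpos p hp).ne')] at h4
  simpa only [Real.log_pow] using h4

lemma core_real {d M s c q β L : ℝ} (hd : 1 ≤ d) (hM : 2 * d ≤ M) (hs2 : s * 2 = 2 * d * M + 3 * d - d ^ 2)
    (hq : 2 * q = (M - d + 2) * (M - d + 1)) (hc : 0 ≤ c) (hβ0 : 0 ≤ β) (hβ : β ≤ 2 * M)
    (h0 : q * c ≤ s * Real.log s + s * M * β)
    (h1 : s ^ 2 / 2 * (Real.log s - 4 * Real.log d - L - 42) + q * c ≤ s * Real.log s + s * M * β) :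
    Real.log s + c / d ^ 2 ≤ 4 * Real.log d + L + 2 / d * β + 700 := by
  have hM2 : 2 ≤ M := by linarith
  have hsub : s ≤ d * M + d := by nlinarith
  have hslb : d * M - d ^ 2 / 2 ≤ s := by nlinarith
  have hspos : 0 < s := by nlinarith
  have hlogs : Real.log s ≤ 2 * M := by
    have h3 : s ≤ M ^ 2 := by nlinarith
    calc Real.log s ≤ Real.log (M ^ 2) := Real.log_le_log hspos h3
      _ = 2 * Real.log M := by rw [Real.log_pow]; norm_num
      _ ≤ 2 * M := by
        have := Real.log_le_sub_one_of_pos (show 0 < M by linarith)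
        linarith
  have hlogs2 : Real.log s ≤ s := by
    have := Real.log_le_sub_one_of_pos hspos
    linarith
  -- first bound on c
  have hcb : c ≤ 64 * d * M := by
    have h3 : M ^ 2 / 8 * c ≤ (2 * d * M) * (4 * M ^ 2) := by
      have hq8 : M ^ 2 / 8 ≤ q := by nlinarith
      calc M ^ 2 / 8 * c ≤ q * c := by gcongr
        _ ≤ s * (Real.log s + M * β) := by linarith
        _ ≤ s * (2 * M + M * (2 * M)) := by gcongr
        _ ≤ (2 * d * M) * (4 * M ^ 2) := by
          have h5 : s ≤ 2 * d * M := by nlinarith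
          have h6 : 2 * M + M * (2 * M) ≤ 4 * M ^ 2 := by nlinarith
          exact mul_le_mul h5 h6 (by positivity) (by positivity)
    have h4 : M ^ 2 / 8 * c ≤ M ^ 2 / 8 * (64 * d * M) := by linarith
    exact le_of_mul_le_mul_left h4 (by positivity)
  have h2 : s ^ 2 / 2 * (Real.log s - 4 * Real.log d - L - 42) ≤
      s ^ 2 / 2 * (2 - (c / d ^ 2 - 512) + (2 / d * β + 4)) := by
    have e1 : s * Real.log s ≤ s ^ 2 / 2 * 2 := by nlinarith
    have e2 : s ^ 2 / 2 * (c / d ^ 2 - 512) ≤ q * c := by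
      have f1 : s ^ 2 / d ^ 2 ≤ (M + 1) ^ 2 := by
        rw [div_le_iff₀ (by positivity), ← mul_pow]
        have : s ≤ (M + 1) * d := by linarith
        gcongr
      have f2 : s ^ 2 / d ^ 2 ≤ 2 * q + 2 * d * (M + 1) := by nlinarith
      have f3 : 2 * d * (M + 1) * c ≤ s ^ 2 * 512 := by
        have g1 : d * M * 3 / 4 ≤ s := by nlinarith
        have g2 : (d * M * 3 / 4) * (d * M * 3 / 4) ≤ s * s := by gcongr
        calc 2 * d * (M + 1) * c ≤ 2 * d * (M + 1) * (64 * d * M) := by gcongr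
          _ ≤ (d * M * 3 / 4) * (d * M * 3 / 4) * 342 := by nlinarith [mul_nonneg (mul_nonneg (sq_nonneg d) (show 0 ≤ M by linarith)) (show 0 ≤ M - 2 by linarith)]
          _ ≤ s * s * 342 := by gcongr
          _ ≤ s ^ 2 * 512 := by nlinarith [sq_nonneg s]
      have f4 : s ^ 2 / d ^ 2 * c ≤ (2 * q + 2 * d * (M + 1)) * c := by gcongr
      have f5 : s ^ 2 / 2 * (c / d ^ 2 - 512) = (s ^ 2 / d ^ 2 * c - s ^ 2 * 512) / 2 := by ring
      rw [f5]
      linarith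
    have e3 : s * M * β ≤ s ^ 2 / 2 * (2 / d * β + 4) := by
      have f1 : M ≤ s * (1 / d + 1 / M) := by
        have : 1 / d + 1 / M = (M + d) / (d * M) := by field_simp
        rw [this, mul_div_assoc', le_div_iff₀ (by positivity)]
        nlinarith [mul_nonneg (sq_nonneg d) (show 0 ≤ M - d by linarith), mul_le_mul_of_nonneg_right hslb (show 0 ≤ M + d by linarith)]
      have f2 : 1 / M * β ≤ 2 := by
        rw [one_div, inv_mul_le_iff₀ (by linarith)]
        linarith
      calc s * M * β ≤ s * (s * (1 / d + 1 / M)) * β := by gcongr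
        _ = s ^ 2 * (1 / d * β + 1 / M * β) := by ring
        _ ≤ s ^ 2 * (1 / d * β + 2) := by gcongr
        _ = _ := by ring
    linarith
  have := le_of_mul_le_mul_left h2 (by positivity)
  linarith

open Classical in
theorem core {ι : Type*} [Fintype ι] {f : MvPolynomial (Fin 3) ℤ} {d M : ℕ} (hd : 1 ≤ d) (hf : f.IsHomogeneous d)
    (hprim : Prim f) (hirr : Irreducible (map (Int.castRingHom ℚ) f))
    (hc : coeff (Finsupp.single 0 d) f ≠ 0) (hM : 2 * d ≤ M)
    (v : ι → Fin 3 → ℤ) (hv : ∀ j, eval (v j) f = 0) (hvp : ∀ j (p : ℕ), p.Prime → ∃ i, ¬ (p : ℤ) ∣ v j i)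
    (hvv : ∀ i j, i ≠ j → ∀ c : ℚ, (fun a => (v i a : ℚ)) ≠ c • fun a => (v j a : ℚ))
    (B : ℕ) (hB1 : 1 ≤ B) (hB : ∀ j i, |v j i| ≤ B) (hBM : Real.log B ≤ 2 * M) (hcard : d * M < Fintype.card ι)
    (good : ℕ → Prop) (hgood : ∀ (p : ℕ) [Fact p.Prime], 400 * d ^ 4 ≤ p → good p →
      Irreducible (map (Int.castRingHom (ZMod p)) f)) (L : ℝ)
    (hL : ∀ s : ℕ, ∑ p ∈ (Nat.primesLE s).filter (fun p => 400 * d ^ 4 ≤ p ∧ ¬ good p), Real.log p / p ≤ L) :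
    Real.log (d * M / 2) + Real.log |((coeff (Finsupp.single 0 d) f : ℤ) : ℝ)| / d ^ 2 ≤
      4 * Real.log d + L + 2 / d * Real.log B + 700 := by
  obtain ⟨k, rfl⟩ : ∃ k, M = d + k := ⟨M - d, by omega⟩
  obtain ⟨D, hD, hle, hdvd⟩ := main_det hd hf hprim hirr hc rfl v hv hvp hvv B hB hcard
  set c := (coeff (Finsupp.single 0 d) f).natAbs with hcdef
  set s := hil d (d + k) with hsdef
  have hc1 : 1 ≤ c := Nat.one_le_iff_ne_zero.2 (Int.natAbs_ne_zero.2 hc)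
  have hs2 := two_hil (d := d) (e := d + k) (by omega)
  rw [← hsdef] at hs2
  have hs2' : (s : ℝ) * 2 = 2 * d * ((d + k : ℕ) : ℝ) + 3 * d - d ^ 2 := by
    rw [mul_comm]; exact_mod_cast hs2
  have hd' : (1 : ℝ) ≤ d := by exact_mod_cast hd
  have hM' : 2 * (d : ℝ) ≤ ((d + k : ℕ) : ℝ) := by exact_mod_cast hM
  have hslow : (d : ℝ) * ((d + k : ℕ) : ℝ) / 2 ≤ s := by nlinarith
  have hspos : (0 : ℝ) < s := by nlinarith
  have hs1 : 1 ≤ s := by exact_mod_cast hspos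
  have hle2 := hil_le (d := d) (e := d + k) (by omega)
  rw [← hsdef] at hle2
  -- logs
  have hlog : Real.log D + ((k + 2).choose 2 : ℝ) * Real.log c ≤ s * Real.log s + s * ((d + k : ℕ) : ℝ) * Real.log B := by
    have h1 : (D : ℝ) * (c : ℝ) ^ (k + 2).choose 2 ≤ (s.factorial : ℝ) * ((B : ℝ) ^ (d + k)) ^ s := by exact_mod_cast hle
    have hD' : (0 : ℝ) < D := by exact_mod_cast Nat.pos_of_ne_zero hD
    have hc' : (0 : ℝ) < c := by exact_mod_cast hc1
    have hB' : (0 : ℝ) < B := by exact_mod_cast hB1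
    have hf' : (0 : ℝ) < s.factorial := by exact_mod_cast Nat.factorial_pos s
    have h2 := Real.log_le_log (by positivity) h1
    rw [Real.log_mul (by positivity) (by positivity), Real.log_mul (by positivity) (by positivity), Real.log_pow,
      Real.log_pow, Real.log_pow] at h2
    have h3 := log_fact_le s
    nlinarith
  have hgs := good_sum hd hs1 good L (hL s)
  have hDs := prod_dvd_bound ((Nat.primesLE s).filter (fun p => 400 * d ^ 4 ≤ p ∧ good p))
    (fun p hp => (Nat.mem_primesLE.1 (Finset.mem_filter.1 hp).1).2) (ee d s) hD (by
      intro p hp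
      rw [Finset.mem_filter, Nat.mem_primesLE] at hp
      obtain ⟨⟨_, hpp⟩, hp4, hpg⟩ := hp
      have := Fact.mk hpp
      refine hdvd p hp4 (hgood p hp4 hpg) (s / nn d p) _ ?_ (ee_aux (nn d p) s).le
      have h1 : 400 * d ^ 4 ≤ nn d p := by unfold nn; omega
      have h2 : d ≤ d ^ 4 := Nat.le_self_pow (by norm_num) d
      have h3 : s / nn d p ≤ s / (400 * d) := Nat.div_le_div_left (by omega) (by omega)
      have h4 : s / (400 * d) ≤ k := by
        refine Nat.div_le_of_le_mul ?_
        nlinarith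
      omega)
  have hlD : 0 ≤ Real.log D := Real.log_natCast_nonneg D
  have hq : 2 * ((k + 2).choose 2 : ℝ) = (((d + k : ℕ) : ℝ) - d + 2) * (((d + k : ℕ) : ℝ) - d + 1) := by
    have := two_choose k
    push_cast
    rw [mul_comm, show (d : ℝ) + k - d = k by ring]
    exact_mod_cast this
  have hfin := core_real hd' hM' hs2' hq (Real.log_natCast_nonneg c) (Real.log_natCast_nonneg B) hBM (L := L)
    (by linarith) (by linarith)
  have habs : |((coeff (Finsupp.single 0 d) f : ℤ) : ℝ)| = c := by
    rw [hcdef, ← Int.cast_abs, Int.abs_eq_natAbs]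
    simp
  rw [habs]
  have := Real.log_le_log (by positivity) hslow
  linarith

end PW

namespace PW

open Polynomial in
lemma coeff_prod_bd (t : Finset ℕ) (d a : ℕ) (ht : ∀ b ∈ t, b ≤ d) (hta : a ∉ t) (i : ℕ) :
    |(∏ b ∈ t, Lagrange.basisDivisor (a : ℝ) (b : ℝ)).coeff i| ≤ ((d : ℝ) + 1) ^ t.card := by
  classical
  induction t using Finset.induction_on generalizing i with
  | empty =>
    simp only [Finset.prod_empty, Finset.card_empty, pow_zero, Polynomial.coeff_one]
    split_ifs <;> simp
  | insert b t hb ih =>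
    have ih' := ih (fun b hb => ht b (Finset.mem_insert_of_mem hb)) (fun h => hta (Finset.mem_insert_of_mem h))
    have hbd : (b : ℝ) ≤ d := by exact_mod_cast ht b (Finset.mem_insert_self _ _)
    have hab : a ≠ b := fun h => hta (h ▸ Finset.mem_insert_self _ _)
    rw [Finset.prod_insert hb, Finset.card_insert_of_notMem hb]
    set Q := ∏ b ∈ t, Lagrange.basisDivisor (a : ℝ) (b : ℝ)
    have hinv : |((a : ℝ) - b)⁻¹| ≤ 1 := by
      rw [abs_inv]
      refine inv_le_one_of_one_le₀ ?_
      have : (1 : ℤ) ≤ |(a : ℤ) - b| := Int.one_le_abs (by omega)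
      exact_mod_cast this
    have hX : |((X - C (b : ℝ)) * Q).coeff i| ≤ ((d : ℝ) + 1) ^ t.card * (d + 1) := by
      rw [sub_mul, coeff_sub, coeff_C_mul]
      have h1 : |(X * Q).coeff i| ≤ ((d : ℝ) + 1) ^ t.card := by
        cases i with
        | zero => simp; positivity
        | succ i => rw [coeff_X_mul]; exact ih' i
      have h2 : |(b : ℝ) * Q.coeff i| ≤ d * ((d : ℝ) + 1) ^ t.card := by
        rw [abs_mul, abs_of_nonneg (by positivity : (0 : ℝ) ≤ b)]
        exact mul_le_mul hbd (ih' i) (abs_nonneg _) (by positivity)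
      have := abs_sub ((X * Q).coeff i) ((b : ℝ) * Q.coeff i)
      linarith
    unfold Lagrange.basisDivisor
    rw [mul_assoc, coeff_C_mul, abs_mul, pow_succ]
    have := mul_le_mul hinv hX (abs_nonneg _) zero_le_one
    rw [one_mul] at this
    exact this

open Polynomial in
lemma exists_large (P : ℝ[X]) (d : ℕ) (hP : P.degree < ((d + 1 : ℕ) : WithBot ℕ)) (i : ℕ) :
    ∃ a ≤ d, |P.coeff i| ≤ ((d : ℝ) + 1) ^ (d + 1) * |P.eval (a : ℝ)| := by
  classical
  obtain ⟨a, ha, hmax⟩ := Finset.exists_max_image (Finset.range (d + 1)) (fun a : ℕ => |P.eval (a : ℝ)|) ⟨0, by simp⟩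
  refine ⟨a, by simpa [Nat.lt_succ_iff] using ha, ?_⟩
  have hinj : Set.InjOn (fun a : ℕ => (a : ℝ)) (Finset.range (d + 1) : Set ℕ) := fun x _ y _ h => Nat.cast_injective h
  have h := Lagrange.eq_interpolate (s := Finset.range (d + 1)) (v := fun a : ℕ => (a : ℝ)) (f := P) hinj (by simpa using hP)
  rw [Lagrange.interpolate_apply] at h
  have h2 : P.coeff i = ∑ b ∈ Finset.range (d + 1), P.eval (b : ℝ) * (Lagrange.basis (Finset.range (d + 1)) (fun a : ℕ => (a : ℝ)) b).coeff i := by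
    conv_lhs => rw [h]
    rw [finsetSum_coeff]
    simp
  rw [h2]
  refine (Finset.abs_sum_le_sum_abs _ _).trans ?_
  calc _ ≤ ∑ b ∈ Finset.range (d + 1), |P.eval (a : ℝ)| * ((d : ℝ) + 1) ^ d := by
        refine Finset.sum_le_sum fun b hb => ?_
        rw [abs_mul]
        refine mul_le_mul (hmax b hb) ?_ (abs_nonneg _) (abs_nonneg _)
        have := coeff_prod_bd ((Finset.range (d + 1)).erase b) d b
          (fun c hc => by have := Finset.mem_range.1 (Finset.mem_of_mem_erase hc); omega) (Finset.notMem_erase _ _) i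
        rw [Finset.card_erase_of_mem hb, Finset.card_range] at this
        exact this
    _ = _ := by
      rw [Finset.sum_const, Finset.card_range, nsmul_eq_mul, pow_succ]
      push_cast
      ring

open MvPolynomial

lemma log_pow_bd (d : ℕ) (hd : 1 ≤ d) : ((d : ℝ) + 1) ^ (d + 1) ≤ Real.exp (2 * d ^ 2) := by
  have hd' : (1 : ℝ) ≤ d := by exact_mod_cast hd
  calc ((d : ℝ) + 1) ^ (d + 1) ≤ (Real.exp d) ^ (d + 1) := by
        gcongr
        exact Real.add_one_le_exp _
    _ = Real.exp ((d + 1 : ℕ) * d) := by rw [← Real.exp_nat_mul]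
    _ ≤ _ := by
      apply Real.exp_le_exp.2
      push_cast
      nlinarith

/-- a translate with a large leading coefficient -/
lemma exists_large_value {f : MvPolynomial (Fin 3) ℤ} {d : ℕ} (hd : 1 ≤ d) (hf : f.IsHomogeneous d) (m₀ : Fin 3 →₀ ℕ) :
    ∃ a b : ℕ, a ≤ d ∧ b ≤ d ∧ |((coeff m₀ f : ℤ) : ℝ)| ≤
      Real.exp (4 * d ^ 2) * |((eval ![1, (a : ℤ), (b : ℤ)] f : ℤ) : ℝ)| := by
  classical
  by_cases hm0 : coeff m₀ f = 0
  · exact ⟨0, 0, by simp, by simp, by rw [hm0]; simp; positivity⟩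
  have hle : ∀ m ∈ f.support, ∀ i, m i ≤ d := fun m hm i => by
    rw [← hom_degree hf (mem_support_iff.1 hm)]
    exact Finsupp.le_degree i m
  set P1 : Polynomial ℝ := ∑ m ∈ f.support.filter (fun m : Fin 3 →₀ ℕ => m 2 = m₀ 2), Polynomial.monomial (m 1) ((coeff m f : ℤ) : ℝ) with hP1
  have hdeg : ∀ (S : Finset (Fin 3 →₀ ℕ)) (i : Fin 3) (c : (Fin 3 →₀ ℕ) → ℝ), S ⊆ f.support →
      (∑ m ∈ S, Polynomial.monomial (m i) (c m)).degree < ((d + 1 : ℕ) : WithBot ℕ) := by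
    intro S i c hS
    refine lt_of_le_of_lt (Polynomial.degree_sum_le _ _) ?_
    rw [Finset.sup_lt_iff (WithBot.bot_lt_coe _)]
    intro m hm
    refine lt_of_le_of_lt (Polynomial.degree_monomial_le _ _) ?_
    exact_mod_cast Nat.lt_succ_of_le (hle m (hS hm) i)
  obtain ⟨a, ha, hPa⟩ := exists_large P1 d (hdeg _ _ _ (Finset.filter_subset _ _)) (m₀ 1)
  set P2 : Polynomial ℝ := ∑ m ∈ f.support, Polynomial.monomial (m 2) (((coeff m f : ℤ) : ℝ) * (a : ℝ) ^ m 1) with hP2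
  obtain ⟨b, hb, hPb⟩ := exists_large P2 d (hdeg _ _ _ (Finset.Subset.refl _)) (m₀ 2)
  refine ⟨a, b, ha, hb, ?_⟩
  have e1 : P1.coeff (m₀ 1) = ((coeff m₀ f : ℤ) : ℝ) := by
    rw [hP1, Polynomial.finsetSum_coeff, Finset.sum_eq_single m₀]
    · rw [Polynomial.coeff_monomial, if_pos rfl]
    · intro m hm hne
      rw [Finset.mem_filter] at hm
      rw [Polynomial.coeff_monomial, if_neg]
      intro h1
      apply hne
      have d1 := hom_degree hf (mem_support_iff.1 hm.1)
      have d2 := hom_degree hf hm0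
      have q1 := fin3_deg 0 m
      have q2 := fin3_deg 0 m₀
      rw [Finsupp.degree_eq_sum, Fin.sum_univ_three] at d1 d2
      ext i
      fin_cases i
      · change m 0 = m₀ 0; omega
      · exact h1
      · exact hm.2
    · intro h
      exact (h (Finset.mem_filter.2 ⟨mem_support_iff.2 hm0, rfl⟩)).elim
  have e2 : P2.coeff (m₀ 2) = P1.eval (a : ℝ) := by
    rw [hP2, hP1, Polynomial.finsetSum_coeff, Polynomial.eval_finsetSum, Finset.sum_filter]
    refine Finset.sum_congr rfl fun m _ => ?_
    rw [Polynomial.coeff_monomial, Polynomial.eval_monomial]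
  have e3 : P2.eval (b : ℝ) = ((eval ![1, (a : ℤ), (b : ℤ)] f : ℤ) : ℝ) := by
    rw [hP2, Polynomial.eval_finsetSum, eval_eq', Int.cast_sum]
    refine Finset.sum_congr rfl fun m _ => ?_
    rw [Polynomial.eval_monomial, Fin.prod_univ_three]
    simp [mul_assoc]
  rw [e1] at hPa
  rw [e2, e3] at hPb
  have hK := log_pow_bd d hd
  calc _ ≤ _ := hPa
    _ ≤ ((d : ℝ) + 1) ^ (d + 1) * (((d : ℝ) + 1) ^ (d + 1) * |((eval ![1, (a : ℤ), (b : ℤ)] f : ℤ) : ℝ)|) := by gcongr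
    _ ≤ Real.exp (2 * d ^ 2) * (Real.exp (2 * d ^ 2) * |((eval ![1, (a : ℤ), (b : ℤ)] f : ℤ) : ℝ)|) := by gcongr
    _ = _ := by rw [← mul_assoc, ← Real.exp_add]; congr 2; ring

end PW

namespace PW
open MvPolynomial

/-- the shift as an automorphism -/
noncomputable def shE {R : Type*} [CommRing R] (i : Fin 3) (r : Fin 3 → R) :
    MvPolynomial (Fin 3) R ≃ₐ[R] MvPolynomial (Fin 3) R :=
  AlgEquiv.ofAlgHom (sh i r) (sh i (-r))
    (by
      refine AlgHom.ext fun F => ?_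
      have := sh_sh i (-r) F
      rw [neg_neg] at this
      simpa using this)
    (by
      refine AlgHom.ext fun F => ?_
      simpa using sh_sh i r F)

lemma sh_irr {R : Type*} [CommRing R] (i : Fin 3) (r : Fin 3 → R) {F : MvPolynomial (Fin 3) R}
    (h : Irreducible F) : Irreducible (sh i r F) :=
  (MulEquiv.irreducible_iff (shE i r)).2 h

lemma sh_prim (i : Fin 3) (r : Fin 3 → ℤ) {f : MvPolynomial (Fin 3) ℤ} (hf : Prim f) : Prim (sh i r f) := by
  intro p hp h
  apply hf p hp
  have := map_dvd (sh i (-r)) h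
  rw [sh_sh] at this
  have hC : sh i (-r) (C (p : ℤ)) = C (p : ℤ) := by
    have := (sh i (-r)).commutes (p : ℤ)
    simpa [algebraMap_eq] using this
  rwa [hC] at this

lemma eval_e0 {f : MvPolynomial (Fin 3) ℤ} {d : ℕ} (hf : f.IsHomogeneous d) :
    eval (fun j : Fin 3 => if j = 0 then (1 : ℤ) else 0) f = coeff (Finsupp.single 0 d) f := by
  classical
  rw [eval_eq', Finset.sum_eq_single (Finsupp.single 0 d)]
  · simp [Fin.prod_univ_three]
  · intro m hm hne
    have hd := hom_degree hf (mem_support_iff.1 hm)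
    rw [fin3_deg 0] at hd
    have : m 1 ≠ 0 ∨ m 2 ≠ 0 := by
      by_contra hcon
      push Not at hcon
      apply hne
      have q1 : m (0 + 1) = 0 := hcon.1
      have q2 : m (0 + 2) = 0 := hcon.2
      refine fin3_ext 0 ?_ ?_ ?_
      · simp; omega
      · rw [q1]; simp
      · rw [q2]; simp
    rw [Fin.prod_univ_three]
    rcases this with h | h <;> simp [h]
  · intro h
    rw [notMem_support_iff.1 h, zero_mul]

open Classical in
theorem core2 {ι : Type*} [Fintype ι] {f : MvPolynomial (Fin 3) ℤ} {d M : ℕ} (hd : 1 ≤ d) (hf : f.IsHomogeneous d)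
    (hprim : Prim f) (hirr : Irreducible (map (Int.castRingHom ℚ) f)) (m₀ : Fin 3 →₀ ℕ)
    (hc : coeff m₀ f ≠ 0) (hM : 2 * d ≤ M)
    (v : ι → Fin 3 → ℤ) (hv : ∀ j, eval (v j) f = 0) (hvp : ∀ j (p : ℕ), p.Prime → ∃ i, ¬ (p : ℤ) ∣ v j i)
    (hvv : ∀ i j, i ≠ j → ∀ c : ℚ, (fun a => (v i a : ℚ)) ≠ c • fun a => (v j a : ℚ))
    (B : ℕ) (hB1 : 1 ≤ B) (hB : ∀ j i, |v j i| ≤ B) (hBM : Real.log B ≤ M) (hcard : d * M < Fintype.card ι)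
    (good : ℕ → Prop) (hgood : ∀ (p : ℕ) [Fact p.Prime], 400 * d ^ 4 ≤ p → good p →
      Irreducible (map (Int.castRingHom (ZMod p)) f)) (L : ℝ)
    (hL : ∀ s : ℕ, ∑ p ∈ (Nat.primesLE s).filter (fun p => 400 * d ^ 4 ≤ p ∧ ¬ good p), Real.log p / p ≤ L) :
    Real.log (d * M / 2) + Real.log |((coeff m₀ f : ℤ) : ℝ)| / d ^ 2 ≤
      4 * Real.log d + L + 2 / d * Real.log B + 706 := by
  obtain ⟨a, b, ha, hb, hab⟩ := exists_large_value hd hf m₀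
  have hd' : (1 : ℝ) ≤ d := by exact_mod_cast hd
  set r : Fin 3 → ℤ := ![0, (a : ℤ), (b : ℤ)] with hr
  have hr' : ∀ i, 0 ≤ r i ∧ r i ≤ d := by
    intro i
    fin_cases i
    · simp [hr]
    · simpa [hr] using ha
    · simpa [hr] using hb
  set f' := sh 0 r f with hf'
  have hcoef : coeff (Finsupp.single 0 d) f' = eval ![1, (a : ℤ), (b : ℤ)] f := by
    rw [← eval_e0 (sh_hom 0 r hf), eval_sh]
    congr 2
    funext j
    fin_cases j <;> simp [hr]
  have hcpos : (0 : ℝ) < |((coeff m₀ f : ℤ) : ℝ)| := by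
    rw [abs_pos]; exact_mod_cast hc
  have hc' : coeff (Finsupp.single 0 d) f' ≠ 0 := by
    rw [hcoef]
    intro h
    rw [h] at hab
    simp at hab
    exact hc hab
  set v' : ι → Fin 3 → ℤ := fun j i => if i = 0 then v j 0 else v j i - r i * v j 0 with hv'
  have hback : ∀ j, (fun i => if i = 0 then v' j 0 else v' j i + r i * v' j 0) = v j := by
    intro j
    funext i
    by_cases hi : i = 0
    · simp [hi, hv']
    · simp [hi, hv']
  have hback' : ∀ j i, v j i = v' j i + r i * v' j 0 := by
    intro j i
    by_cases hi : i = 0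
    · simp [hi, hv', hr]
    · simp [hi, hv']
  have hlogd : Real.log ((d + 1 : ℕ) : ℝ) ≤ d := by
    push_cast
    have := Real.log_le_sub_one_of_pos (show (0 : ℝ) < d + 1 by positivity)
    linarith
  have hlogB : Real.log (((d + 1) * B : ℕ) : ℝ) = Real.log ((d + 1 : ℕ) : ℝ) + Real.log B := by
    have : (B : ℝ) ≠ 0 := by exact_mod_cast (by omega : B ≠ 0)
    rw [Nat.cast_mul, Real.log_mul (by positivity) this]
  have hM' : (2 * d : ℝ) ≤ M := by exact_mod_cast hM
  have key := core (f := f') (M := M) hd (sh_hom 0 r hf) (sh_prim 0 r hprim)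
    (by rw [hf', map_sh]; exact sh_irr _ _ hirr) hc' hM v'
    (fun j => by rw [hf', eval_sh, hback]; exact hv j)
    (fun j p hp => by
      by_contra hcon
      push Not at hcon
      obtain ⟨i, hi⟩ := hvp j p hp
      exact hi (by rw [hback' j i]; exact dvd_add (hcon i) (Dvd.dvd.mul_left (hcon 0) _)))
    (fun i j hij c h => by
      apply hvv i j hij c
      funext x
      have h1 := congrFun h x
      have h2 := congrFun h 0
      simp only [Pi.smul_apply, smul_eq_mul] at h1 h2 ⊢
      rw [hback' i x, hback' j x]
      push_cast
      rw [h1, h2]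
      ring)
    ((d + 1) * B) (by nlinarith)
    (fun j i => by
      have h1 := hB j i
      have h0 := hB j 0
      have ⟨h2, h3⟩ := hr' i
      rw [abs_le] at h0 h1
      have hB0 : (0 : ℤ) ≤ B := by positivity
      push_cast
      by_cases hi : i = 0
      · simp only [hv', hi, if_true]
        rw [abs_le]
        constructor <;> nlinarith
      · simp only [hv', hi, if_false]
        have h4 : |r i * v j 0| ≤ d * B := by
          rw [abs_mul]
          exact mul_le_mul (by rw [abs_of_nonneg h2]; exact h3) (abs_le.2 h0) (abs_nonneg _) (by positivity)
        rw [abs_le] at h4 ⊢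
        constructor <;> linarith)
    (by rw [hlogB]; linarith) hcard good
    (fun p _ h4 hg => by rw [hf', map_sh]; exact sh_irr _ _ (hgood p h4 hg)) L hL
  rw [hcoef, hlogB] at key
  rw [hcoef] at hc'
  have h1 := Real.log_le_log hcpos hab
  have hc'' : (0 : ℝ) < |((eval ![1, (a : ℤ), (b : ℤ)] f : ℤ) : ℝ)| := by
    rw [abs_pos]; exact_mod_cast hc'
  rw [Real.log_mul (by positivity) hc''.ne', Real.log_exp] at h1
  have h2 : Real.log |((coeff m₀ f : ℤ) : ℝ)| / d ^ 2 ≤ 4 + Real.log |((eval ![1, (a : ℤ), (b : ℤ)] f : ℤ) : ℝ)| / d ^ 2 := by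
    rw [div_le_iff₀ (by positivity), add_mul, div_mul_cancel₀ _ (by positivity)]
    exact h1
  have h3 : 2 / (d : ℝ) * Real.log ((d + 1 : ℕ) : ℝ) ≤ 2 := by
    rw [div_mul_eq_mul_div, div_le_iff₀ (by positivity)]
    linarith
  rw [mul_add] at key
  linarith

end PW

namespace PW
open MvPolynomial

lemma top_factor {K : Type*} [Field K] {f g h : MvPolynomial (Fin 3) K} {d : ℕ} (hf : f.IsHomogeneous d)
    (hf0 : f ≠ 0) (hgh : f = g * h) :
    g.totalDegree + h.totalDegree = d ∧
    f = homogeneousComponent g.totalDegree g * homogeneousComponent h.totalDegree h := by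
  classical
  have hg0 : g ≠ 0 := by rintro rfl; simp [hgh] at hf0
  have hh0 : h ≠ 0 := by rintro rfl; simp [hgh] at hf0
  have hdeg : g.totalDegree + h.totalDegree = d := by
    rw [← hf.totalDegree hf0, hgh, totalDegree_mul_of_isDomain hg0 hh0]
  refine ⟨hdeg, ?_⟩
  have hhom : (homogeneousComponent g.totalDegree g * homogeneousComponent h.totalDegree h).IsHomogeneous d := by
    rw [← hdeg]
    exact (homogeneousComponent_isHomogeneous _ _).mul (homogeneousComponent_isHomogeneous _ _)
  ext m
  by_cases hm : m.degree = d
  · rw [hgh, coeff_mul, coeff_mul]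
    refine Finset.sum_congr rfl fun x hx => ?_
    rw [Finset.HasAntidiagonal.mem_antidiagonal] at hx
    have hx' : x.1.degree + x.2.degree = d := by rw [← map_add, hx, hm]
    rw [coeff_homogeneousComponent, coeff_homogeneousComponent]
    by_cases h1 : coeff x.1 g = 0
    · simp [h1]
    by_cases h2 : coeff x.2 h = 0
    · simp [h2]
    have l1 := le_totalDegree (mem_support_iff.2 h1)
    have l2 := le_totalDegree (mem_support_iff.2 h2)
    change x.1.degree ≤ _ at l1
    change x.2.degree ≤ _ at l2
    rw [if_pos (by omega), if_pos (by omega)]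
  · rw [hf.coeff_eq_zero hm, hhom.coeff_eq_zero hm]

lemma pos_deg {K : Type*} [Field K] {g : MvPolynomial (Fin 3) K} (hg0 : g ≠ 0) (hg : ¬ IsUnit g) : 1 ≤ g.totalDegree := by
  by_contra hcon
  have h0 : g.totalDegree = 0 := by omega
  rw [totalDegree_eq_zero_iff_eq_C] at h0
  apply hg
  rw [h0]
  refine (IsUnit.mk0 _ ?_).map C
  intro h
  rw [h, map_zero] at h0
  exact hg0 h0

lemma part_bound {K : Type*} [Field K] [Algebra ℚ K] {κ : Type*} [Fintype κ] {f : MvPolynomial (Fin 3) ℚ} {d a : ℕ}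
    (hf : f.IsHomogeneous d) (hirr : Irreducible f) {g : MvPolynomial (Fin 3) K} (hg : g.IsHomogeneous a) (hg0 : g ≠ 0)
    (had : a < d) (w : κ → Fin 3 → ℚ) (hw : ∀ i, w i ≠ 0) (hww : ∀ i j, i ≠ j → ∀ c : ℚ, w i ≠ c • w j)
    (hfw : ∀ i, eval (w i) f = 0) (hgw : ∀ i, eval (fun x => algebraMap ℚ K (w i x)) g = 0) :
    Fintype.card κ ≤ d * a := by
  classical
  obtain ⟨m, hm⟩ := ne_zero_iff.1 hg0
  obtain ⟨l, hl⟩ : ∃ l : Module.Dual ℚ K, l (coeff m g) ≠ 0 := by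
    by_contra hcon
    push Not at hcon
    exact hm ((Module.forall_dual_apply_eq_zero_iff ℚ _).1 hcon)
  set G : MvPolynomial (Fin 3) ℚ := ∑ x ∈ monS a, monomial x (l (coeff x g)) with hG
  have hGh : G.IsHomogeneous a := IsHomogeneous.sum _ _ _ fun x hx => isHomogeneous_monomial _ (mem_monS.1 hx)
  have hGc : coeff m G = l (coeff m g) := by
    rw [hG, coeff_sum, Finset.sum_eq_single m]
    · simp
    · intro b _ hb
      rw [coeff_monomial, if_neg hb]
    · intro h
      exact (h (mem_monS.2 (hom_degree hg hm))).elim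
  have hG0 : G ≠ 0 := fun h => hl (by rw [← hGc, h, coeff_zero])
  refine bezout hf hirr hGh ?_ w hw hww hfw ?_
  · rintro ⟨q, hq⟩
    have hq0 : q ≠ 0 := by rintro rfl; simp [hq] at hG0
    have h1 := hGh.totalDegree hG0
    rw [hq, totalDegree_mul_of_isDomain hirr.ne_zero hq0, hf.totalDegree hirr.ne_zero] at h1
    omega
  · intro i
    have h1 := hgw i
    rw [hom_sum hg] at h1
    have h2 := congrArg l h1
    rw [map_sum, map_sum, map_zero] at h2
    rw [hG, map_sum, ← h2]
    refine Finset.sum_congr rfl fun x _ => ?_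
    rw [eval_monomial, eval_monomial]
    have : (x.prod fun n e => (algebraMap ℚ K (w i n)) ^ e) = algebraMap ℚ K (x.prod fun n e => w i n ^ e) := by
      simp [Finsupp.prod]
    rw [this, mul_comm (coeff x g), ← Algebra.smul_def, map_smul, smul_eq_mul, mul_comm]

theorem not_abs_irr {ι : Type*} [Fintype ι] {f : MvPolynomial (Fin 3) ℤ} {d : ℕ} (hd : 1 ≤ d) (hf : f.IsHomogeneous d)
    (hirr : Irreducible (map (Int.castRingHom ℚ) f)) {K : Type*} [Field K] [Algebra ℚ K]
    (hn : ¬ Irreducible (map (Int.castRingHom K) f))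
    (w : ι → Fin 3 → ℚ) (hw : ∀ i, w i ≠ 0) (hww : ∀ i j, i ≠ j → ∀ c : ℚ, w i ≠ c • w j)
    (hfw : ∀ i, eval (w i) (map (Int.castRingHom ℚ) f) = 0) : Fintype.card ι ≤ d * d := by
  classical
  set F := map (Int.castRingHom K) f with hF
  have hFmap : F = map (algebraMap ℚ K) (map (Int.castRingHom ℚ) f) := by
    rw [hF, map_map]
    congr 2
    exact (RingHom.ext_int _ _)
  have hFh : F.IsHomogeneous d := hf.map _
  have hF0 : F ≠ 0 := by
    rw [hFmap]
    intro h
    apply hirr.ne_zero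
    exact map_injective _ (algebraMap ℚ K).injective (by rw [h, map_zero])
  have hnu : ¬ IsUnit F := by
    intro hu
    obtain ⟨q, hq⟩ := hu.exists_right_inv
    have hq0 : q ≠ 0 := by rintro rfl; simp at hq
    have := totalDegree_mul_of_isDomain hF0 hq0
    rw [hq, totalDegree_one, hFh.totalDegree hF0] at this
    omega
  rw [irreducible_iff] at hn
  push Not at hn
  obtain ⟨g, h, hgh, hg, hh⟩ := hn hnu
  obtain ⟨hdeg, htop⟩ := top_factor hFh hF0 hgh
  have hg0 : g ≠ 0 := by rintro rfl; simp [hgh] at hF0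
  have hh0 : h ≠ 0 := by rintro rfl; simp [hgh] at hF0
  have ha := pos_deg hg0 hg
  have hb := pos_deg hh0 hh
  set a := g.totalDegree
  set b := h.totalDegree
  set g' := homogeneousComponent a g
  set h' := homogeneousComponent b h
  have hg'0 : g' ≠ 0 := by intro q; simp [htop, q] at hF0
  have hh'0 : h' ≠ 0 := by intro q; simp [htop, q] at hF0
  have hpt : ∀ i, eval (fun x => algebraMap ℚ K (w i x)) g' = 0 ∨ eval (fun x => algebraMap ℚ K (w i x)) h' = 0 := by
    intro i
    rw [← mul_eq_zero, ← map_mul, ← htop, hFmap, eval_map]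
    have : algebraMap ℚ K (eval (w i) (map (Int.castRingHom ℚ) f)) = 0 := by rw [hfw i, map_zero]
    rw [← this, ← eval₂_id, eval₂_comp_left]
    rfl
  have c1 := part_bound (κ := {i // eval (fun x => algebraMap ℚ K (w i x)) g' = 0}) (hf.map (Int.castRingHom ℚ)) hirr
    (homogeneousComponent_isHomogeneous a g) hg'0 (by omega) (fun i => w i.1) (fun i => hw _)
    (fun i j hij => hww _ _ fun h => hij (Subtype.ext h)) (fun i => hfw _) (fun i => i.2)
  have c2 := part_bound (κ := {i // eval (fun x => algebraMap ℚ K (w i x)) h' = 0}) (hf.map (Int.castRingHom ℚ)) hirr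
    (homogeneousComponent_isHomogeneous b h) hh'0 (by omega) (fun i => w i.1) (fun i => hw _)
    (fun i j hij => hww _ _ fun h => hij (Subtype.ext h)) (fun i => hfw _) (fun i => i.2)
  rw [Fintype.card_subtype] at c1 c2
  have : Fintype.card ι ≤ d * a + d * b := by
    refine le_trans ?_ (add_le_add c1 c2)
    refine le_trans ?_ (Finset.card_union_le _ _)
    rw [← Finset.card_univ]
    refine Finset.card_le_card fun i _ => ?_
    simpa using hpt i
  calc _ ≤ _ := this
    _ = d * (a + b) := by ring
    _ = _ := by rw [hdeg]

end PW

namespace PW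
open MvPolynomial

/-- monomials of degree less than `d` -/
noncomputable def mlt (d : ℕ) : Finset (Fin 3 →₀ ℕ) := by
  classical exact (Finset.range d).biUnion monS

lemma mem_mlt {d : ℕ} {m : Fin 3 →₀ ℕ} : m ∈ mlt d ↔ m.degree < d := by
  classical
  simp only [mlt, Finset.mem_biUnion, Finset.mem_range, mem_monS]
  exact ⟨fun ⟨a, h1, h2⟩ => h2 ▸ h1, fun h => ⟨_, h, rfl⟩⟩

/-- the generic polynomial of degree less than `d` -/
noncomputable def genP {R : Type*} [CommRing R] (d : ℕ) (x : mlt d → R) : MvPolynomial (Fin 3) R :=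
  ∑ m : mlt d, monomial (m : Fin 3 →₀ ℕ) (x m)

lemma map_genP {R S : Type*} [CommRing R] [CommRing S] (φ : R →+* S) (d : ℕ) (x : mlt d → R) :
    map φ (genP d x) = genP d (fun m => φ (x m)) := by
  simp [genP, map_monomial]

lemma genP_coeff {R : Type*} [CommRing R] (d : ℕ) (x : mlt d → R) (m : Fin 3 →₀ ℕ) (hm : coeff m (genP d x) ≠ 0) :
    m.degree < d := by
  classical
  by_contra hcon
  apply hm
  rw [genP, coeff_sum]
  refine Finset.sum_eq_zero fun y _ => ?_
  rw [coeff_monomial, if_neg]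
  rintro rfl
  exact hcon (mem_mlt.1 y.2)

lemma genP_eq {R : Type*} [CommRing R] (d : ℕ) (g : MvPolynomial (Fin 3) R) (hg : ∀ m, coeff m g ≠ 0 → m.degree < d) :
    genP d (fun m => coeff (m : Fin 3 →₀ ℕ) g) = g := by
  classical
  ext m
  rw [genP, coeff_sum]
  by_cases hm : m.degree < d
  · rw [Finset.sum_eq_single (⟨m, mem_mlt.2 hm⟩ : mlt d)]
    · simp
    · intro b _ hb
      rw [coeff_monomial, if_neg]
      intro h
      exact hb (Subtype.ext h)
    · simp
  · have h0 : coeff m g = 0 := by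
      by_contra h
      exact hm (hg m h)
    rw [h0]
    refine Finset.sum_eq_zero fun b _ => ?_
    rw [coeff_monomial, if_neg]
    intro h
    exact hm (h ▸ mem_mlt.1 b.2)

/-- the ideal expressing that `f` is a product of two polynomials of degree less than `d` -/
noncomputable def redI (d : ℕ) (f : MvPolynomial (Fin 3) ℤ) : Ideal (MvPolynomial (mlt d ⊕ mlt d) ℤ) :=
  Ideal.span (Set.range fun m : Fin 3 →₀ ℕ => coeff m
    (genP d (fun m => (X (Sum.inl m) : MvPolynomial (mlt d ⊕ mlt d) ℤ)) * genP d (fun m => X (Sum.inr m)) - map C f))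

lemma map_redI {K : Type*} [CommRing K] (d : ℕ) (f : MvPolynomial (Fin 3) ℤ) (φ : MvPolynomial (mlt d ⊕ mlt d) ℤ →+* K) :
    (∀ q ∈ redI d f, φ q = 0) ↔ genP d (fun m => φ (X (Sum.inl m))) * genP d (fun m => φ (X (Sum.inr m))) =
      map (Int.castRingHom K) f := by
  have h0 : (∀ q ∈ redI d f, φ q = 0) ↔ redI d f ≤ RingHom.ker φ := by
    simp only [SetLike.le_def, RingHom.mem_ker]
  rw [h0, redI, Ideal.span_le]
  have h1 : map (Int.castRingHom K) f = map φ (map C f) := by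
    rw [map_map]
    congr 2
    exact (RingHom.ext_int _ _)
  rw [h1, ← map_genP, ← map_genP, ← map_mul, ← sub_eq_zero, ← map_sub]
  constructor
  · intro h
    ext m
    rw [coeff_map, coeff_zero]
    exact h ⟨m, rfl⟩
  · rintro h _ ⟨m, rfl⟩
    have := congrArg (coeff m) h
    rw [coeff_map, coeff_zero] at this
    exact this

lemma irr_no_split {K : Type*} [Field K] {F : MvPolynomial (Fin 3) K} {d : ℕ} (hd : 1 ≤ d) (hF : F.IsHomogeneous d) :
    Irreducible F ↔ ¬ ∃ x y : mlt d → K, genP d x * genP d y = F := by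
  have hlt : ∀ x : mlt d → K, (genP d x).totalDegree < d := by
    intro x
    refine (Finset.sup_lt_iff (by rw [Nat.bot_eq_zero]; omega)).2 fun m hm => ?_
    exact genP_coeff d x m (mem_support_iff.1 hm)
  constructor
  · rintro hirr ⟨x, y, hxy⟩
    have hx0 : genP d x ≠ 0 := by intro h; exact hirr.ne_zero (by rw [← hxy, h, zero_mul])
    have hy0 : genP d y ≠ 0 := by intro h; exact hirr.ne_zero (by rw [← hxy, h, mul_zero])
    have h1 := totalDegree_mul_of_isDomain hx0 hy0
    rw [hxy, hF.totalDegree hirr.ne_zero] at h1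
    have hunit : ∀ g : MvPolynomial (Fin 3) K, IsUnit g → g ≠ 0 → g.totalDegree = 0 := by
      intro g hu hg0
      obtain ⟨q, hq⟩ := hu.exists_right_inv
      have hq0 : q ≠ 0 := by rintro rfl; simp at hq
      have := totalDegree_mul_of_isDomain hg0 hq0
      rw [hq, totalDegree_one] at this
      omega
    have := hlt x
    have := hlt y
    rcases hirr.isUnit_or_isUnit hxy.symm with h | h
    · have := hunit _ h hx0; omega
    · have := hunit _ h hy0; omega
  · intro hno
    have hF0 : F ≠ 0 := by
      rintro rfl
      exact hno ⟨0, 0, by simp [genP]⟩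
    rw [irreducible_iff]
    constructor
    · intro hu
      obtain ⟨q, hq⟩ := hu.exists_right_inv
      have hq0 : q ≠ 0 := by rintro rfl; simp at hq
      have := totalDegree_mul_of_isDomain hF0 hq0
      rw [hq, totalDegree_one, hF.totalDegree hF0] at this
      omega
    · intro g h hgh
      by_contra hcon
      push Not at hcon
      have hg0 : g ≠ 0 := by rintro rfl; simp [hgh] at hF0
      have hh0 : h ≠ 0 := by rintro rfl; simp [hgh] at hF0
      have ha := pos_deg hg0 hcon.1
      have hb := pos_deg hh0 hcon.2
      have h1 := totalDegree_mul_of_isDomain hg0 hh0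
      rw [← hgh, hF.totalDegree hF0] at h1
      apply hno
      refine ⟨fun m => coeff (m : Fin 3 →₀ ℕ) g, fun m => coeff (m : Fin 3 →₀ ℕ) h, ?_⟩
      rw [genP_eq, genP_eq, hgh]
      · intro m hm
        have := le_totalDegree (mem_support_iff.2 hm)
        change m.degree ≤ _ at this
        omega
      · intro m hm
        have := le_totalDegree (mem_support_iff.2 hm)
        change m.degree ≤ _ at this
        omega

theorem bad_finite {f : MvPolynomial (Fin 3) ℤ} {d : ℕ} (hd : 1 ≤ d) (hf : f.IsHomogeneous d)
    (hirr : Irreducible (map (Int.castRingHom (AlgebraicClosure ℚ)) f)) :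
    ∃ n : ℤ, n ≠ 0 ∧ ∀ (p : ℕ) (K : Type) [Field K] [CharP K p], ¬ Irreducible (map (Int.castRingHom K) f) → (p : ℤ) ∣ n := by
  have hex : ∃ n : ℤ, n ≠ 0 ∧ C n ∈ redI d f := by
    letI : Algebra (MvPolynomial (mlt d ⊕ mlt d) ℤ) (MvPolynomial (mlt d ⊕ mlt d) ℚ) := MvPolynomial.algebraMvPolynomial
    by_contra hcon
    push Not at hcon
    have hdis : Disjoint (((nonZeroDivisors ℤ).map (C (σ := mlt d ⊕ mlt d)) : Submonoid _) : Set (MvPolynomial (mlt d ⊕ mlt d) ℤ))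
        (redI d f : Set (MvPolynomial (mlt d ⊕ mlt d) ℤ)) := by
      rw [Set.disjoint_left]
      rintro _ ⟨n, hn, rfl⟩ h
      exact hcon n (nonZeroDivisors.ne_zero hn) h
    rw [← IsLocalization.map_algebraMap_ne_top_iff_disjoint _ (MvPolynomial (mlt d ⊕ mlt d) ℚ)] at hdis
    obtain ⟨J, hJ, hIJ⟩ := Ideal.exists_le_maximal _ hdis
    obtain ⟨x, hx⟩ := eq_vanishingIdeal_singleton_of_isMaximal (AlgebraicClosure ℚ) hJ
    refine (irr_no_split hd (hf.map _)).1 hirr ?_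
    refine ⟨_, _, (map_redI d f (eval₂Hom (Int.castRingHom _) x)).1 ?_⟩
    intro q hq
    have h1 : algebraMap (MvPolynomial (mlt d ⊕ mlt d) ℤ) (MvPolynomial (mlt d ⊕ mlt d) ℚ) q ∈ J :=
      hIJ (Ideal.mem_map_of_mem _ hq)
    rw [hx, mem_vanishingIdeal_singleton_iff, algebraMap_def, aeval_def, eval₂_map] at h1
    rw [coe_eval₂Hom, ← h1]
    congr 1
  obtain ⟨n, hn0, hn⟩ := hex
  refine ⟨n, hn0, ?_⟩
  intro p K _ _ hK
  rw [irr_no_split hd (hf.map _), not_not] at hK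
  obtain ⟨x, y, hxy⟩ := hK
  have h1 := (map_redI d f (eval₂Hom (Int.castRingHom K) (Sum.elim x y))).2 (by simpa using hxy) _ hn
  rw [coe_eval₂Hom, eval₂_C] at h1
  exact (CharP.intCast_eq_zero_iff K p n).1 h1

/-- absolute irreducibility implies irreducibility -/
lemma irr_of_ext {k K : Type*} [Field k] [Field K] (φ : k →+* K) {f : MvPolynomial (Fin 3) ℤ} {d : ℕ} (hd : 1 ≤ d)
    (hf : f.IsHomogeneous d) (h : Irreducible (map (Int.castRingHom K) f)) : Irreducible (map (Int.castRingHom k) f) := by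
  rw [irr_no_split hd (hf.map _)] at h ⊢
  rintro ⟨x, y, hxy⟩
  refine h ⟨fun m => φ (x m), fun m => φ (y m), ?_⟩
  · rw [← map_genP, ← map_genP, ← map_mul, hxy, map_map]
    congr 2
    exact RingHom.ext_int _ _

end PW

namespace PW
open MvPolynomial

lemma prim_of_gcd {f : MvPolynomial (Fin 3) ℤ} (h : Finset.gcd f.support f.coeff = 1) : Prim f := by
  intro p hp hdvd
  rw [C_dvd_iff_dvd_coeff] at hdvd
  have h1 : (p : ℤ) ∣ Finset.gcd f.support f.coeff := Finset.dvd_gcd fun m _ => hdvd m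
  rw [h] at h1
  have := Int.eq_one_of_dvd_one (by positivity) h1
  exact hp.one_lt.ne' (by exact_mod_cast this)

lemma extract {f : MvPolynomial (Fin 3) ℤ} {B : ℝ} (hB : 1 ≤ B) :
    ∃ v : Fin (Nproj f B) → Fin 3 → ℤ, (∀ j, eval (v j) f = 0) ∧
      (∀ j (p : ℕ), p.Prime → ∃ i, ¬ (p : ℤ) ∣ v j i) ∧
      (∀ j, (fun a => (v j a : ℚ)) ≠ 0) ∧
      (∀ i j, i ≠ j → ∀ c : ℚ, (fun a => (v i a : ℚ)) ≠ c • fun a => (v j a : ℚ)) ∧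
      (∀ j i, |v j i| ≤ (⌊B⌋₊ : ℤ)) := by
  classical
  set S : Set (Projectivization ℚ (Fin 3 → ℚ)) := {P | ∃ (v : Fin 3 → ℤ) (hv : (fun i => (v i : ℚ)) ≠ 0),
      Finset.univ.gcd v = 1 ∧
      MvPolynomial.eval v f = 0 ∧ (∀ i, |(v i : ℝ)| ≤ B) ∧
      P = Projectivization.mk ℚ (fun i => (v i : ℚ)) hv} with hS
  have hN : Nproj f B = S.ncard := rfl
  obtain ⟨e, he⟩ : ∃ e : Fin (Nproj f B) → S, Function.Injective e := by
    by_cases h0 : Nproj f B = 0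
    · rw [h0]
      exact ⟨Fin.elim0, fun x => x.elim0⟩
    · have hfin : S.Finite := Set.finite_of_ncard_ne_zero (by rw [← hN]; exact h0)
      have := hfin.fintype
      have hcard : Fintype.card S = Nproj f B := by
        rw [hN, ← Nat.card_coe_set_eq, Nat.card_eq_fintype_card]
      exact ⟨(Fintype.equivFinOfCardEq hcard).symm, Equiv.injective _⟩
  choose v hv hg hev hb hP using fun j => (e j).2
  refine ⟨v, hev, ?_, hv, ?_, ?_⟩
  · intro j p hp
    by_contra hcon
    push Not at hcon
    have h1 : (p : ℤ) ∣ Finset.univ.gcd (v j) := Finset.dvd_gcd fun i _ => hcon i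
    rw [hg j] at h1
    have := Int.eq_one_of_dvd_one (by positivity) h1
    exact hp.one_lt.ne' (by exact_mod_cast this)
  · intro i j hij c hc
    apply hij
    apply he
    apply Subtype.ext
    rw [hP i, hP j, Projectivization.mk_eq_mk_iff']
    exact ⟨c, hc.symm⟩
  · intro j i
    have h1 := hb j i
    have h2 : ((v j i).natAbs : ℝ) ≤ B := by
      rw [Nat.cast_natAbs, Int.cast_abs]; exact h1
    have h3 := Nat.le_floor h2
    rw [Int.abs_eq_natAbs]
    exact_mod_cast h3

open Classical in
lemma badness_exp {f : MvPolynomial (Fin 3) ℤ} {d : ℕ} (hd : 1 ≤ d) (hf : f.IsHomogeneous d)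
    (hirr : Irreducible (map (Int.castRingHom (AlgebraicClosure ℚ)) f)) (hdeg : f.totalDegree = d) :
    ∃ (L : ℝ) (good : ℕ → Prop), badness f = Real.exp L ∧
      (∀ (p : ℕ) [Fact p.Prime], 400 * d ^ 4 ≤ p → good p → Irreducible (map (Int.castRingHom (ZMod p)) f)) ∧
      ∀ s : ℕ, ∑ p ∈ (Nat.primesLE s).filter (fun p => 400 * d ^ 4 ≤ p ∧ ¬ good p), Real.log p / p ≤ L := by
  set T : Set ℕ := {p : ℕ | ∃ hp : Nat.Prime p,
        27 * f.totalDegree ^ 4 < p ∧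
        ¬ Irreducible (letI : Fact (Nat.Prime p) := ⟨hp⟩;
          MvPolynomial.map (Int.castRingHom (AlgebraicClosure (ZMod p))) f)} with hT
  have hd4 : 1 ≤ d ^ 4 := Nat.one_le_pow _ _ hd
  have hTfin : T.Finite := by
    obtain ⟨n, hn0, hn⟩ := bad_finite hd hf hirr
    refine Set.Finite.subset (Finset.finite_toSet n.natAbs.divisors) ?_
    rintro p ⟨hp, _, hpn⟩
    have : Fact p.Prime := ⟨hp⟩
    have h1 := hn p (AlgebraicClosure (ZMod p)) hpn
    rw [Finset.mem_coe, Nat.mem_divisors]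
    exact ⟨Int.natCast_dvd.1 h1, Int.natAbs_ne_zero.2 hn0⟩
  refine ⟨∑ p ∈ hTfin.toFinset, Real.log p / p, fun p => p ∉ T, ?_, ?_, ?_⟩
  · unfold badness
    rw [if_pos hirr, Real.exp_sum]
    exact finprod_mem_eq_finite_toFinset_prod _ hTfin
  · intro p hp h4 hg
    refine irr_of_ext (algebraMap (ZMod p) (AlgebraicClosure (ZMod p))) hd hf ?_
    by_contra hcon
    exact hg ⟨hp.out, by rw [hdeg]; omega, hcon⟩
  · intro s
    refine Finset.sum_le_sum_of_subset_of_nonneg ?_ ?_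
    · intro p hp
      simp only [Finset.mem_filter] at hp
      exact hTfin.mem_toFinset.2 (not_not.1 hp.2.2)
    · intro p _ _
      exact div_nonneg (Real.log_natCast_nonneg p) (Nat.cast_nonneg p)

lemma normMax_eq {f : MvPolynomial (Fin 3) ℤ} (hf0 : f ≠ 0) :
    ∃ m, coeff m f ≠ 0 ∧ normMax f = |((coeff m f : ℤ) : ℝ)| := by
  obtain ⟨m, hm, h⟩ := Finset.exists_mem_eq_sup f.support (support_nonempty.2 hf0) (fun m => (f.coeff m).natAbs)
  refine ⟨m, mem_support_iff.1 hm, ?_⟩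
  unfold normMax
  rw [h, Nat.cast_natAbs, Int.cast_abs]

theorem final (d : ℕ) (f : MvPolynomial (Fin 3) ℤ) (B : ℝ) (hd : 1 ≤ d) (hf : f.IsHomogeneous d)
    (hg : Finset.gcd f.support f.coeff = 1) (hirr : Irreducible (MvPolynomial.map (Int.castRingHom ℚ) f)) (hB : 1 ≤ B) :
    (Nproj f B : ℝ) ≤ (4 * Real.exp 706 + 3) * B ^ (2 / (d : ℝ)) * (d : ℝ) ^ 4 * badness f /
      (normMax f) ^ ((1 : ℝ) / (d : ℝ) ^ 2) + (4 * Real.exp 706 + 3) * (d : ℝ) * Real.log B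
       + (4 * Real.exp 706 + 3) * (d : ℝ) ^ 4 := by
  obtain ⟨v, hv, hvp, hv0, hvv, hvB⟩ := extract (f := f) hB
  have hE : 1 ≤ Real.exp 706 := Real.one_le_exp (by norm_num)
  set E := Real.exp 706 with hEdef
  have hd' : (1 : ℝ) ≤ d := by exact_mod_cast hd
  have hlB : 0 ≤ Real.log B := Real.log_nonneg hB
  have hd24 : (d : ℝ) ^ 2 ≤ d ^ 4 := pow_le_pow_right₀ hd' (by norm_num)
  have hd14 : (d : ℝ) ≤ d ^ 4 := le_self_pow₀ hd' (by norm_num)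
  by_cases habs : Irreducible (map (Int.castRingHom (AlgebraicClosure ℚ)) f)
  swap
  · have hbz : badness f = 0 := by unfold badness; rw [if_neg habs]
    rw [hbz, mul_zero, zero_div, zero_add]
    have h1 := not_abs_irr hd hf hirr habs (fun j a => (v j a : ℚ)) hv0 hvv (fun j => by
      have : Int.castRingHom ℚ (eval (v j) f) = 0 := by rw [hv j, map_zero]
      rw [eval_map, ← this, ← eval₂_id, eval₂_comp_left]
      rfl)
    rw [Fintype.card_fin] at h1
    have h2 : (Nproj f B : ℝ) ≤ d * d := by exact_mod_cast h1
    have h3 : 0 ≤ (4 * E + 3) * (d : ℝ) * Real.log B := by positivity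
    nlinarith
  have hf0 : f ≠ 0 := by
    rintro rfl
    exact hirr.ne_zero (map_zero _)
  obtain ⟨m₀, hm₀, hnorm⟩ := normMax_eq hf0
  obtain ⟨L, good, hbad, hgood, hL⟩ := badness_exp hd hf habs (hf.totalDegree hf0)
  have hnpos : 0 < normMax f := by
    rw [hnorm, abs_pos]; exact_mod_cast hm₀
  set n₀ := normMax f
  set Y : ℝ := B ^ (2 / (d : ℝ)) * (d : ℝ) ^ 4 * badness f / n₀ ^ ((1 : ℝ) / (d : ℝ) ^ 2) with hY
  have hBpos : 0 < B := by linarith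
  have hYexp : Y = Real.exp (4 * Real.log d + L + 2 / d * Real.log B - Real.log n₀ / d ^ 2) := by
    have e4 : Real.exp (4 * Real.log d) = (d : ℝ) ^ 4 := by
      rw [show (4 : ℝ) * Real.log d = ((4 : ℕ) : ℝ) * Real.log d by norm_num, Real.exp_nat_mul, Real.exp_log (by linarith)]
    rw [hY, hbad, Real.rpow_def_of_pos hBpos, Real.rpow_def_of_pos hnpos, Real.exp_sub, Real.exp_add, Real.exp_add, e4]
    rw [show Real.log n₀ * (1 / (d : ℝ) ^ 2) = Real.log n₀ / d ^ 2 by ring, mul_comm (Real.log B)]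
    ring
  have hYpos : 0 < Y := by rw [hYexp]; positivity
  set M := ⌈4 * E * Y / d + Real.log B + 2 * d⌉₊ with hMdef
  have hM1 : 4 * E * Y / d + Real.log B + 2 * d ≤ M := Nat.le_ceil _
  have hq : 0 ≤ 4 * E * Y / d := by positivity
  have hM2 : (M : ℝ) < 4 * E * Y / d + Real.log B + 2 * d + 1 := Nat.ceil_lt_add_one (by positivity)
  have hmain : Nproj f B ≤ d * M := by
    by_contra hcon
    push Not at hcon
    have hBf : 1 ≤ ⌊B⌋₊ := Nat.le_floor (by simpa using hB)
    have hBf' : Real.log (⌊B⌋₊ : ℝ) ≤ Real.log B :=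
      Real.log_le_log (by exact_mod_cast hBf) (Nat.floor_le hBpos.le)
    have hc := core2 hd hf (prim_of_gcd hg) hirr m₀ hm₀ (M := M)
      (by have : (2 * d : ℝ) ≤ M := by linarith
          exact_mod_cast this) v hv hvp hvv ⌊B⌋₊ hBf hvB (by linarith)
      (by rw [Fintype.card_fin]; exact hcon) good hgood L hL
    rw [← hnorm] at hc
    have hMpos : (0 : ℝ) < M := by linarith
    have h2 : 2 / (d : ℝ) * Real.log (⌊B⌋₊ : ℝ) ≤ 2 / d * Real.log B := by gcongr
    have h3 : Real.log (d * M / 2) ≤ (4 * Real.log d + L + 2 / d * Real.log B - Real.log n₀ / d ^ 2) + 706 := by linarith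
    rw [Real.log_le_iff_le_exp (by positivity), Real.exp_add, ← hYexp] at h3
    have h4 : 4 * E * Y ≤ d * M := by
      have : 4 * E * Y / d ≤ M := by linarith
      rw [div_le_iff₀ (by positivity)] at this
      linarith
    have : 0 < E * Y := by positivity
    linarith
  have hmain' : (Nproj f B : ℝ) ≤ d * M := by exact_mod_cast hmain
  have h5 : (d : ℝ) * M ≤ 4 * E * Y + d * Real.log B + 2 * d ^ 2 + d := by
    have : (d : ℝ) * M ≤ d * (4 * E * Y / d + Real.log B + 2 * d + 1) := by gcongr
    have h6 : (d : ℝ) * (4 * E * Y / d + Real.log B + 2 * d + 1) = 4 * E * Y + d * Real.log B + 2 * d ^ 2 + d := by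
      field_simp
    linarith
  have h7 : (4 * E + 3) * B ^ (2 / (d : ℝ)) * (d : ℝ) ^ 4 * badness f / n₀ ^ ((1 : ℝ) / (d : ℝ) ^ 2) = (4 * E + 3) * Y := by
    rw [hY]; ring
  rw [h7]
  have h8 : 0 ≤ (4 * E + 2) * (d * Real.log B) := by positivity
  have h9 : 0 ≤ 4 * E * (d : ℝ) ^ 4 := by positivity
  nlinarith

end PW

/-- **Precise Walsh bound for plane projective curves.** There is an absolute constant
`c > 0` such that for every primitive homogeneous `f ∈ ℤ[x_0,x_1,x_2]` of degree
`d ≥ 1` irreducible over `ℚ` and every `B ≥ 1`, one has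
`N(f,B) ≤ c·B^(2/d)·d^4·b(f)/‖f‖^(1/d²) + c·d·log B + c·d^4`. -/
theorem precise_walsh_planar_curve :
    ∃ c : ℝ, 0 < c ∧
      ∀ (d : ℕ) (f : MvPolynomial (Fin 3) ℤ) (B : ℝ),
        1 ≤ d → f.IsHomogeneous d →
        Finset.gcd f.support f.coeff = 1 →
        Irreducible (MvPolynomial.map (Int.castRingHom ℚ) f) →
        1 ≤ B →
        (Nproj f B : ℝ) ≤
          c * B ^ (2 / (d : ℝ)) * (d : ℝ) ^ 4 * badness f /
              (normMax f) ^ ((1 : ℝ) / (d : ℝ) ^ 2)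
            + c * (d : ℝ) * Real.log B + c * (d : ℝ) ^ 4 := by
  exact ⟨4 * Real.exp 706 + 3, by positivity, PW.final⟩
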